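/- Let E be the elliptic curve over ℚ defined by y² = x³ − x. Let a > 1 be a cube-free integer all of whose prime factors p satisfy p ∉ {2,3} and condition (P). Then every point of E over the field ℚ(ζ₃, ∛a) (the subfield of ℂ generated over ℚ by a primitive cube root of unity ζ₃ and the real cube root of a) is a torsion point. -/

import Mathlib

/-- The congruent number elliptic curve `y² = x³ - x` (Cremona label 32a2),
considered over an arbitrary commutative ring. -/
def Ecurve (F : Type*) [CommRing F] : WeierstrassCurve.Affine F :=
  { a₁ := 0, a₂ := 0, a₃ := 0, a₄ := -1, a₆ := 0 }

/-- Condition (P) on a prime `p ∉ {2,3}`: setting `f(p) = 1` if `p ≡ 1 (mod 3)` and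
`f(p) = 2` otherwise, the number of points of `y² = x³ - x` over the finite field with
`p ^ f(p)` elements is not divisible by `3`. -/
def ConditionP (p : ℕ) (hp : p.Prime) : Prop :=
  letI : Fact p.Prime := ⟨hp⟩
  ¬ (3 ∣ Nat.card (Ecurve (GaloisField p (if p % 3 = 1 then 1 else 2))).Point)

section

/-- A ternary cubic form, given by its ten coefficients. -/
@[ext] structure TernaryCubic (F : Type*) where
  (a b c a2 a3 b1 b3 c1 c2 m : F)

namespace TernaryCubic

variable {F : Type*} [CommRing F]

/-- The value of the ternary cubic at a vector. -/
def eval (U : TernaryCubic F) (v : Fin 3 → F) : F :=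
  U.a * v 0 ^ 3 + U.b * v 1 ^ 3 + U.c * v 2 ^ 3 + U.a2 * v 0 ^ 2 * v 1 + U.a3 * v 0 ^ 2 * v 2 +
    U.b1 * v 1 ^ 2 * v 0 + U.b3 * v 1 ^ 2 * v 2 + U.c1 * v 2 ^ 2 * v 0 + U.c2 * v 2 ^ 2 * v 1 +
    U.m * v 0 * v 1 * v 2

/-- The degree four invariant. -/
def c4 (U : TernaryCubic F) : F :=
    U.m^4 - 8*U.b1*U.c1*U.m^2 + 16*U.b1^2*U.c1^2 - 8*U.a3*U.b3*U.m^2 + 24*U.a3*U.b1*U.c2*U.m -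
    16*U.a3*U.b1*U.b3*U.c1 + 16*U.a3^2*U.b3^2 - 8*U.a2*U.c2*U.m^2 + 24*U.a2*U.b3*U.c1*U.m -
    16*U.a2*U.b1*U.c1*U.c2 - 16*U.a2*U.a3*U.b3*U.c2 + 16*U.a2^2*U.c2^2 - 48*U.c*U.a3*U.b1^2 +
    24*U.c*U.a2*U.b1*U.m - 48*U.c*U.a2^2*U.b3 + 24*U.b*U.a3*U.c1*U.m - 48*U.b*U.a3^2*U.c2 -
    48*U.b*U.a2*U.c1^2 + 144*U.b*U.c*U.a2*U.a3 + 24*U.a*U.b3*U.c2*U.m - 48*U.a*U.b3^2*U.c1 -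
    48*U.a*U.b1*U.c2^2 + 144*U.a*U.c*U.b1*U.b3 + 144*U.a*U.b*U.c1*U.c2 - 216*U.a*U.b*U.c*U.m

/-- The degree six invariant. -/
def c6 (U : TernaryCubic F) : F :=
    U.m^6 - 12*U.b1*U.c1*U.m^4 + 48*U.b1^2*U.c1^2*U.m^2 - 64*U.b1^3*U.c1^3 - 12*U.a3*U.b3*U.m^4 +
    36*U.a3*U.b1*U.c2*U.m^3 + 24*U.a3*U.b1*U.b3*U.c1*U.m^2 - 144*U.a3*U.b1^2*U.c1*U.c2*U.m +
    96*U.a3*U.b1^2*U.b3*U.c1^2 + 48*U.a3^2*U.b3^2*U.m^2 - 144*U.a3^2*U.b1*U.b3*U.c2*U.m +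
    96*U.a3^2*U.b1*U.b3^2*U.c1 + 216*U.a3^2*U.b1^2*U.c2^2 - 64*U.a3^3*U.b3^3 - 12*U.a2*U.c2*U.m^4 +
    36*U.a2*U.b3*U.c1*U.m^3 + 24*U.a2*U.b1*U.c1*U.c2*U.m^2 - 144*U.a2*U.b1*U.b3*U.c1^2*U.m +
    96*U.a2*U.b1^2*U.c1^2*U.c2 + 24*U.a2*U.a3*U.b3*U.c2*U.m^2 - 144*U.a2*U.a3*U.b3^2*U.c1*U.m -
    144*U.a2*U.a3*U.b1*U.c2^2*U.m + 48*U.a2*U.a3*U.b1*U.b3*U.c1*U.c2 + 96*U.a2*U.a3^2*U.b3^2*U.c2 +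
    48*U.a2^2*U.c2^2*U.m^2 - 144*U.a2^2*U.b3*U.c1*U.c2*U.m + 216*U.a2^2*U.b3^2*U.c1^2 +
    96*U.a2^2*U.b1*U.c1*U.c2^2 + 96*U.a2^2*U.a3*U.b3*U.c2^2 - 64*U.a2^3*U.c2^3 -
    72*U.c*U.a3*U.b1^2*U.m^2 + 288*U.c*U.a3*U.b1^3*U.c1 - 576*U.c*U.a3^2*U.b1^2*U.b3 +
    36*U.c*U.a2*U.b1*U.m^3 - 144*U.c*U.a2*U.b1^2*U.c1*U.m + 720*U.c*U.a2*U.a3*U.b1*U.b3*U.m -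
    144*U.c*U.a2*U.a3*U.b1^2*U.c2 - 72*U.c*U.a2^2*U.b3*U.m^2 - 144*U.c*U.a2^2*U.b1*U.c2*U.m -
    144*U.c*U.a2^2*U.b1*U.b3*U.c1 - 576*U.c*U.a2^2*U.a3*U.b3^2 + 288*U.c*U.a2^3*U.b3*U.c2 +
    216*U.c^2*U.a2^2*U.b1^2 + 36*U.b*U.a3*U.c1*U.m^3 - 144*U.b*U.a3*U.b1*U.c1^2*U.m -
    72*U.b*U.a3^2*U.c2*U.m^2 - 144*U.b*U.a3^2*U.b3*U.c1*U.m - 144*U.b*U.a3^2*U.b1*U.c1*U.c2 +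
    288*U.b*U.a3^3*U.b3*U.c2 - 72*U.b*U.a2*U.c1^2*U.m^2 + 288*U.b*U.a2*U.b1*U.c1^3 +
    720*U.b*U.a2*U.a3*U.c1*U.c2*U.m - 144*U.b*U.a2*U.a3*U.b3*U.c1^2 - 576*U.b*U.a2*U.a3^2*U.c2^2 -
    576*U.b*U.a2^2*U.c1^2*U.c2 + 864*U.b*U.c*U.a3^2*U.b1*U.m - 648*U.b*U.c*U.a2*U.a3*U.m^2 -
    1296*U.b*U.c*U.a2*U.a3*U.b1*U.c1 + 864*U.b*U.c*U.a2*U.a3^2*U.b3 + 864*U.b*U.c*U.a2^2*U.c1*U.m +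
    864*U.b*U.c*U.a2^2*U.a3*U.c2 - 864*U.b*U.c^2*U.a2^3 + 216*U.b^2*U.a3^2*U.c1^2 -
    864*U.b^2*U.c*U.a3^3 + 36*U.a*U.b3*U.c2*U.m^3 - 72*U.a*U.b3^2*U.c1*U.m^2 -
    72*U.a*U.b1*U.c2^2*U.m^2 + 720*U.a*U.b1*U.b3*U.c1*U.c2*U.m - 576*U.a*U.b1*U.b3^2*U.c1^2 -
    576*U.a*U.b1^2*U.c1*U.c2^2 - 144*U.a*U.a3*U.b3^2*U.c2*U.m + 288*U.a*U.a3*U.b3^3*U.c1 -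
    144*U.a*U.a3*U.b1*U.b3*U.c2^2 - 144*U.a*U.a2*U.b3*U.c2^2*U.m - 144*U.a*U.a2*U.b3^2*U.c1*U.c2 +
    288*U.a*U.a2*U.b1*U.c2^3 - 648*U.a*U.c*U.b1*U.b3*U.m^2 + 864*U.a*U.c*U.b1^2*U.c2*U.m +
    864*U.a*U.c*U.b1^2*U.b3*U.c1 + 864*U.a*U.c*U.a3*U.b1*U.b3^2 + 864*U.a*U.c*U.a2*U.b3^2*U.m -
    1296*U.a*U.c*U.a2*U.b1*U.b3*U.c2 - 864*U.a*U.c^2*U.b1^3 - 648*U.a*U.b*U.c1*U.c2*U.m^2 +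
    864*U.a*U.b*U.b3*U.c1^2*U.m + 864*U.a*U.b*U.b1*U.c1^2*U.c2 + 864*U.a*U.b*U.a3*U.c2^2*U.m -
    1296*U.a*U.b*U.a3*U.b3*U.c1*U.c2 + 864*U.a*U.b*U.a2*U.c1*U.c2^2 + 540*U.a*U.b*U.c*U.m^3 -
    1296*U.a*U.b*U.c*U.b1*U.c1*U.m - 1296*U.a*U.b*U.c*U.a3*U.b3*U.m -
    1296*U.a*U.b*U.c*U.a3*U.b1*U.c2 - 1296*U.a*U.b*U.c*U.a2*U.c2*U.m -
    1296*U.a*U.b*U.c*U.a2*U.b3*U.c1 + 3888*U.a*U.b*U.c^2*U.a2*U.b1 - 864*U.a*U.b^2*U.c1^3 +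
    3888*U.a*U.b^2*U.c*U.a3*U.c1 + 216*U.a^2*U.b3^2*U.c2^2 - 864*U.a^2*U.c*U.b3^3 -
    864*U.a^2*U.b*U.c2^3 + 3888*U.a^2*U.b*U.c*U.b3*U.c2 - 5832*U.a^2*U.b^2*U.c^2

/-- Substitution of `y + t * x` for `y`. -/
def shear (U : TernaryCubic F) (t : F) : TernaryCubic F where
  a := U.a + U.a2 * t + U.b1 * t ^ 2 + U.b * t ^ 3
  b := U.b
  c := U.c
  a2 := U.a2 + 2 * U.b1 * t + 3 * U.b * t ^ 2
  a3 := U.a3 + U.m * t + U.b3 * t ^ 2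
  b1 := U.b1 + 3 * U.b * t
  b3 := U.b3
  c1 := U.c1 + U.c2 * t
  c2 := U.c2
  m := U.m + 2 * U.b3 * t

lemma eval_shear (U : TernaryCubic F) (t : F) (v : Fin 3 → F) :
    (U.shear t).eval v = U.eval ![v 0, v 1 + t * v 0, v 2] := by
  simp [eval, shear]; ring

lemma c4_shear (U : TernaryCubic F) (t : F) : (U.shear t).c4 = U.c4 := by
  simp only [c4, shear]; ring

lemma c6_shear (U : TernaryCubic F) (t : F) : (U.shear t).c6 = U.c6 := by
  simp only [c6, shear]; ring

end TernaryCubic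

end

section

namespace TernaryCubic

variable {F : Type*} [Field F]

/-- Exchange of the first two variables. -/
def swap01 (U : TernaryCubic F) : TernaryCubic F :=
  ⟨U.b, U.a, U.c, U.b1, U.b3, U.a2, U.a3, U.c2, U.c1, U.m⟩

/-- Exchange of the last two variables. -/
def swap12 (U : TernaryCubic F) : TernaryCubic F :=
  ⟨U.a, U.c, U.b, U.a3, U.a2, U.c1, U.c2, U.b1, U.b3, U.m⟩

/-- Rescaling of the variables. -/
def diag (U : TernaryCubic F) (k l n : F) : TernaryCubic F :=
  ⟨U.a * k ^ 3, U.b * l ^ 3, U.c * n ^ 3, U.a2 * k ^ 2 * l, U.a3 * k ^ 2 * n, U.b1 * l ^ 2 * k,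
    U.b3 * l ^ 2 * n, U.c1 * n ^ 2 * k, U.c2 * n ^ 2 * l, U.m * k * l * n⟩

/-- Multiplication by a constant. -/
def scale (U : TernaryCubic F) (k : F) : TernaryCubic F :=
  ⟨U.a * k, U.b * k, U.c * k, U.a2 * k, U.a3 * k, U.b1 * k, U.b3 * k, U.c1 * k, U.c2 * k, U.m * k⟩

/-- `U` is obtained from `V` by a linear substitution and multiplication by a constant, of total
determinant `δ`. -/
def Eqv (U V : TernaryCubic F) (δ : F) : Prop :=
  ∃ (g : Matrix (Fin 3) (Fin 3) F) (ν : F), ν * g.det = δ ∧ δ ≠ 0 ∧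
    (∀ v, U.eval v = ν * V.eval (g.mulVec v)) ∧ U.c4 = δ ^ 4 * V.c4 ∧ U.c6 = δ ^ 6 * V.c6

lemma Eqv.trans {U V W : TernaryCubic F} {δ ε : F} (h : Eqv U V δ) (k : Eqv V W ε) :
    Eqv U W (δ * ε) := by
  obtain ⟨g, ν, h1, h2, h3, h4, h5⟩ := h
  obtain ⟨g', ν', k1, k2, k3, k4, k5⟩ := k
  refine ⟨g' * g, ν * ν', ?_, mul_ne_zero h2 k2, fun v => ?_, ?_, ?_⟩
  · rw [Matrix.det_mul, ← h1, ← k1]; ring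
  · rw [h3, k3, Matrix.mulVec_mulVec]; ring
  · rw [h4, k4]; ring
  · rw [h5, k5]; ring

lemma mulVec_fin_three (g : Matrix (Fin 3) (Fin 3) F) (v : Fin 3 → F) :
    g.mulVec v = ![g 0 0 * v 0 + g 0 1 * v 1 + g 0 2 * v 2,
      g 1 0 * v 0 + g 1 1 * v 1 + g 1 2 * v 2, g 2 0 * v 0 + g 2 1 * v 1 + g 2 2 * v 2] := by
  ext i; fin_cases i <;> simp [Matrix.mulVec, dotProduct, Fin.sum_univ_three]

lemma eqv_shear (U : TernaryCubic F) (t : F) : Eqv U (U.shear t) 1 := by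
  refine ⟨!![1, 0, 0; -t, 1, 0; 0, 0, 1], 1, ?_, one_ne_zero, fun v => ?_, ?_, ?_⟩
  · simp [Matrix.det_fin_three]
  · rw [eval_shear, mulVec_fin_three]; simp [eval]
  · rw [c4_shear]; ring
  · rw [c6_shear]; ring

lemma eqv_swap01 (U : TernaryCubic F) : Eqv U U.swap01 (-1) := by
  refine ⟨!![0, 1, 0; 1, 0, 0; 0, 0, 1], 1, ?_, by simp, fun v => ?_, ?_, ?_⟩
  · simp [Matrix.det_fin_three]
  · rw [mulVec_fin_three]; simp [eval, swap01]; ring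
  · simp only [c4, swap01]; ring
  · simp only [c6, swap01]; ring

lemma eqv_swap12 (U : TernaryCubic F) : Eqv U U.swap12 (-1) := by
  refine ⟨!![1, 0, 0; 0, 0, 1; 0, 1, 0], 1, ?_, by simp, fun v => ?_, ?_, ?_⟩
  · simp [Matrix.det_fin_three]
  · rw [mulVec_fin_three]; simp [eval, swap12]; ring
  · simp only [c4, swap12]; ring
  · simp only [c6, swap12]; ring

lemma eqv_diag (U : TernaryCubic F) {k l n : F} (hk : k ≠ 0) (hl : l ≠ 0) (hn : n ≠ 0) :
    Eqv U (U.diag k l n) (k * l * n)⁻¹ := by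
  refine ⟨!![k⁻¹, 0, 0; 0, l⁻¹, 0; 0, 0, n⁻¹], 1, ?_, by simp [hk, hl, hn], fun v => ?_, ?_, ?_⟩
  · simp [Matrix.det_fin_three]; ring
  · rw [mulVec_fin_three]; simp [eval, diag]; field_simp
  · have : (U.diag k l n).c4 = (k * l * n) ^ 4 * U.c4 := by simp only [c4, diag]; ring
    rw [this]; field_simp
  · have : (U.diag k l n).c6 = (k * l * n) ^ 6 * U.c6 := by simp only [c6, diag]; ring
    rw [this]; field_simp

lemma eqv_scale (U : TernaryCubic F) {k : F} (hk : k ≠ 0) : Eqv U (U.scale k) k⁻¹ := by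
  refine ⟨1, k⁻¹, by simp, by simp [hk], fun v => ?_, ?_, ?_⟩
  · simp [eval, scale]; field_simp
  · have : (U.scale k).c4 = k ^ 4 * U.c4 := by simp only [c4, scale]; ring
    rw [this]; field_simp
  · have : (U.scale k).c6 = k ^ 6 * U.c6 := by simp only [c6, scale]; ring
    rw [this]; field_simp

/-- The tangent-line normal form attached to a point `(x₀, y₀)` of `y² = x³ + a₄ x + a₆`. -/
def tate (x₀ y₀ a₄ : F) : TernaryCubic F :=
  ⟨0, 0, -(x₀ ^ 2 + a₄), 1, -x₀, 0, -1, -2 * y₀, -x₀, 0⟩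

/-- The Weierstrass cubic `y² z - x³ - a₄ x z² - a₆ z³`, in the variables `(x, y, z)`. -/
def weier (a₄ a₆ : F) : TernaryCubic F :=
  ⟨-1, 0, -a₆, 0, 0, 0, 1, -a₄, 0, 0⟩

end TernaryCubic

end

section

namespace TernaryCubic

variable {F : Type*} [Field F]

/-- Equivalence of ternary cubics, with unspecified determinant. -/
def Rel (U V : TernaryCubic F) : Prop := ∃ δ, Eqv U V δ

lemma Rel.trans {U V W : TernaryCubic F} (h : Rel U V) (k : Rel V W) : Rel U W := by
  obtain ⟨δ, h⟩ := h
  obtain ⟨ε, k⟩ := k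
  exact ⟨_, h.trans k⟩

lemma Rel.c4_ne_zero {U V : TernaryCubic F} (h : Rel U V) (hU : U.c4 ≠ 0) : V.c4 ≠ 0 := by
  obtain ⟨δ, g, ν, -, -, -, h4, -⟩ := h
  rintro h0
  rw [h0, mul_zero] at h4
  exact hU h4

lemma Rel.c6_eq_zero {U V : TernaryCubic F} (h : Rel U V) (hU : U.c6 = 0) : V.c6 = 0 := by
  obtain ⟨δ, g, ν, -, hδ, -, -, h6⟩ := h
  rw [hU] at h6
  exact (mul_eq_zero.1 h6.symm).resolve_left (pow_ne_zero _ hδ)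

lemma rel_shear (U : TernaryCubic F) (t : F) : Rel U (U.shear t) := ⟨_, U.eqv_shear t⟩
lemma rel_swap01 (U : TernaryCubic F) : Rel U U.swap01 := ⟨_, U.eqv_swap01⟩
lemma rel_swap12 (U : TernaryCubic F) : Rel U U.swap12 := ⟨_, U.eqv_swap12⟩

/-- Substitution of `x + t * y` for `x`. -/
def shear01 (U : TernaryCubic F) (t : F) : TernaryCubic F := (U.swap01.shear t).swap01

/-- Substitution of `z + t * x` for `z`. -/
def shear20 (U : TernaryCubic F) (t : F) : TernaryCubic F := (U.swap12.shear t).swap12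

/-- Substitution of `z + t * y` for `z`. -/
def shear21 (U : TernaryCubic F) (t : F) : TernaryCubic F :=
  (U.swap01.swap12.shear t).swap12.swap01

/-- Substitution of `x + t * z` for `x`. -/
def shear02 (U : TernaryCubic F) (t : F) : TernaryCubic F :=
  (U.swap12.swap01.shear t).swap01.swap12

/-- Substitution of `y + t * z` for `y`. -/
def shear12 (U : TernaryCubic F) (t : F) : TernaryCubic F :=
  (U.swap01.swap12.swap01.shear t).swap01.swap12.swap01

lemma rel_shear01 (U : TernaryCubic F) (t : F) : Rel U (U.shear01 t) :=
  ((rel_swap01 _).trans (rel_shear _ t)).trans (rel_swap01 _)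
lemma rel_shear20 (U : TernaryCubic F) (t : F) : Rel U (U.shear20 t) :=
  ((rel_swap12 _).trans (rel_shear _ t)).trans (rel_swap12 _)
lemma rel_shear21 (U : TernaryCubic F) (t : F) : Rel U (U.shear21 t) :=
  ((((rel_swap01 _).trans (rel_swap12 _)).trans (rel_shear _ t)).trans (rel_swap12 _)).trans
    (rel_swap01 _)
lemma rel_shear02 (U : TernaryCubic F) (t : F) : Rel U (U.shear02 t) :=
  ((((rel_swap12 _).trans (rel_swap01 _)).trans (rel_shear _ t)).trans (rel_swap01 _)).trans
    (rel_swap12 _)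
lemma rel_shear12 (U : TernaryCubic F) (t : F) : Rel U (U.shear12 t) :=
  ((((((rel_swap01 _).trans (rel_swap12 _)).trans (rel_swap01 _)).trans (rel_shear _ t)).trans
    (rel_swap01 _)).trans (rel_swap12 _)).trans (rel_swap01 _)

lemma exists_rel_b_aux (U : TernaryCubic F) {v : Fin 3 → F} (hv : v 1 ≠ 0) (h : U.eval v = 0) :
    ∃ V, Rel U V ∧ V.b = 0 := by
  refine ⟨(U.shear01 (v 0 / v 1)).shear21 (v 2 / v 1), (rel_shear01 _ _).trans (rel_shear21 _ _),
    ?_⟩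
  have h' : U.eval v / v 1 ^ 3 = 0 := by rw [h, zero_div]
  rw [← h']
  simp only [shear01, shear21, swap01, swap12, shear, eval]
  field_simp
  ring

lemma exists_rel_b (U : TernaryCubic F) {v : Fin 3 → F} (hv : v ≠ 0) (h : U.eval v = 0) :
    ∃ V, Rel U V ∧ V.b = 0 := by
  by_cases h1 : v 1 = 0
  · by_cases h0 : v 0 = 0
    · have h2 : v 2 ≠ 0 := by
        intro h2; apply hv; ext i; fin_cases i <;> simp [h0, h1, h2]
      obtain ⟨V, hV, hb⟩ := exists_rel_b_aux U.swap12 (v := ![v 0, v 2, v 1]) (by simpa)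
        (by rw [← h]; simp [eval, swap12]; ring)
      exact ⟨V, (rel_swap12 _).trans hV, hb⟩
    · obtain ⟨V, hV, hb⟩ := exists_rel_b_aux U.swap01 (v := ![v 1, v 0, v 2]) (by simpa)
        (by rw [← h]; simp [eval, swap01]; ring)
      exact ⟨V, (rel_swap01 _).trans hV, hb⟩
  · exact exists_rel_b_aux U h1 h

lemma exists_rel_b1 (U : TernaryCubic F) (hb : U.b = 0) (h4 : U.c4 ≠ 0) (h6 : U.c6 = 0) :
    ∃ V, Rel U V ∧ V.b = 0 ∧ V.b1 = 0 ∧ V.b3 ≠ 0 := by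
  by_cases h3 : U.b3 = 0
  · by_cases h1 : U.b1 = 0
    · exfalso
      have e4 : U.c4 = (U.m ^ 2 - 4 * U.a2 * U.c2) ^ 2 := by simp [c4, hb, h1, h3]; ring
      have e6 : U.c6 = (U.m ^ 2 - 4 * U.a2 * U.c2) ^ 3 := by simp [c6, hb, h1, h3]; ring
      rw [h6] at e6
      apply h4
      rw [e4, (pow_eq_zero_iff three_ne_zero).1 e6.symm]; simp
    · refine ⟨U.swap01.swap12.swap01, ((rel_swap01 _).trans (rel_swap12 _)).trans (rel_swap01 _),
        by simpa [swap01, swap12], by simpa [swap01, swap12], by simpa [swap01, swap12]⟩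
  · refine ⟨U.shear20 (-U.b1 / U.b3), rel_shear20 _ _, ?_, ?_, ?_⟩ <;>
      simp [shear20, shear, swap12, hb, h3]
    field_simp; ring

variable [CharZero F]

lemma exists_rel_weier (U : TernaryCubic F) (hb : U.b = 0) (h1 : U.b1 = 0) (h3 : U.b3 ≠ 0)
    (h2 : U.a2 = 0) (h4 : U.c4 ≠ 0) (h6 : U.c6 = 0) : ∃ a₄, Rel U (weier a₄ 0) := by
  have ha : U.a ≠ 0 := by
    intro ha
    have e4 : U.c4 = (U.m ^ 2 - 4 * U.a3 * U.b3) ^ 2 := by simp [c4, hb, h1, h2, ha]; ring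
    have e6 : U.c6 = (U.m ^ 2 - 4 * U.a3 * U.b3) ^ 3 := by simp [c6, hb, h1, h2, ha]; ring
    rw [h6] at e6
    apply h4
    rw [e4, (pow_eq_zero_iff three_ne_zero).1 e6.symm]; simp
  obtain ⟨V, hUV, hVa, hVb, hVb3, hVa2, hVb1, hVm⟩ : ∃ V, Rel U V ∧ V.a ≠ 0 ∧ V.b = 0 ∧
      V.b3 ≠ 0 ∧ V.a2 = 0 ∧ V.b1 = 0 ∧ V.m = 0 := by
    refine ⟨_, rel_shear U (-U.m / (2 * U.b3)), ?_⟩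
    simp only [shear, hb, h1, h2]
    refine ⟨by simpa, trivial, h3, by simp, by simp, by field_simp; ring⟩
  obtain ⟨W, hVW, hWa, hWb, hWb3, hWa2, hWb1, hWm, hWc2⟩ : ∃ W, Rel V W ∧ W.a ≠ 0 ∧ W.b = 0 ∧
      W.b3 ≠ 0 ∧ W.a2 = 0 ∧ W.b1 = 0 ∧ W.m = 0 ∧ W.c2 = 0 := by
    refine ⟨_, rel_shear12 V (-V.c2 / (2 * V.b3)), ?_⟩
    simp only [shear12, swap01, swap12, shear, hVa2, hVb, hVb1, hVm]
    refine ⟨by simpa, trivial, by simpa, by simp, by simp, by simp, by field_simp; ring⟩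
  obtain ⟨X, hWX, hXa, hXb, hXb3, hXa2, hXb1, hXm, hXc2, hXa3⟩ : ∃ X, Rel W X ∧ X.a ≠ 0 ∧
      X.b = 0 ∧ X.b3 ≠ 0 ∧ X.a2 = 0 ∧ X.b1 = 0 ∧ X.m = 0 ∧ X.c2 = 0 ∧ X.a3 = 0 := by
    refine ⟨_, rel_shear02 W (-W.a3 / (3 * W.a)), ?_⟩
    simp only [shear02, swap01, swap12, shear, hWa2, hWb, hWb1, hWm, hWc2]
    refine ⟨by simpa, trivial, by simpa, by simp, by simp, by simp, by simp, by field_simp; ring⟩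
  have hUX := (hUV.trans hVW).trans hWX
  have e : (X.scale (-1 / X.a)).diag 1 1 (-X.a / X.b3) =
      weier (X.c1 * X.a / X.b3 ^ 2) (-X.c * X.a ^ 2 / X.b3 ^ 3) := by
    ext <;> simp [scale, diag, weier, hXb, hXa2, hXb1, hXm, hXc2, hXa3] <;> field_simp
  have r : Rel U (weier (X.c1 * X.a / X.b3 ^ 2) (-X.c * X.a ^ 2 / X.b3 ^ 3)) := by
    rw [← e]
    exact (hUX.trans ⟨_, eqv_scale _ (by simpa)⟩).trans
      ⟨_, eqv_diag _ one_ne_zero one_ne_zero (by simp [hXa, hXb3])⟩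
  have h := r.c6_eq_zero h6
  have h0 : -X.c * X.a ^ 2 / X.b3 ^ 3 = 0 := by
    simpa [c6, weier] using h
  rw [h0] at r
  exact ⟨_, r⟩

lemma exists_rel_tate (U : TernaryCubic F) (hb : U.b = 0) (h1 : U.b1 = 0) (h3 : U.b3 ≠ 0)
    (h2 : U.a2 ≠ 0) (h6 : U.c6 = 0) :
    ∃ x₀ y₀ a₄, y₀ ^ 2 = x₀ ^ 3 + a₄ * x₀ ∧ Rel U (tate x₀ y₀ a₄) := by
  obtain ⟨V, hUV, hVa, hVb, hVb3, hVa2, hVb1⟩ : ∃ V, Rel U V ∧ V.a = 0 ∧ V.b = 0 ∧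
      V.b3 ≠ 0 ∧ V.a2 ≠ 0 ∧ V.b1 = 0 := by
    refine ⟨_, rel_shear U (-U.a / U.a2), ?_⟩
    simp only [shear, hb, h1]
    refine ⟨by field_simp; ring, trivial, h3, by simpa, by simp⟩
  obtain ⟨W, hVW, hWa, hWb, hWb3, hWa2, hWb1, hWm⟩ : ∃ W, Rel V W ∧ W.a = 0 ∧ W.b = 0 ∧
      W.b3 ≠ 0 ∧ W.a2 ≠ 0 ∧ W.b1 = 0 ∧ W.m = 0 := by
    refine ⟨_, rel_shear02 V (-V.m / (2 * V.a2)), ?_⟩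
    simp only [shear02, swap01, swap12, shear, hVa, hVb, hVb1]
    refine ⟨trivial, trivial, by simpa, by simpa, by simp, by field_simp; ring⟩
  obtain ⟨X, hWX, hXa, hXb, hXb3, hXa2, hXb1, hXm, hX⟩ : ∃ X, Rel W X ∧ X.a = 0 ∧
      X.b = 0 ∧ X.b3 ≠ 0 ∧ X.a2 ≠ 0 ∧ X.b1 = 0 ∧ X.m = 0 ∧ X.a3 * X.b3 = -(X.a2 * X.c2) := by
    refine ⟨_, rel_shear12 W (-(W.a3 * W.b3 + W.a2 * W.c2) / (3 * W.a2 * W.b3)), ?_⟩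
    simp only [shear12, swap01, swap12, shear, hWa, hWb, hWb1, hWm]
    refine ⟨trivial, trivial, by simpa, by simpa, by simp, by simp, by field_simp; ring⟩
  have hUX := (hUV.trans hVW).trans hWX
  obtain ⟨x₀, hx₀⟩ : ∃ x₀, X.b3 * x₀ = X.a3 := ⟨X.a3 / X.b3, by field_simp⟩
  have e : (X.scale (1 / X.a2)).diag 1 1 (-X.a2 / X.b3) =
      tate x₀ (-X.c1 * X.a2 / (2 * X.b3 ^ 2)) (X.c * X.a2 ^ 2 / X.b3 ^ 3 - x₀ ^ 2) := by
    ext <;> simp [scale, diag, tate, hXb, hXa, hXb1, hXm] <;> field_simp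
    · linear_combination hx₀
    · linear_combination hX + X.b3 * hx₀
  have r : Rel U _ := (hUX.trans ⟨_, eqv_scale X (k := 1 / X.a2) (by simpa)⟩).trans
      ⟨_, eqv_diag _ one_ne_zero one_ne_zero (n := -X.a2 / X.b3) (by simp [hXa2, hXb3])⟩
  rw [e] at r
  refine ⟨_, _, _, ?_, r⟩
  have h := r.c6_eq_zero h6
  simp only [c6, tate] at h
  have h864 : (864 : F) ≠ 0 := by norm_num
  apply mul_left_cancel₀ h864
  linear_combination h

/-- A ternary cubic with `c₆ = 0`, `c₄ ≠ 0` and a rational point is equivalent to one of the two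
normal forms. -/
lemma exists_rel_normal (U : TernaryCubic F) (h4 : U.c4 ≠ 0) (h6 : U.c6 = 0) {v : Fin 3 → F}
    (hv : v ≠ 0) (h : U.eval v = 0) :
    (∃ x₀ y₀ a₄, y₀ ^ 2 = x₀ ^ 3 + a₄ * x₀ ∧ Rel U (tate x₀ y₀ a₄)) ∨
      ∃ a₄, Rel U (weier a₄ 0) := by
  obtain ⟨V, hUV, hb⟩ := exists_rel_b U hv h
  obtain ⟨W, hVW, hb, h1, h3⟩ := exists_rel_b1 V hb (hUV.c4_ne_zero h4) (hUV.c6_eq_zero h6)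
  have hUW := hUV.trans hVW
  by_cases h2 : W.a2 = 0
  · obtain ⟨a₄, r⟩ := exists_rel_weier W hb h1 h3 h2 (hUW.c4_ne_zero h4) (hUW.c6_eq_zero h6)
    exact Or.inr ⟨a₄, hUW.trans r⟩
  · obtain ⟨x₀, y₀, a₄, e, r⟩ := exists_rel_tate W hb h1 h3 h2 (hUW.c6_eq_zero h6)
    exact Or.inl ⟨x₀, y₀, a₄, e, hUW.trans r⟩

/-- The normal forms with prescribed Jacobian `y² = x³ - d x`. -/
lemma exists_eqv_normal (U : TernaryCubic F) {d κ : F} (hd : d ≠ 0) (hκ : κ ≠ 0)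
    (h4 : U.c4 = 48 * d * κ ^ 4) (h6 : U.c6 = 0) {v : Fin 3 → F} (hv : v ≠ 0)
    (h : U.eval v = 0) :
    (∃ x₀ y₀, y₀ ^ 2 = x₀ ^ 3 - d * x₀ ∧ Eqv U (tate x₀ y₀ (-d)) κ) ∨
      Eqv U (weier (-d) 0) κ := by
  have h48 : (48 : F) ≠ 0 := by norm_num
  have h4' : U.c4 ≠ 0 := by rw [h4]; simp [hd, hκ]
  have key : ∀ {V a₄ δ}, Eqv U V δ → V.c4 = -48 * a₄ →
      δ / κ ≠ 0 ∧ a₄ * (δ / κ) ^ 4 = -d ∧ δ = κ * (δ / κ) := by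
    intro V a₄ δ r hV
    obtain ⟨_, _, _, hδ, _, hc, _⟩ := r
    refine ⟨div_ne_zero hδ hκ, ?_, by field_simp⟩
    rw [h4, hV] at hc
    field_simp
    apply mul_left_cancel₀ h48
    linear_combination hc
  rcases exists_rel_normal U h4' h6 hv h with ⟨x₀, y₀, a₄, e, δ, r⟩ | ⟨a₄, δ, r⟩
  · left
    obtain ⟨hρ, ha, hδ⟩ := key (a₄ := a₄) r (by simp only [c4, tate]; ring)
    set ρ := δ / κ
    refine ⟨x₀ * ρ ^ 2, y₀ * ρ ^ 3, by linear_combination ρ ^ 6 * e + x₀ * ρ ^ 2 * ha, ?_⟩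
    have e : ((tate x₀ y₀ a₄).diag ρ⁻¹ (ρ⁻¹ ^ 2) 1).scale (ρ ^ 4) =
        tate (x₀ * ρ ^ 2) (y₀ * ρ ^ 3) (-d) := by
      rw [← ha]
      ext <;> simp [diag, scale, tate] <;> field_simp
    have := (r.trans (eqv_diag _ (k := ρ⁻¹) (l := ρ⁻¹ ^ 2) (n := 1) (by simpa) (by simpa)
      one_ne_zero)).trans (eqv_scale _ (k := ρ ^ 4) (by simpa))
    rw [e] at this
    convert this using 1
    rw [hδ]; field_simp
  · right
    obtain ⟨hρ, ha, hδ⟩ := key (a₄ := a₄) r (by simp only [c4, weier]; ring)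
    set ρ := δ / κ
    have e : ((weier a₄ 0).diag (ρ⁻¹ ^ 2) (ρ⁻¹ ^ 3) 1).scale (ρ ^ 6) = weier (-d) 0 := by
      rw [← ha]
      ext <;> simp [diag, scale, weier] <;> field_simp
    have := (r.trans (eqv_diag _ (k := ρ⁻¹ ^ 2) (l := ρ⁻¹ ^ 3) (n := 1) (by simpa) (by simpa)
      one_ne_zero)).trans (eqv_scale _ (k := ρ ^ 6) (by simpa))
    rw [e] at this
    convert this using 1
    rw [hδ]; field_simp

end TernaryCubic

end

section

namespace TernaryCubic

section translation

variable {F : Type*} [Field F]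

lemma eqv_tate_translate {x₀ y₀ a₄ : F} (h : y₀ ^ 2 = x₀ ^ 3 + a₄ * x₀) (hx : x₀ ≠ 0)
    (ha : a₄ ≠ 0) :
    Eqv (tate x₀ y₀ a₄) (tate (a₄ / x₀) (-a₄ * y₀ / x₀ ^ 2) a₄) 1 := by
  refine ⟨!![x₀, y₀ / x₀, y₀; 0, 0, a₄; 0, 1, 0], -1 / (a₄ * x₀), ?_, one_ne_zero, fun v => ?_,
    ?_, ?_⟩
  · simp [Matrix.det_fin_three]; field_simp
  · rw [mulVec_fin_three]
    simp [eval, tate]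
    field_simp
    linear_combination (v 2 * (x₀ ^ 3 * v 2 ^ 2 + 2 * x₀ ^ 2 * v 1 * v 2 + x₀ * v 1 ^ 2) + v 1 ^ 3 -
      x₀ ^ 2 * v 2 ^ 2 * v 1) * h
  · simp only [c4, tate]; ring
  · simp only [c6, tate]; field_simp; linear_combination 864 * (x₀ ^ 6 - x₀ ^ 2 * a₄ ^ 2) * h

end translation

variable {p : ℕ} [hp : Fact p.Prime]

/-- An integral model over `ℤ_p` of a ternary cubic. -/
def LocalModel (U : TernaryCubic ℚ_[p]) (κ : ℚ_[p]) : Prop :=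
  ∃ (g : Matrix (Fin 3) (Fin 3) ℚ_[p]) (ν : ℚ_[p]), ‖ν * g.det‖ = ‖κ‖ ∧
    ∀ v, (∀ i, ‖g.mulVec v i‖ ≤ 1) → ‖U.eval v‖ ≤ ‖ν‖

/-- An integral model over `ℤ_p` of a ternary cubic, which is divisible by `p` outside of a
line. -/
def LocalModelLine (U : TernaryCubic ℚ_[p]) (κ : ℚ_[p]) : Prop :=
  ∃ (g : Matrix (Fin 3) (Fin 3) ℚ_[p]) (ν : ℚ_[p]), ‖ν * g.det‖ = ‖κ‖ ∧
    (∀ v, (∀ i, ‖g.mulVec v i‖ ≤ 1) → ‖U.eval v‖ ≤ ‖ν‖) ∧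
    ∀ v, (∀ i, ‖g.mulVec v i‖ ≤ 1) → ‖g.mulVec v 2‖ = 1 → p * ‖U.eval v‖ ≤ ‖ν‖

lemma Eqv.localModel {U V : TernaryCubic ℚ_[p]} {κ : ℚ_[p]} (h : Eqv U V κ)
    (hV : LocalModel V 1) : LocalModel U κ := by
  obtain ⟨g, ν, h1, -, h2, -, -⟩ := h
  obtain ⟨g', ν', k1, k2⟩ := hV
  refine ⟨g' * g, ν * ν', ?_, fun v hv => ?_⟩
  · rw [Matrix.det_mul, ← h1, show ν * ν' * (g'.det * g.det) = (ν * g.det) * (ν' * g'.det) by ring,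
      norm_mul, k1]
    simp
  · rw [h2, norm_mul, norm_mul]
    refine mul_le_mul_of_nonneg_left (k2 _ fun i => ?_) (norm_nonneg _)
    rw [Matrix.mulVec_mulVec]
    exact hv i

lemma Eqv.localModelLine {U V : TernaryCubic ℚ_[p]} {κ : ℚ_[p]} (h : Eqv U V κ)
    (hV : LocalModelLine V 1) : LocalModelLine U κ := by
  obtain ⟨g, ν, h1, -, h2, -, -⟩ := h
  obtain ⟨g', ν', k1, k2, k3⟩ := hV
  refine ⟨g' * g, ν * ν', ?_, fun v hv => ?_, fun v hv hz => ?_⟩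
  · rw [Matrix.det_mul, ← h1, show ν * ν' * (g'.det * g.det) = (ν * g.det) * (ν' * g'.det) by ring,
      norm_mul, k1]
    simp
  · rw [h2, norm_mul, norm_mul]
    refine mul_le_mul_of_nonneg_left (k2 _ fun i => ?_) (norm_nonneg _)
    rw [Matrix.mulVec_mulVec]
    exact hv i
  · rw [h2, norm_mul, norm_mul, mul_left_comm]
    rw [← Matrix.mulVec_mulVec] at hv hz
    exact mul_le_mul_of_nonneg_left (k3 _ hv hz) (norm_nonneg _)

lemma norm_eval_le_one {U : TernaryCubic ℚ_[p]} (ha : ‖U.a‖ ≤ 1) (hb : ‖U.b‖ ≤ 1)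
    (hc : ‖U.c‖ ≤ 1) (ha2 : ‖U.a2‖ ≤ 1) (ha3 : ‖U.a3‖ ≤ 1) (hb1 : ‖U.b1‖ ≤ 1) (hb3 : ‖U.b3‖ ≤ 1)
    (hc1 : ‖U.c1‖ ≤ 1) (hc2 : ‖U.c2‖ ≤ 1) (hm : ‖U.m‖ ≤ 1) {v : Fin 3 → ℚ_[p]}
    (hv : ∀ i, ‖v i‖ ≤ 1) : ‖U.eval v‖ ≤ 1 := by
  suffices U.eval v ∈ PadicInt.subring p from this
  have hv' : ∀ i, v i ∈ PadicInt.subring p := hv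
  have h0 := hv' 0
  have h1 := hv' 1
  have h2 := hv' 2
  have mm : ∀ {x y : ℚ_[p]}, ‖x‖ ≤ 1 → y ∈ PadicInt.subring p → x * y ∈ PadicInt.subring p :=
    fun hx hy => (PadicInt.subring p).mul_mem hx hy
  simp only [eval, mul_assoc]
  refine add_mem (add_mem (add_mem (add_mem (add_mem (add_mem (add_mem (add_mem (add_mem
    (mm ha ?_) (mm hb ?_)) (mm hc ?_)) (mm ha2 ?_)) (mm ha3 ?_)) (mm hb1 ?_)) (mm hb3 ?_))
    (mm hc1 ?_)) (mm hc2 ?_)) (mm hm ?_)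
  all_goals simp [mul_mem, pow_mem, h0, h1, h2]

lemma exists_padicInt {x : ℚ_[p]} (h : ‖x‖ ≤ 1) : ∃ X : ℤ_[p], (X : ℚ_[p]) = x := ⟨⟨x, h⟩, rfl⟩

lemma norm_le_one_of_sq_eq {x y d : ℚ_[p]} (hd : ‖d‖ ≤ 1) (hx : ‖x‖ ≤ 1)
    (h : y ^ 2 = x ^ 3 - d * x) : ‖y‖ ≤ 1 := by
  obtain ⟨X, rfl⟩ := exists_padicInt hx
  obtain ⟨D, rfl⟩ := exists_padicInt hd
  have : ‖y ^ 2‖ ≤ 1 := by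
    rw [h]
    exact (X ^ 3 - D * X).2
  rw [norm_pow] at this
  exact (pow_le_one_iff_of_nonneg (norm_nonneg _) two_ne_zero).1 this

lemma localModel_weier {d : ℚ_[p]} (hd : ‖d‖ ≤ 1) : LocalModel (weier (-d) 0) 1 := by
  refine ⟨1, 1, by simp, fun v hv => ?_⟩
  rw [norm_one]
  apply norm_eval_le_one (hv := by simpa using hv) <;> simp [weier, hd]

lemma localModel_tate_of_le {x₀ y₀ d : ℚ_[p]} (hd : ‖d‖ ≤ 1) (hx : ‖x₀‖ ≤ 1)
    (h : y₀ ^ 2 = x₀ ^ 3 - d * x₀) : LocalModel (tate x₀ y₀ (-d)) 1 := by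
  have hy := norm_le_one_of_sq_eq hd hx h
  obtain ⟨X, rfl⟩ := exists_padicInt hx
  obtain ⟨Y, rfl⟩ := exists_padicInt hy
  obtain ⟨D, rfl⟩ := exists_padicInt hd
  refine ⟨1, 1, by simp, fun v hv => ?_⟩
  rw [norm_one]
  apply norm_eval_le_one (hv := by simpa using hv) <;> simp only [tate]
  · simp
  · simp
  · exact (-(X ^ 2 + -D)).2
  · simp
  · exact (-X).2
  · simp
  · simp
  · exact (-2 * Y).2
  · exact (-X).2
  · simp

lemma localModel_tate {x₀ y₀ d : ℚ_[p]} (hd : ‖d‖ ≤ 1) (hd0 : d ≠ 0)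
    (h : y₀ ^ 2 = x₀ ^ 3 - d * x₀) : LocalModel (tate x₀ y₀ (-d)) 1 := by
  rcases le_or_gt ‖x₀‖ 1 with hx | hx
  · exact localModel_tate_of_le hd hx h
  · have hx0 : x₀ ≠ 0 := by rintro rfl; simp at hx; linarith
    refine (eqv_tate_translate (by rw [h]; ring) hx0 (neg_ne_zero.2 hd0)).localModel
      (localModel_tate_of_le hd ?_ ?_)
    · rw [norm_div, norm_neg]
      exact div_le_one_of_le₀ (hd.trans hx.le) (norm_nonneg _)
    · field_simp
      linear_combination h

/-- A ternary cubic with a `p`-adic point has an integral model. -/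
lemma localModel_of_zero {U : TernaryCubic ℚ_[p]} {d κ : ℚ_[p]} (hd : ‖d‖ ≤ 1) (hd0 : d ≠ 0)
    (hκ : κ ≠ 0) (h4 : U.c4 = 48 * d * κ ^ 4) (h6 : U.c6 = 0) {v : Fin 3 → ℚ_[p]} (hv : v ≠ 0)
    (h : U.eval v = 0) : LocalModel U κ := by
  rcases exists_eqv_normal U hd0 hκ h4 h6 hv h with ⟨x₀, y₀, e, r⟩ | r
  · exact r.localModel (localModel_tate hd hd0 e)
  · exact r.localModel (localModel_weier hd)

lemma three_dvd_aux (X Y Z : ℤ_[3]) (hZ : ‖Z‖ = 1) : (3 : ℤ_[3]) ∣ X * (X ^ 2 - Z ^ 2) * Y := by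
  have h3 : ∀ W : ℤ_[3], PadicInt.toZMod W = 0 ↔ (3 : ℤ_[3]) ∣ W := fun W => by
    rw [← RingHom.mem_ker, PadicInt.ker_toZMod, PadicInt.maximalIdeal_eq_span_p,
      Ideal.mem_span_singleton]
    norm_num
  have hZ' : PadicInt.toZMod Z ≠ 0 := by
    rw [Ne, h3]
    intro h
    have := (PadicInt.norm_lt_one_iff_dvd Z).2 (by exact_mod_cast h)
    linarith
  rw [← h3]
  simp only [map_mul, map_sub, map_pow]
  generalize PadicInt.toZMod X = x at *
  generalize PadicInt.toZMod Z = z at *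
  generalize PadicInt.toZMod Y = y at *
  revert x y z
  decide

lemma norm_coe_le_of_dvd {W : ℤ_[3]} (h : (3 : ℤ_[3]) ∣ W) : 3 * ‖(W : ℚ_[3])‖ ≤ 1 := by
  obtain ⟨V, rfl⟩ := h
  have h3 : ‖(3 : ℚ_[3])‖ = 3⁻¹ := by exact_mod_cast Padic.norm_p (p := 3)
  rw [PadicInt.coe_mul, norm_mul]
  have : ((3 : ℤ_[3]) : ℚ_[3]) = 3 := rfl
  rw [this, h3]
  have := V.2
  linarith

lemma norm_three : ‖(3 : ℚ_[3])‖ = 3⁻¹ := by exact_mod_cast Padic.norm_p (p := 3)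

lemma localModelLine_aux {U : TernaryCubic ℚ_[3]} (g : Matrix (Fin 3) (Fin 3) ℚ_[3]) (ν : ℚ_[3])
    (hg : (ν * g.det) ^ 2 = 1)
    (h : ∀ (v : Fin 3 → ℚ_[3]) (X Y Z : ℤ_[3]), g.mulVec v = ![(X : ℚ_[3]), Y, Z] →
      ∃ A B T : ℤ_[3], U.eval v = ν * (A * (A ^ 2 - Z ^ 2) * B + 3 * T)) :
    LocalModelLine U 1 := by
  have key : ∀ v, (∀ i, ‖g.mulVec v i‖ ≤ 1) → ∃ X Y Z : ℤ_[3],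
      g.mulVec v = ![(X : ℚ_[3]), Y, Z] := by
    intro v hv
    refine ⟨⟨_, hv 0⟩, ⟨_, hv 1⟩, ⟨_, hv 2⟩, ?_⟩
    ext i; fin_cases i <;> rfl
  have h' : ∀ (v : Fin 3 → ℚ_[3]) (X Y Z : ℤ_[3]), g.mulVec v = ![(X : ℚ_[3]), Y, Z] →
      ∃ A B T : ℤ_[3], U.eval v = ν * ((A * (A ^ 2 - Z ^ 2) * B + 3 * T : ℤ_[3]) : ℚ_[3]) := by
    intro v X Y Z e
    obtain ⟨A, B, T, e⟩ := h v X Y Z e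
    exact ⟨A, B, T, by rw [e]; rfl⟩
  refine ⟨g, ν, ?_, fun v hv => ?_, fun v hv hz => ?_⟩
  · rw [norm_one]
    exact (pow_eq_one_iff_of_nonneg (norm_nonneg _) two_ne_zero).1 (by rw [← norm_pow, hg, norm_one])
  · obtain ⟨X, Y, Z, e⟩ := key v hv
    obtain ⟨A, B, T, e⟩ := h' v X Y Z e
    rw [e, norm_mul]
    exact mul_le_of_le_one_right (norm_nonneg _) (PadicInt.norm_le_one _)
  · obtain ⟨X, Y, Z, e⟩ := key v hv
    have hZ : ‖Z‖ = 1 := by rw [e] at hz; simpa using hz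
    obtain ⟨A, B, T, e⟩ := h' v X Y Z e
    rw [e, norm_mul, mul_left_comm]
    exact mul_le_of_le_one_right (norm_nonneg _) (norm_coe_le_of_dvd
      (dvd_add (three_dvd_aux _ _ _ hZ) (dvd_mul_right _ _)))

lemma localModelLine_weier : LocalModelLine (weier (-9 : ℚ_[3]) 0) 1 := by
  refine localModelLine_aux !![3⁻¹, 0, 0; 0, 9⁻¹, 0; 0, 0, 1] 27 ?_ fun v X Y Z h => ?_
  · simp [Matrix.det_fin_three]; norm_num
  · rw [mulVec_fin_three] at h
    have h0 := congrFun h 0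
    have h1 := congrFun h 1
    have h2 := congrFun h 2
    simp at h0 h1 h2
    have e0 : v 0 = 3 * X := by rw [← h0]; ring
    have e1 : v 1 = 9 * Y := by rw [← h1]; ring
    refine ⟨X, -1, Y ^ 2 * Z, ?_⟩
    simp only [eval, weier, e0, e1, h2]
    push_cast
    ring

lemma localModelLine_tate_of_lt {x₀ y₀ : ℚ_[3]} (hx : ‖x₀‖ ≤ 3⁻¹)
    (h : y₀ ^ 2 = x₀ ^ 3 - 9 * x₀) : LocalModelLine (tate x₀ y₀ (-9)) 1 := by
  obtain ⟨ξ, rfl⟩ : ∃ ξ : ℤ_[3], x₀ = 3 * ξ := by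
    refine ⟨⟨x₀ / 3, ?_⟩, by simp; field_simp⟩
    rw [norm_div, norm_three, div_inv_eq_mul]
    linarith
  obtain ⟨η, rfl⟩ : ∃ η : ℤ_[3], y₀ = 9 * η := by
    refine ⟨⟨y₀ / 9, ?_⟩, by simp; field_simp⟩
    have hd := norm_coe_le_of_dvd (by simpa using three_dvd_aux ξ 1 1 (by simp))
    have : ‖(y₀ / 9) ^ 2‖ ≤ 1 := by
      have e : (y₀ / 9) ^ 2 = ((ξ * (ξ ^ 2 - 1) : ℤ_[3]) : ℚ_[3]) / 3 := by
        rw [div_pow, h]; push_cast; ring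
      rw [e, norm_div, norm_three, div_inv_eq_mul]
      linarith
    rw [norm_pow] at this
    exact (pow_le_one_iff_of_nonneg (norm_nonneg _) two_ne_zero).1 this
  refine localModelLine_aux !![3⁻¹, 0, 0; 0, 0, 1; 0, 3⁻¹, -(ξ : ℚ_[3])] 9 ?_ fun v X Y Z h => ?_
  · simp [Matrix.det_fin_three]; norm_num
  · rw [mulVec_fin_three] at h
    have h0 := congrFun h 0
    have h1 := congrFun h 1
    have h2 := congrFun h 2
    simp at h0 h1 h2
    have e0 : v 0 = 3 * X := by rw [← h0]; ring
    have e1 : v 1 = 3 * (Z + ξ * Y) := by rw [← h2, ← h1]; ring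
    refine ⟨Y, 1, X ^ 2 * Z - (1 + 1) * η * X * Y ^ 2 - ξ * Z * Y ^ 2 - ξ ^ 2 * Y ^ 3, ?_⟩
    simp only [eval, tate, e0, e1, h1]
    push_cast
    ring

lemma localModelLine_tate_of_eq {x₀ y₀ : ℚ_[3]} (hx : ‖x₀‖ = 1)
    (h : y₀ ^ 2 = x₀ ^ 3 - 9 * x₀) : LocalModelLine (tate x₀ y₀ (-9)) 1 := by
  have hx0 : x₀ ≠ 0 := by rintro rfl; simp at hx
  obtain ⟨t, ht⟩ := exists_padicInt (x := x₀⁻¹) (by simp [hx])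
  obtain ⟨r, hr⟩ := exists_padicInt hx.le
  obtain ⟨s, hs⟩ := exists_padicInt (x := y₀ / x₀) (by
    rw [norm_div, hx, div_one]
    refine norm_le_one_of_sq_eq (d := 9) ?_ hx.le h
    exact_mod_cast Padic.norm_int_le_one 9)
  subst hr
  have hrt : (r : ℚ_[3]) * t = 1 := by rw [ht]; field_simp
  have hy : y₀ = r * s := by rw [hs]; field_simp
  have hst : (s : ℚ_[3]) ^ 2 * t = 1 - 9 * t ^ 2 := by
    rw [hs, ht]
    field_simp
    linear_combination h
  subst hy
  refine localModelLine_aux !![0, 3⁻¹, 0; 9⁻¹, (s : ℚ_[3]) * t / 9, (s : ℚ_[3]) / 9; 0, 0, 1] 27 ?_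
    fun v X Y Z h => ?_
  · simp [Matrix.det_fin_three]; norm_num
  · rw [mulVec_fin_three] at h
    have h0 := congrFun h 0
    have h1 := congrFun h 1
    have h2 := congrFun h 2
    simp at h0 h1 h2
    have e1 : v 1 = 3 * X := by rw [← h0]; ring
    have e0 : v 0 = 9 * Y - 3 * s * t * X - s * Z := by
      rw [← h1, h2, e1]; ring
    refine ⟨X, t, -t ^ 2 * X ^ 2 * Z - r * Y ^ 2 * Z - (1 + 1 + 1) * t ^ 3 * X ^ 3 -
      (1 + 1) * s * t * X ^ 2 * Y + (1 + 1 + 1) * X * Y ^ 2, ?_⟩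
    simp only [eval, tate, e0, e1, h2]
    push_cast
    generalize (t : ℚ_[3]) = t at *
    generalize (r : ℚ_[3]) = r at *
    generalize (s : ℚ_[3]) = s at *
    generalize (X : ℚ_[3]) = X at *
    generalize (Y : ℚ_[3]) = Y at *
    generalize (Z : ℚ_[3]) = Z at *
    have hr2 : s ^ 2 = r - 9 * t := by linear_combination r * hst - s ^ 2 * hrt - 9 * t * hrt
    linear_combination 27 * t * X ^ 3 * hst + 3 * X * Z ^ 2 * hr2 + 54 * s * X * Y * Z * hrt +
      X ^ 2 * Z * (-9 * s ^ 2 * t * hrt + 9 * hst) + Z ^ 3 * (r * hr2 - 9 * hrt)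

lemma norm_le_inv_three {x : ℚ_[3]} (h : ‖x‖ < 1) : ‖x‖ ≤ 3⁻¹ := by
  have := (Padic.norm_le_pow_iff_norm_lt_pow_add_one x (-1)).2 (by simpa using h)
  simpa using this

/-- A ternary cubic of the same invariants as `y² = x³ - 9x` with a `3`-adic point has an integral
model which is divisible by `3` outside of a line. -/
lemma localModelLine_of_zero {U : TernaryCubic ℚ_[3]} {κ : ℚ_[3]}
    (hκ : κ ≠ 0) (h4 : U.c4 = 48 * 9 * κ ^ 4) (h6 : U.c6 = 0) {v : Fin 3 → ℚ_[3]} (hv : v ≠ 0)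
    (h : U.eval v = 0) : LocalModelLine U κ := by
  rcases exists_eqv_normal U (by norm_num) hκ h4 h6 hv h with ⟨x₀, y₀, e, r⟩ | r
  · refine r.localModelLine ?_
    rcases lt_trichotomy ‖x₀‖ 1 with hx | hx | hx
    · exact localModelLine_tate_of_lt (norm_le_inv_three hx) e
    · exact localModelLine_tate_of_eq hx e
    · have hx0 : x₀ ≠ 0 := by rintro rfl; simp at hx; linarith
      refine (eqv_tate_translate (by rw [e]; ring) hx0 (by norm_num)).localModelLine
        (localModelLine_tate_of_lt (norm_le_inv_three ?_) ?_)
      · have h9 : ‖(-9 : ℚ_[3])‖ < 1 := by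
          rw [norm_neg, show (9 : ℚ_[3]) = 3 * 3 by norm_num, norm_mul, norm_three]
          norm_num
        rw [norm_div]
        exact (div_lt_one (by linarith)).2 (h9.trans hx)
      · field_simp
        linear_combination e
  · exact r.localModelLine localModelLine_weier

end TernaryCubic

end

section

namespace TernaryCubic

lemma exists_root_phi (x₀ : ℝ) : ∃ X : ℝ, X ^ 9 + 12 * X ^ 7 + 30 * X ^ 5 - 36 * X ^ 3 + 9 * X =
    x₀ * (3 * X ^ 4 - 6 * X ^ 2 - 1) ^ 2 := by
  open Polynomial in
  have aux : ∀ x₀ : ℝ, ∃ X : ℝ, 0 ≤ X ∧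
      x₀ * (3 * X ^ 4 - 6 * X ^ 2 - 1) ^ 2 ≤
      X ^ 9 + 12 * X ^ 7 + 30 * X ^ 5 - 36 * X ^ 3 + 9 * X := by
    intro x₀
    let P : ℝ[X] := X ^ 9 + 12 * X ^ 7 + 30 * X ^ 5 - 36 * X ^ 3 + 9 * X -
      C x₀ * (3 * X ^ 4 - 6 * X ^ 2 - 1) ^ 2
    have hP : P = X ^ 9 - (C (9 * x₀) * X ^ 8 + C (-12) * X ^ 7 + C (-36 * x₀) * X ^ 6 + C (-30) * X ^ 5 +
       C (30 * x₀) * X ^ 4 + C 36 * X ^ 3 + C (12 * x₀) * X ^ 2 + C (-9) * X + C x₀) := by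
      simp only [P, map_mul, map_neg, map_ofNat]
      ring
    have hd : (C (9 * x₀) * X ^ 8 + C (-12) * X ^ 7 + C (-36 * x₀) * X ^ 6 + C (-30) * X ^ 5 +
       C (30 * x₀) * X ^ 4 + C 36 * X ^ 3 + C (12 * x₀) * X ^ 2 + C (-9) * X + C x₀ : ℝ[X]).degree
         < (X ^ 9 : ℝ[X]).degree := by
      rw [degree_X_pow]
      refine lt_of_le_of_lt (b := 8) ?_ (by norm_num)
      compute_degree
    have h1 : P.degree = 9 := by rw [hP, degree_sub_eq_left_of_degree_lt hd, degree_X_pow]; rfl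
    have h2 : P.leadingCoeff = 1 := by
      rw [hP, leadingCoeff_sub_of_degree_lt hd, leadingCoeff_X_pow]
    have h3 := P.tendsto_atTop_of_leadingCoeff_nonneg (by rw [h1]; norm_num) (by rw [h2]; norm_num)
    obtain ⟨X, hX, hX0⟩ := ((h3.eventually_ge_atTop 0).and (Filter.eventually_ge_atTop 0)).exists
    refine ⟨X, hX0, ?_⟩
    simp [P] at hX
    linarith
  obtain ⟨r, hr0, hr⟩ := aux x₀
  obtain ⟨l, hl0, hl⟩ := aux (-x₀)
  have hc : ContinuousOn (fun X : ℝ => X ^ 9 + 12 * X ^ 7 + 30 * X ^ 5 - 36 * X ^ 3 + 9 * X -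
      x₀ * (3 * X ^ 4 - 6 * X ^ 2 - 1) ^ 2) (Set.Icc (-l) r) := by fun_prop
  have := intermediate_value_Icc (by linarith) hc
  obtain ⟨X, -, hX⟩ := this (show (0 : ℝ) ∈ _ from ⟨by ring_nf at hl ⊢; linarith, by linarith⟩)
  exact ⟨X, by simpa [sub_eq_zero] using hX⟩

lemma rel_tate_weier_of_eq_zero {x₀ : ℝ} (h : x₀ ^ 3 - x₀ = 0) :
    ∃ a₄, Rel (tate x₀ 0 (-1)) (weier a₄ 0) := by
  have h4 : (tate x₀ 0 (-1)).c4 = 48 := by simp only [c4, tate]; linear_combination 0 * h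
  have h6 : (tate x₀ 0 (-1)).c6 = 0 := by simp only [c6, tate]; linear_combination (-864) * h
  have r : Rel (tate x₀ 0 (-1)) ⟨-(3 * x₀ ^ 2 - 1), 0, 0, 0, -3 * x₀, 0, 1, -1, 0, 0⟩ := by
    refine ⟨1, !![0, 0, 1; 1, 0, 0; 0, 1, -x₀], 1, ?_, one_ne_zero, fun v => ?_, ?_, ?_⟩
    · simp [Matrix.det_fin_three]
    · rw [mulVec_fin_three]; simp [eval, tate]; ring
    · simp only [c4, tate]; ring
    · simp only [c6, tate]; ring
  obtain ⟨a₄, hr⟩ := exists_rel_weier _ rfl rfl (by simp) rfl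
    (r.c4_ne_zero (by rw [h4]; norm_num)) (r.c6_eq_zero h6)
  exact ⟨a₄, r.trans hr⟩

lemma rel_tate_weier_of_params {X l q : ℝ} (hh : 3 * X - l ^ 2 ≠ 0)
    (ha : q * l * (3 * X - l ^ 2) - 3 * X ^ 2 = -1) (hq : q ^ 2 * (3 * X - l ^ 2) ^ 2 / 4 = X ^ 3 - X) :
    ∃ a₄, Rel (tate (X + q * (q - 2 * l))
      (-(q * (3 * X - l ^ 2) / 2) - (q - l) * (q * (q - 2 * l))) (-1)) (weier a₄ 0) := by
  set x₀ := X + q * (q - 2 * l) with hx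
  set y₀ := -(q * (3 * X - l ^ 2) / 2) - (q - l) * (q * (q - 2 * l)) with hy
  have hS : y₀ ^ 2 = x₀ ^ 3 - x₀ := by
    rw [hx, hy]
    linear_combination hq + q * (q - 2 * l) * ha
  have h4 : (tate x₀ y₀ (-1)).c4 = 48 := by simp only [c4, tate]; ring
  have h6 : (tate x₀ y₀ (-1)).c6 = 0 := by simp only [c6, tate]; linear_combination 864 * hS
  have e : ∀ v, (tate x₀ y₀ (-1)).eval v =
      (⟨q, 0, 0, 0, -1, 0, 3 * X - l ^ 2, 0, -1, 2 * l⟩ : TernaryCubic ℝ).eval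
        ![v 0 - (q - l) * v 2, v 2, q * (v 0 - (q - l) * v 2) - (v 1 - X * v 2)] := by
    intro v
    simp [eval, tate]
    rw [hx, hy]
    linear_combination v 2 ^ 3 * ha
  have r : Rel (tate x₀ y₀ (-1)) ⟨q, 0, 0, 0, -1, 0, 3 * X - l ^ 2, 0, -1, 2 * l⟩ := by
    refine ⟨1, !![1, 0, -(q - l); 0, 0, 1; q, -1, -q * (q - l) + X], 1, ?_, one_ne_zero,
      fun v => ?_, ?_, ?_⟩
    · simp [Matrix.det_fin_three]
    · rw [mulVec_fin_three, e]
      simp [eval]; ring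
    · rw [h4]; simp only [c4]
      linear_combination 48 * ha
    · rw [h6]; simp only [c6]
      linear_combination -864 * hq + 864 * X * ha
  obtain ⟨a₄, hr⟩ := exists_rel_weier _ rfl rfl (by simpa) rfl
    (r.c4_ne_zero (by rw [h4]; norm_num)) (r.c6_eq_zero h6)
  exact ⟨a₄, r.trans hr⟩

lemma rel_tate_weier {x₀ y₀ : ℝ} (h : y₀ ^ 2 = x₀ ^ 3 - x₀) :
    ∃ a₄, Rel (tate x₀ y₀ (-1)) (weier a₄ 0) := by
  by_cases hy : y₀ = 0
  · subst hy
    exact rel_tate_weier_of_eq_zero (by rw [← h]; simp)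
  have hy2 : 0 < y₀ ^ 2 := by positivity
  obtain ⟨X, hX⟩ := exists_root_phi x₀
  set ψ := 3 * X ^ 4 - 6 * X ^ 2 - 1 with hψ
  have hψ0 : ψ ≠ 0 := by
    intro h0
    rw [h0] at hX
    have h1 : X * (3 * X ^ 2 + 1) = 0 := by
      have h0' : 3 * X ^ 4 - 6 * X ^ 2 - 1 = 0 := h0
      linear_combination (9 / 256 : ℝ) * hX - (3 / 256 : ℝ) * (X ^ 5 + 14 * X ^ 3 + 175 / 3 * X) * h0'
    rcases mul_eq_zero.1 h1 with h1 | h1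
    · rw [hψ, h1] at h0; norm_num at h0
    · nlinarith [sq_nonneg X]
  have hψX : ψ = 3 * X ^ 4 - 6 * X ^ 2 - 1 := hψ
  clear_value ψ
  obtain ⟨K, hK⟩ : ∃ K, K = 8 * (X ^ 3 - X) ^ 2 - (3 * X ^ 2 - 1) * ψ := ⟨_, rfl⟩
  have hx : (x₀ - X) * ψ ^ 2 = 8 * (X ^ 3 - X) * K := by
    rw [sub_mul, ← hX, hK, hψX]; ring
  have hΩ : y₀ ^ 2 * ψ ^ 6 =
      (X ^ 3 - X) * (ψ ^ 3 + 64 * (X ^ 3 - X) ^ 2 * K - 4 * (3 * X ^ 2 - 1) * ψ * K) ^ 2 := by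
    have : y₀ ^ 2 * ψ ^ 6 = (x₀ * ψ ^ 2) ^ 3 - (x₀ * ψ ^ 2) * ψ ^ 4 := by rw [h]; ring
    rw [this, ← hX, hK, hψX]
    ring
  have hg : 0 < X ^ 3 - X := by
    have : 0 < y₀ ^ 2 * ψ ^ 6 := by positivity
    rw [hΩ] at this
    exact pos_of_mul_pos_left this (sq_nonneg _)
  suffices key : ∀ Y, Y ^ 2 = X ^ 3 - X → Y ≠ 0 → ∀ y₁,
      y₁ = -(8 * Y ^ 3 / ψ * (3 * X - ((3 * X ^ 2 - 1) / (2 * Y)) ^ 2) / 2) -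
        (8 * Y ^ 3 / ψ - (3 * X ^ 2 - 1) / (2 * Y)) *
        (8 * Y ^ 3 / ψ * (8 * Y ^ 3 / ψ - 2 * ((3 * X ^ 2 - 1) / (2 * Y)))) → y₁ ^ 2 = y₀ ^ 2 ∧
        ∃ a₄, Rel (tate x₀ y₁ (-1)) (weier a₄ 0) by
    have hY2 := Real.sq_sqrt hg.le
    have hY0 := (Real.sqrt_pos.2 hg).ne'
    obtain ⟨e1, r1⟩ := key _ hY2 hY0 _ rfl
    rcases sq_eq_sq_iff_eq_or_eq_neg.1 e1 with e | e
    · rwa [← e]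
    · obtain ⟨-, r2⟩ := key (-√(X ^ 3 - X)) (by simpa using hY2) (by simpa) y₀ (by
        rw [← neg_eq_iff_eq_neg] at e
        rw [← e]
        field_simp
        ring)
      exact r2
  intro Y hY hY0 y₁ hy₁
  have hh : 3 * X - ((3 * X ^ 2 - 1) / (2 * Y)) ^ 2 = ψ / (4 * (X ^ 3 - X)) := by
    rw [← hY, div_pow, mul_pow, hψX]
    field_simp
    rw [hY]; ring
  have hx₀ : X + 8 * Y ^ 3 / ψ * (8 * Y ^ 3 / ψ - 2 * ((3 * X ^ 2 - 1) / (2 * Y))) = x₀ := by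
    have : x₀ = X + 8 * (X ^ 3 - X) * K / ψ ^ 2 := by rw [← hx]; field_simp; ring
    rw [this, hK, ← hY]
    field_simp
  have hS := rel_tate_weier_of_params (X := X) (l := (3 * X ^ 2 - 1) / (2 * Y)) (q := 8 * Y ^ 3 / ψ)
    ?_ ?_ ?_
  · rw [← hy₁, hx₀] at hS
    refine ⟨?_, hS⟩
    have : y₁ * ψ ^ 3 = -Y * (ψ ^ 3 + 64 * (X ^ 3 - X) ^ 2 * K - 4 * (3 * X ^ 2 - 1) * ψ * K) := by
      rw [hy₁, hh, hK, ← hY]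
      field_simp
      ring
    have h2 : (y₁ * ψ ^ 3) ^ 2 = y₀ ^ 2 * ψ ^ 6 := by rw [this, hΩ, ← hY]; ring
    apply mul_right_cancel₀ (pow_ne_zero 6 hψ0)
    rw [← h2]; ring
  · rw [hh]; positivity
  · rw [hh, ← hY]; field_simp; ring
  · rw [hh, ← hY]; field_simp; ring

/-- A real ternary cubic with the invariants of `y² = x³ - x` is equivalent to it as soon as it
has a real point. -/
lemma exists_eqv_weier_real {U : TernaryCubic ℝ} {κ : ℝ} (hκ : κ ≠ 0)
    (h4 : U.c4 = 48 * κ ^ 4) (h6 : U.c6 = 0) {v : Fin 3 → ℝ} (hv : v ≠ 0)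
    (h : U.eval v = 0) : ∃ δ, |δ| = |κ| ∧ Eqv U (weier (-1) 0) δ := by
  rcases exists_eqv_normal U one_ne_zero hκ (by rw [h4]; ring) h6 hv h with ⟨x₀, y₀, e, r⟩ | r
  · obtain ⟨a₄, δ, r'⟩ := rel_tate_weier (by rw [e]; ring)
    have hδ := r'
    obtain ⟨_, _, _, hδ0, _, hc, _⟩ := hδ
    have ha : δ ^ 4 * a₄ = -1 := by
      simp only [c4, tate, weier] at hc
      linear_combination (1 / 48 : ℝ) * hc
    have e : ((weier a₄ 0).diag (δ⁻¹ ^ 2) (δ⁻¹ ^ 3) 1).scale (δ ^ 6) = weier (-1) 0 := by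
      rw [← ha]
      ext <;> simp [diag, scale, weier] <;> field_simp
    have := ((r.trans r').trans (eqv_diag _ (k := δ⁻¹ ^ 2) (l := δ⁻¹ ^ 3) (n := 1) (by simpa)
      (by simpa) one_ne_zero)).trans (eqv_scale _ (k := δ ^ 6) (by simpa))
    rw [e] at this
    refine ⟨_, ?_, this⟩
    congr 1
    field_simp
  · exact ⟨_, rfl, r⟩

lemma weier_bound_aux {p q z : ℝ} (hp : 0 ≤ p) (hq : 0 ≤ q) (hz : 0 ≤ z) :
    0 ≤ p * (3 / 16 * (p ^ 2 + 3 * q ^ 2) - z * q) + 2 / 5 * z ^ 3 - 3 / 8 * (p - q) * z ^ 2 := by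
  have hz3 := pow_nonneg hz 3
  rcases le_total p (3 / 8 * z) with h | h
  · have h1 : 0 ≤ q * z * (3 / 8 * z - p) := by
      have : 0 ≤ 3 / 8 * z - p := by linarith
      positivity
    have h2 : 0 ≤ z ^ 2 * (3 / 8 * z - p) := by
      have : 0 ≤ 3 / 8 * z - p := by linarith
      positivity
    have h3 : 0 ≤ p ^ 3 := by positivity
    have h4 : 0 ≤ p * q ^ 2 := by positivity
    linarith
  rcases hp.eq_or_lt with rfl | hp
  · have := mul_nonneg hq (sq_nonneg z)
    linarith
  have h' : 0 ≤ p * (3 / 16 * p ^ 3 + 2 / 5 * z ^ 3 - 3 / 8 * p * z ^ 2) -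
      4 / 9 * (p * z - 3 / 8 * z ^ 2) ^ 2 := by
    have h1 : 0 ≤ (p - 117 / 100 * z) ^ 2 * (p * (p - 3 / 8 * z)) := by
      have : 0 ≤ p - 3 / 8 * z := by linarith
      positivity
    have h2 : 0 ≤ (p - 117 / 100 * z) ^ 2 * (z * (p - 3 / 8 * z)) := by
      have : 0 ≤ p - 3 / 8 * z := by linarith
      positivity
    have h3 : 0 ≤ (p - 117 / 100 * z) ^ 2 * z ^ 2 := by positivity
    have h4 : 0 ≤ z ^ 3 * p := by positivity
    have h5 : 0 ≤ z ^ 4 := by positivity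
    linarith
  refine nonneg_of_mul_nonneg_right (a := p) ?_ hp
  nlinarith [sq_nonneg (3 / 4 * p * q - 2 / 3 * (p * z - 3 / 8 * z ^ 2))]

lemma weier_bound_of_nonneg {x y z : ℝ} (hz : 0 ≤ z) :
    (-x ^ 3 + y ^ 2 * z + x * z ^ 2) ^ 2 ≤ (x ^ 2 + 3 / 4 * y ^ 2 + 2 / 5 * z ^ 2) ^ 3 := by
  obtain ⟨s, hs, h⟩ : ∃ s, 0 ≤ s ∧ s ^ 2 = x ^ 2 + 3 / 4 * y ^ 2 + 2 / 5 * z ^ 2 :=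
    ⟨_, Real.sqrt_nonneg _, Real.sq_sqrt (by positivity)⟩
  have hy : y ^ 2 = 4 / 3 * (s ^ 2 - x ^ 2 - 2 / 5 * z ^ 2) := by linarith
  have hD : 0 ≤ s ^ 2 - x ^ 2 - 2 / 5 * z ^ 2 := by nlinarith [sq_nonneg y]
  have hx : |x| ≤ s := by
    apply abs_le_of_sq_le_sq _ hs
    nlinarith [sq_nonneg z]
  have hx' := abs_le.1 hx
  rw [← h, ← pow_mul, mul_comm 2 3, pow_mul, hy]
  apply sq_le_sq'
  · have h1 : 0 ≤ s ^ 3 + x * z ^ 2 - x ^ 3 := by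
      rcases le_total 0 x with h0 | h0
      · have := pow_le_pow_left₀ h0 hx'.2 3
        have := mul_nonneg h0 (sq_nonneg z)
        linarith
      · have h1 : 0 ≤ (-x - s / 2) ^ 2 * (s - x) := by
          have : 0 ≤ s - x := by linarith
          positivity
        have h2 : 0 ≤ s ^ 2 * (s - x) := by
          have : 0 ≤ s - x := by linarith
          positivity
        have h3 := mul_nonneg (neg_nonneg.2 h0) hD
        linarith
    nlinarith [mul_nonneg hz hD]
  · have := weier_bound_aux (p := s + x) (q := s - x) (by linarith) (by linarith) hz
    nlinarith

lemma weier_bound (v : Fin 3 → ℝ) : (weier (-1) 0 : TernaryCubic ℝ).eval v ^ 2 ≤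
    (v 0 ^ 2 + 3 / 4 * v 1 ^ 2 + 2 / 5 * v 2 ^ 2) ^ 3 := by
  have e : (weier (-1) 0 : TernaryCubic ℝ).eval v =
      -v 0 ^ 3 + v 1 ^ 2 * v 2 + v 0 * v 2 ^ 2 := by
    simp [eval, weier]; ring
  rw [e]
  rcases le_total 0 (v 2) with h | h
  · exact weier_bound_of_nonneg h
  · convert weier_bound_of_nonneg (x := - v 0) (y := v 1) (z := - v 2) (by linarith) using 1 <;> ring

end TernaryCubic

end

section

open Matrix

lemma exists_pos_le_vecMul_sq {H : Matrix (Fin 3) (Fin 3) ℝ} (hH : H.det ≠ 0) :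
    ∃ c : ℝ, 0 < c ∧ ∀ w : Fin 3 → ℤ, w ≠ 0 →
      c ≤ ∑ i, (((fun i => (w i : ℝ)) ᵥ* H) i) ^ 2 := by
  obtain ⟨s, hs⟩ : ∃ s, s = ∑ j, ∑ i, (H⁻¹ i j) ^ 2 := ⟨_, rfl⟩
  have hs0 : 0 ≤ s := by rw [hs]; positivity
  refine ⟨1 / (1 + s), by positivity, fun w hw => ?_⟩
  set x : Fin 3 → ℝ := fun i => (w i : ℝ)
  obtain ⟨j, hj⟩ : ∃ j, w j ≠ 0 := by
    by_contra! h
    exact hw (funext h)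
  have h1 : (1 : ℝ) ≤ x j ^ 2 := by
    have : 1 ≤ w j ^ 2 := by have := sq_pos_of_ne_zero hj; lia
    simp only [x]; exact_mod_cast this
  have h2 : x j = ∑ i, (x ᵥ* H) i * H⁻¹ i j := by
    have : x ᵥ* H ᵥ* H⁻¹ = x := by
      rw [vecMul_vecMul, mul_nonsing_inv _ (isUnit_iff_ne_zero.2 hH), vecMul_one]
    conv_lhs => rw [← this]
    rfl
  have h3 := Finset.sum_mul_sq_le_sq_mul_sq Finset.univ (x ᵥ* H) (fun i => H⁻¹ i j)
  rw [← h2] at h3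
  have h4 : ∑ i, (H⁻¹ i j) ^ 2 ≤ s := by
    rw [hs]
    exact Finset.single_le_sum (f := fun j => ∑ i, (H⁻¹ i j) ^ 2)
      (fun _ _ => by positivity) (Finset.mem_univ j)
  rw [div_le_iff₀ (by positivity)]
  have h5 : 0 ≤ ∑ i, ((x ᵥ* H) i) ^ 2 := by positivity
  nlinarith

/-- A basis of a lattice which is almost reduced, described by its Gram-Schmidt
orthogonalisation. -/
structure AlmostReduced (N : Matrix (Fin 3) (Fin 3) ℝ) (A B C b c d : ℝ) : Prop where
  pos_A : 0 < A
  pos_B : 0 < B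
  pos_C : 0 < C
  sq_b : b ^ 2 ≤ 1 / 4
  sq_c : c ^ 2 ≤ 1 / 4
  sq_d : d ^ 2 ≤ 1 / 4
  col_zero : ∑ i, N i 0 ^ 2 = A
  col_one : ∑ i, N i 1 ^ 2 = b ^ 2 * A + B
  col_two : ∑ i, N i 2 ^ 2 = c ^ 2 * A + d ^ 2 * B + C
  det_sq : N.det ^ 2 = A * B * C
  le_one : 19 / 20 * A ≤ b ^ 2 * A + B
  le_two : 19 / 20 * B ≤ d ^ 2 * B + C

lemma sq_le_quarter {x y : ℝ} (hy : 0 < y) (h : |x| ≤ y / 2) : (x / y) ^ 2 ≤ 1 / 4 := by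
  rw [div_pow, div_le_iff₀ (by positivity), ← sq_abs]
  nlinarith [abs_nonneg x]

lemma almostReduced_of_gram {N : Matrix (Fin 3) (Fin 3) ℝ} {A s₁ s₂ t u v m : ℝ}
    (hA : A = ∑ i, N i 0 ^ 2) (hs₁ : s₁ = ∑ i, N i 0 * N i 1) (hs₂ : s₂ = ∑ i, N i 0 * N i 2)
    (ht : t = ∑ i, N i 1 ^ 2) (hu : u = ∑ i, N i 1 * N i 2) (hv : v = ∑ i, N i 2 ^ 2)
    (hm : m = A * t - s₁ ^ 2) (hA0 : 0 < A) (hm0 : 0 < m) (hd : N.det ≠ 0)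
    (h1 : |s₁| ≤ A / 2) (h2 : |s₂| ≤ A / 2) (h3 : |A * u - s₁ * s₂| ≤ m / 2)
    (k1 : 19 / 20 * A ≤ t) (k2 : 19 / 20 * m ≤ A * v - s₂ ^ 2) :
    ∃ A B C b c d, AlmostReduced N A B C b c d := by
  have hdet : N.det ^ 2 = A * t * v + 2 * s₁ * s₂ * u - A * u ^ 2 - t * s₂ ^ 2 - v * s₁ ^ 2 := by
    rw [det_fin_three, hA, hs₁, hs₂, ht, hu, hv]
    simp only [Fin.sum_univ_three]
    ring
  have hd2 : 0 < N.det ^ 2 := by positivity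
  have e1 : (s₁ / A) ^ 2 * A + m / A = t := by rw [hm]; field_simp; ring
  have e2 : ((A * u - s₁ * s₂) / m) ^ 2 * (m / A) + N.det ^ 2 / m = (A * v - s₂ ^ 2) / A := by
    rw [hdet]
    field_simp
    rw [hm]
    ring
  have e3 : (s₂ / A) ^ 2 * A + ((A * u - s₁ * s₂) / m) ^ 2 * (m / A) + N.det ^ 2 / m = v := by
    rw [add_assoc, e2]; field_simp; ring
  refine ⟨A, m / A, N.det ^ 2 / m, s₁ / A, s₂ / A, (A * u - s₁ * s₂) / m, hA0, by positivity,
    by positivity, sq_le_quarter hA0 h1, sq_le_quarter hA0 h2, sq_le_quarter hm0 h3, hA.symm, ?_, ?_,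
    ?_, ?_, ?_⟩
  · rw [e1, ht]
  · rw [e3, hv]
  · field_simp
  · rw [e1]; exact k1
  · rw [e2, ← mul_div_assoc]
    gcongr

lemma exists_int_abs_add_mul_le (x : ℝ) {y : ℝ} (hy : 0 < y) : ∃ k : ℤ, |x + k * y| ≤ y / 2 := by
  refine ⟨-round (x / y), ?_⟩
  have := abs_sub_round (x / y)
  have e : x + (-round (x / y) : ℤ) * y = (x / y - round (x / y)) * y := by
    push_cast; field_simp; ring
  rw [e, abs_mul, abs_of_pos hy]
  nlinarith

/-- Lattice reduction in dimension three. -/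
theorem exists_almostReduced {G : Matrix (Fin 3) (Fin 3) ℝ} (hG : G.det ≠ 0) :
    ∃ V : Matrix (Fin 3) (Fin 3) ℤ, V.det ^ 2 = 1 ∧
      ∃ A B C b c d, AlmostReduced (G * V.map (Int.cast : ℤ → ℝ)) A B C b c d := by
  obtain ⟨m, hm⟩ : ∃ m : Matrix (Fin 3) (Fin 3) ℝ → ℝ, ∀ N, m N =
    (∑ i, N i 0 ^ 2) * (∑ i, N i 1 ^ 2) - (∑ i, N i 0 * N i 1) ^ 2 := ⟨_, fun N => rfl⟩
  let L (V : Matrix (Fin 3) (Fin 3) ℤ) : Matrix (Fin 3) (Fin 3) ℝ := G * V.map (Int.cast : ℤ → ℝ)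
  have hdet : ∀ V : Matrix (Fin 3) (Fin 3) ℤ, (V.map (Int.cast : ℤ → ℝ)).det = V.det := fun V =>
    (Int.cast_det V).symm
  have hLdet : ∀ V : Matrix (Fin 3) (Fin 3) ℤ, V.det ^ 2 = 1 → (L V).det ≠ 0 := by
    intro V hV
    rw [det_mul, hdet]
    refine mul_ne_zero hG ?_
    rintro h
    have : V.det = 0 := by exact_mod_cast h
    simp [this] at hV
  obtain ⟨c₁, hc₁, h₁⟩ : ∃ c : ℝ, 0 < c ∧ ∀ V : Matrix (Fin 3) (Fin 3) ℤ, V.det ^ 2 = 1 →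
      c ≤ ∑ i, L V i 0 ^ 2 := by
    obtain ⟨c, hc, h⟩ := exists_pos_le_vecMul_sq (H := Gᵀ) (by rwa [det_transpose])
    refine ⟨c, hc, fun V hV => (h (fun i => V i 0) ?_).trans_eq ?_⟩
    · intro h0
      rw [det_eq_zero_of_column_eq_zero 0 (fun i => congrFun h0 i)] at hV
      simp at hV
    · refine Finset.sum_congr rfl fun i _ => ?_
      simp [L, vecMul, Matrix.mul_apply, dotProduct, mul_comm]
  obtain ⟨c₂, hc₂, h₂⟩ : ∃ c : ℝ, 0 < c ∧ ∀ V : Matrix (Fin 3) (Fin 3) ℤ, V.det ^ 2 = 1 →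
      c ≤ m (L V) := by
    obtain ⟨c, hc, h⟩ := exists_pos_le_vecMul_sq (H := G.adjugate) (by
      rw [det_adjugate]; exact pow_ne_zero _ hG)
    refine ⟨c, hc, fun V hV => (h (fun i => V.adjugate 2 i) ?_).trans_eq ?_⟩
    · intro h0
      have h1 : V.adjugate.det = 0 := det_eq_zero_of_row_eq_zero 2 (fun i => congrFun h0 i)
      rw [det_adjugate] at h1
      have := pow_eq_zero_iff (by simp) |>.1 h1
      simp [this] at hV
    · have e : ∀ i, ((fun i => (V.adjugate 2 i : ℝ)) ᵥ* G.adjugate) i = (L V).adjugate 2 i := by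
        intro i
        have : (L V).adjugate = (V.adjugate.map (Int.cast : ℤ → ℝ)) * G.adjugate := by
          simp only [L]
          rw [adjugate_mul_distrib]
          congr 1
          exact ((Int.castRingHom ℝ).map_adjugate V).symm
        rw [this, Matrix.mul_apply]
        rfl
      simp only [e, hm]
      simp [Fin.sum_univ_three, adjugate_fin_three]
      ring
  let S : Set ℝ := {x | ∃ V : Matrix (Fin 3) (Fin 3) ℤ, V.det ^ 2 = 1 ∧
    x = (∑ i, L V i 0 ^ 2) * m (L V)}
  have hS : S.Nonempty := ⟨_, 1, by simp, rfl⟩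
  have hSb : ∀ x ∈ S, c₁ * c₂ ≤ x := by
    rintro x ⟨V, hV, rfl⟩
    exact mul_le_mul (h₁ V hV) (h₂ V hV) hc₂.le (hc₁.le.trans (h₁ V hV))
  have hI : 0 < sInf S := (mul_pos hc₁ hc₂).trans_le (le_csInf hS hSb)
  obtain ⟨x, ⟨V, hV, rfl⟩, hx⟩ := exists_lt_of_csInf_lt hS (show sInf S < 20 / 19 * sInf S by linarith)
  have hmin : ∀ W : Matrix (Fin 3) (Fin 3) ℤ, W.det ^ 2 = 1 →
      19 / 20 * ((∑ i, L V i 0 ^ 2) * m (L V)) ≤ (∑ i, L W i 0 ^ 2) * m (L W) := by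
    intro W hW
    have := csInf_le ⟨_, hSb⟩ ⟨W, hW, rfl⟩
    linarith
  have hmul : ∀ V W, L (V * W) = L V * W.map (Int.cast : ℤ → ℝ) := by
    intro V W
    simp only [L]
    rw [Matrix.mul_assoc]
    congr 1
    ext i j
    exact RingHom.map_matrix_mul V W i j (Int.castRingHom ℝ)
  obtain ⟨A, hA⟩ : ∃ A, A = ∑ i, L V i 0 ^ 2 := ⟨_, rfl⟩
  obtain ⟨s₁, hs₁⟩ : ∃ s, s = ∑ i, L V i 0 * L V i 1 := ⟨_, rfl⟩
  obtain ⟨s₂, hs₂⟩ : ∃ s, s = ∑ i, L V i 0 * L V i 2 := ⟨_, rfl⟩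
  obtain ⟨u, hu⟩ : ∃ s, s = ∑ i, L V i 1 * L V i 2 := ⟨_, rfl⟩
  have hA0 : 0 < A := by rw [hA]; exact hc₁.trans_le (h₁ V hV)
  have hm0 : 0 < m (L V) := hc₂.trans_le (h₂ V hV)
  obtain ⟨k, hk⟩ := exists_int_abs_add_mul_le s₁ hA0
  obtain ⟨n, hn⟩ := exists_int_abs_add_mul_le (A * u - s₁ * s₂) hm0
  obtain ⟨l, hl⟩ := exists_int_abs_add_mul_le (s₂ + n * s₁) hA0
  let T : Matrix (Fin 3) (Fin 3) ℤ := !![1, k, l; 0, 1, n; 0, 0, 1]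
  have hVT : (V * T).det ^ 2 = 1 := by
    rw [det_mul, mul_pow, hV]
    simp [T, det_fin_three]
  have hN : ∀ i, L (V * T) i 0 = L V i 0 ∧ L (V * T) i 1 = L V i 1 + k * L V i 0 ∧
      L (V * T) i 2 = L V i 2 + n * L V i 1 + l * L V i 0 := by
    intro i
    rw [hmul]
    simp [Matrix.mul_apply, Fin.sum_univ_three, T]
    constructor <;> ring
  have e0 : ∑ i, L (V * T) i 0 ^ 2 = A := by simp [hN, hA]
  have em : m (L (V * T)) = m (L V) := by
    rw [hm, hm]; simp only [hN, Fin.sum_univ_three]; ring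
  rw [← hA, ← em] at hmin
  have hm0' := em ▸ hm0
  refine ⟨V * T, hVT, almostReduced_of_gram e0.symm rfl rfl rfl rfl rfl ((hm _).trans (by rw [e0]))
    hA0 hm0' (hLdet _ hVT) ?_ ?_ ?_ ?_ ?_⟩
  · convert hk using 2
    change ∑ i, L (V * T) i 0 * L (V * T) i 1 = _
    simp only [hN, hs₁, hA, Fin.sum_univ_three]; ring
  · convert hl using 2
    change ∑ i, L (V * T) i 0 * L (V * T) i 2 = _
    simp only [hN, hs₁, hs₂, hA, Fin.sum_univ_three]; ring
  · rw [em]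
    convert hn using 2
    change A * (∑ i, L (V * T) i 1 * L (V * T) i 2) - (∑ i, L (V * T) i 0 * L (V * T) i 1) *
      (∑ i, L (V * T) i 0 * L (V * T) i 2) = _
    rw [hm]
    simp only [hN, hs₁, hs₂, hA, hu, Fin.sum_univ_three]; ring
  · have h := hmin (V * T * !![0, 1, 0; 1, 0, 0; 0, 0, 1]) (by
      rw [det_mul, mul_pow, hVT]; simp [det_fin_three])
    have e : ∀ i, L (V * T * !![0, 1, 0; 1, 0, 0; 0, 0, 1]) i 0 = L (V * T) i 1 ∧
        L (V * T * !![0, 1, 0; 1, 0, 0; 0, 0, 1]) i 1 = L (V * T) i 0 := by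
      intro i
      rw [hmul]
      simp [Matrix.mul_apply, Fin.sum_univ_three]
    have e' : m (L (V * T * !![0, 1, 0; 1, 0, 0; 0, 0, 1])) = m (L (V * T)) := by
      rw [hm, hm]; simp only [e, Fin.sum_univ_three]; ring
    rw [e', ← mul_assoc] at h
    have := le_of_mul_le_mul_right h hm0'
    simpa only [e] using this
  · have h := hmin (V * T * !![1, 0, 0; 0, 0, 1; 0, 1, 0]) (by
      rw [det_mul, mul_pow, hVT]; simp [det_fin_three])
    have e : ∀ i, L (V * T * !![1, 0, 0; 0, 0, 1; 0, 1, 0]) i 0 = L (V * T) i 0 ∧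
        L (V * T * !![1, 0, 0; 0, 0, 1; 0, 1, 0]) i 1 = L (V * T) i 2 := by
      intro i
      rw [hmul]
      simp [Matrix.mul_apply, Fin.sum_univ_three]
    rw [hm (L (V * T * _))] at h
    simp only [e] at h
    rw [e0, mul_left_comm] at h
    exact le_of_mul_le_mul_left h hA0

end

section

open Matrix

namespace TernaryCubic

section single

variable {p : ℕ} [hp : Fact p.Prime]

/-- Membership in `GL₃(ℤ_p)`. -/
def IsUnimodular (M : Matrix (Fin 3) (Fin 3) ℚ_[p]) : Prop :=
  (∀ i j, ‖M i j‖ ≤ 1) ∧ ‖M.det‖ = 1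

lemma norm_sum_three_le {a b c : ℚ_[p]} {r : ℝ} (ha : ‖a‖ ≤ r) (hb : ‖b‖ ≤ r) (hc : ‖c‖ ≤ r) :
    ‖a + b + c‖ ≤ r :=
  (Padic.nonarchimedean _ _).trans
    (max_le ((Padic.nonarchimedean _ _).trans (max_le ha hb)) hc)

lemma norm_mul_apply_le {M N : Matrix (Fin 3) (Fin 3) ℚ_[p]} (hM : ∀ i j, ‖M i j‖ ≤ 1)
    (hN : ∀ i j, ‖N i j‖ ≤ 1) (i j : Fin 3) : ‖(M * N) i j‖ ≤ 1 := by
  rw [Matrix.mul_apply, Fin.sum_univ_three]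
  apply norm_sum_three_le <;> rw [norm_mul] <;>
    exact mul_le_one₀ (hM _ _) (norm_nonneg _) (hN _ _)

lemma norm_mulVec_le {M : Matrix (Fin 3) (Fin 3) ℚ_[p]} (hM : ∀ i j, ‖M i j‖ ≤ 1)
    {v : Fin 3 → ℚ_[p]} (hv : ∀ i, ‖v i‖ ≤ 1) (i : Fin 3) : ‖M.mulVec v i‖ ≤ 1 := by
  rw [Matrix.mulVec, dotProduct, Fin.sum_univ_three]
  apply norm_sum_three_le <;> rw [norm_mul] <;>
    exact mul_le_one₀ (hM _ _) (norm_nonneg _) (hv _)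

lemma IsUnimodular.mul {M N : Matrix (Fin 3) (Fin 3) ℚ_[p]} (hM : IsUnimodular M)
    (hN : IsUnimodular N) : IsUnimodular (M * N) :=
  ⟨norm_mul_apply_le hM.1 hN.1, by rw [det_mul, norm_mul, hM.2, hN.2, one_mul]⟩

lemma isUnimodular_one : IsUnimodular (1 : Matrix (Fin 3) (Fin 3) ℚ_[p]) := by
  refine ⟨fun i j => ?_, by simp⟩
  rw [Matrix.one_apply]; split_ifs <;> simp

/-- The image of a rational matrix over `ℚ_p`. -/
noncomputable def padicMap (p : ℕ) [Fact p.Prime] (B : Matrix (Fin 3) (Fin 3) ℚ) :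
    Matrix (Fin 3) (Fin 3) ℚ_[p] :=
  B.map (Rat.castHom ℚ_[p])

lemma padicMap_mul (B C : Matrix (Fin 3) (Fin 3) ℚ) :
    padicMap p (B * C) = padicMap p B * padicMap p C :=
  Matrix.map_mul

lemma det_padicMap (B : Matrix (Fin 3) (Fin 3) ℚ) : (padicMap p B).det = (B.det : ℚ_[p]) :=
  ((Rat.castHom ℚ_[p]).map_det B).symm

lemma norm_natCast_eq_one_of_ne {q : ℕ} [hq : Fact q.Prime] (h : q ≠ p) : ‖(p : ℚ_[q])‖ = 1 := by
  rw [Padic.norm_natCast_eq_one_iff]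
  exact (Nat.coprime_primes hq.out hp.out).2 h

/-- Rational matrices which are unimodular away from `p`. -/
def AwayUnimodular (p : ℕ) (C : Matrix (Fin 3) (Fin 3) ℚ) : Prop :=
  ∀ (q : ℕ) [Fact q.Prime], q ≠ p → IsUnimodular (padicMap q C)

lemma AwayUnimodular.mul {B C : Matrix (Fin 3) (Fin 3) ℚ} (hB : AwayUnimodular p B)
    (hC : AwayUnimodular p C) : AwayUnimodular p (B * C) := fun q _ hq => by
  rw [padicMap_mul]; exact (hB q hq).mul (hC q hq)

lemma norm_lt_one_iff_toZMod {x : ℤ_[p]} : ‖x‖ < 1 ↔ PadicInt.toZMod x = 0 := by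
  rw [← RingHom.mem_ker, PadicInt.ker_toZMod, PadicInt.mem_nonunits.symm]
  exact Iff.rfl

lemma exists_away_step {M : Matrix (Fin 3) (Fin 3) ℚ_[p]} (hM : ∀ i j, ‖M i j‖ ≤ 1)
    (hd : ‖M.det‖ < 1) : ∃ C, AwayUnimodular p C ∧ (∀ i j, ‖(M * padicMap p C) i j‖ ≤ 1) ∧
      C.det = 1 / p := by
  let M' : Matrix (Fin 3) (Fin 3) ℤ_[p] := fun i j => ⟨M i j, hM i j⟩
  have hM' : (M'.det : ℚ_[p]) = M.det := PadicInt.Coe.ringHom.map_det M'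
  have h0 : (M'.map PadicInt.toZMod).det = 0 := by
    have := (PadicInt.toZMod (p := p)).map_det M'
    rw [RingHom.mapMatrix_apply] at this
    rw [← this, ← norm_lt_one_iff_toZMod]
    change ‖(M'.det : ℚ_[p])‖ < 1
    rwa [hM']
  obtain ⟨v, hv, hv0⟩ := Matrix.exists_mulVec_eq_zero_iff.2 h0
  obtain ⟨k, hk⟩ := Function.ne_iff.1 hv
  have hk' : v k ≠ 0 := hk
  let w : Fin 3 → ℕ := fun i => ((v k)⁻¹ * v i).val
  have hw : ∀ i, (w i : ZMod p) = (v k)⁻¹ * v i := fun i => ZMod.natCast_zmod_val _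
  have hwk : w k = 1 := by
    simp only [w, inv_mul_cancel₀ hk']
    exact ZMod.val_one p
  have hp0 : (p : ℚ) ≠ 0 := by exact_mod_cast hp.out.ne_zero
  let C : Matrix (Fin 3) (Fin 3) ℚ := (1 : Matrix (Fin 3) (Fin 3) ℚ).updateCol k
    fun i => (w i : ℚ) / p
  have hCdet : C.det = 1 / p := by
    have : C.det = ((w k : ℚ) / p) := by
      simp only [C]
      rw [← Matrix.cramer_apply]
      simp
    rw [this, hwk, Nat.cast_one]
  refine ⟨C, fun q _ hq => ⟨fun i j => ?_, ?_⟩, fun i j => ?_, hCdet⟩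
  · simp only [padicMap, Matrix.map_apply, C, Matrix.updateCol_apply]
    split_ifs
    · simp only [eq_ratCast]
      push_cast
      rw [norm_div, norm_natCast_eq_one_of_ne hq, div_one]
      exact_mod_cast Padic.norm_int_le_one (p := q) (w i)
    · rw [Matrix.one_apply]; split_ifs <;> simp
  · rw [det_padicMap, hCdet]
    push_cast
    rw [norm_div, norm_natCast_eq_one_of_ne hq]; simp
  · by_cases hj : j = k
    · subst hj
      have e : (M * padicMap p C) i j = ((M'.mulVec (fun i => (w i : ℤ_[p])) i : ℤ_[p]) : ℚ_[p]) / p := by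
        rw [Matrix.mul_apply, Matrix.mulVec, dotProduct]
        simp only [Fin.sum_univ_three, padicMap, Matrix.map_apply, C, Matrix.updateCol_self]
        push_cast
        simp only [M', eq_ratCast]
        push_cast
        ring
      have e2 : PadicInt.toZMod (M'.mulVec (fun i => (w i : ℤ_[p])) i) = 0 := by
        have h3 := congrFun hv0 i
        simp only [Matrix.mulVec, dotProduct, Fin.sum_univ_three, map_add, map_mul, map_natCast,
          Matrix.map_apply, hw, Pi.zero_apply] at h3 ⊢
        linear_combination (v j)⁻¹ * h3
      rw [← norm_lt_one_iff_toZMod, PadicInt.norm_lt_one_iff_dvd] at e2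
      obtain ⟨y, hy⟩ := e2
      have hp1 : (p : ℚ_[p]) ≠ 0 := by exact_mod_cast hp.out.ne_zero
      rw [e, hy]
      push_cast
      rw [mul_div_cancel_left₀ _ hp1]
      exact y.2
    · have : (M * padicMap p C) i j = M i j := by
        rw [Matrix.mul_apply]
        simp only [padicMap, Matrix.map_apply, C, Matrix.updateCol_ne hj]
        simp [Matrix.one_apply]
      rw [this]; exact hM i j

lemma exists_away_of_integral (n : ℕ) {M : Matrix (Fin 3) (Fin 3) ℚ_[p]} (hM : ∀ i j, ‖M i j‖ ≤ 1)
    (hd : (p : ℝ) ^ (-n : ℤ) ≤ ‖M.det‖) :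
    ∃ C, AwayUnimodular p C ∧ C.det ≠ 0 ∧ IsUnimodular (M * padicMap p C) := by
  induction n generalizing M with
  | zero =>
    refine ⟨1, fun q _ _ => ?_, by simp, ?_⟩
    · have : padicMap q 1 = 1 := by simp [padicMap]
      rw [this]; exact isUnimodular_one
    · have : padicMap p 1 = 1 := by simp [padicMap]
      rw [this, mul_one]
      refine ⟨hM, le_antisymm ?_ (by simpa using hd)⟩
      let M' : Matrix (Fin 3) (Fin 3) ℤ_[p] := fun i j => ⟨M i j, hM i j⟩
      have hM' : (M'.det : ℚ_[p]) = M.det := PadicInt.Coe.ringHom.map_det M'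
      rw [← hM']; exact M'.det.2
  | succ n ih =>
    by_cases h : (p : ℝ) ^ (-n : ℤ) ≤ ‖M.det‖
    · exact ih hM h
    have hp1 : (1 : ℝ) < p := by exact_mod_cast hp.out.one_lt
    have hlt : ‖M.det‖ < 1 := (not_le.1 h).trans_le (by
      rw [_root_.zpow_neg]; exact inv_le_one_of_one_le₀ (one_le_zpow₀ hp1.le (by positivity)))
    obtain ⟨C, hC, hMC, hdet⟩ := exists_away_step hM hlt
    obtain ⟨C', hC', hne, hMC'⟩ := ih hMC (by
      rw [det_mul, det_padicMap, hdet, norm_mul]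
      push_cast
      rw [norm_div, norm_one, Padic.norm_p, one_div, inv_inv]
      rw [show (-((n : ℕ) + 1 : ℕ) : ℤ) = -n - 1 by push_cast; ring, zpow_sub_one₀ (by positivity)]
        at hd
      calc (p : ℝ) ^ (-n : ℤ) = (p : ℝ) ^ (-n : ℤ) * (p : ℝ)⁻¹ * p := by field_simp
        _ ≤ _ := by gcongr)
    refine ⟨C * C', hC.mul hC', ?_, ?_⟩
    · rw [det_mul, hdet]
      exact mul_ne_zero (one_div_ne_zero (by exact_mod_cast hp.out.ne_zero)) hne
    · rw [padicMap_mul, ← mul_assoc]; exact hMC'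

lemma exists_away {M : Matrix (Fin 3) (Fin 3) ℚ_[p]} (hM : M.det ≠ 0) :
    ∃ C, AwayUnimodular p C ∧ C.det ≠ 0 ∧ IsUnimodular (M * padicMap p C) := by
  have hp1 : (1 : ℝ) < p := by exact_mod_cast hp.out.one_lt
  have hp0 : (p : ℚ) ≠ 0 := by exact_mod_cast hp.out.ne_zero
  obtain ⟨R, hR⟩ : ∃ R : ℝ, ∀ i j, ‖M i j‖ ≤ R :=
    ⟨∑ i, ∑ j, ‖M i j‖, fun i j => (Finset.single_le_sum (f := fun j => ‖M i j‖)
      (fun _ _ => norm_nonneg _) (Finset.mem_univ j)).trans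
      (Finset.single_le_sum (f := fun i => ∑ j, ‖M i j‖)
      (fun _ _ => Finset.sum_nonneg fun _ _ => norm_nonneg _) (Finset.mem_univ i))⟩
  obtain ⟨k, hk⟩ := pow_unbounded_of_one_lt R hp1
  let D : Matrix (Fin 3) (Fin 3) ℚ := ((p : ℚ) ^ k) • 1
  have hD : D.det = ((p : ℚ) ^ k) ^ 3 := by simp [D]
  have hDm : ∀ (q : ℕ) [Fact q.Prime], padicMap q D = ((p : ℚ_[q]) ^ k) • 1 := fun q _ => by
    ext i j; simp only [padicMap, D, Matrix.map_apply, Matrix.smul_apply, Matrix.one_apply]; split_ifs <;> simp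
  have hDa : AwayUnimodular p D := fun q _ hq => by
    refine ⟨fun i j => ?_, ?_⟩
    · rw [hDm, Matrix.smul_apply, Matrix.one_apply, smul_eq_mul, norm_mul, norm_pow,
        norm_natCast_eq_one_of_ne hq]
      split_ifs <;> simp
    · rw [hDm, Matrix.det_smul]
      simp [norm_natCast_eq_one_of_ne hq]
  have hMD : M * padicMap p D = ((p : ℚ_[p]) ^ k) • M := by rw [hDm]; simp
  have hne : (M * padicMap p D).det ≠ 0 := by
    rw [hMD, Matrix.det_smul]
    exact mul_ne_zero (pow_ne_zero _ (pow_ne_zero _ (by exact_mod_cast hp.out.ne_zero))) hM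
  obtain ⟨n, hn⟩ : ∃ n : ℕ, (p : ℝ) ^ (-n : ℤ) ≤ ‖(M * padicMap p D).det‖ := by
    obtain ⟨n, hn⟩ := pow_unbounded_of_one_lt (‖(M * padicMap p D).det‖⁻¹) hp1
    refine ⟨n, ?_⟩
    rw [_root_.zpow_neg, zpow_natCast]
    exact inv_le_of_inv_le₀ (norm_pos_iff.2 hne) hn.le
  obtain ⟨C, h1, h2, h3⟩ := exists_away_of_integral n (M := M * padicMap p D) (fun i j => by
    rw [hMD, Matrix.smul_apply, smul_eq_mul, norm_mul, norm_pow, Padic.norm_p, inv_pow]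
    rw [inv_mul_le_iff₀ (by positivity), mul_one]
    exact (hR i j).trans hk.le) hn
  refine ⟨D * C, hDa.mul h1, ?_, ?_⟩
  · rw [det_mul, hD]; exact mul_ne_zero (by positivity) h2
  · rw [padicMap_mul, ← mul_assoc]; exact h3

end single

/-- A lattice in `ℚ³` with prescribed localisations. -/
theorem exists_lattice_basis (g : ∀ (p : ℕ) [Fact p.Prime], Matrix (Fin 3) (Fin 3) ℚ_[p])
    (hg : ∀ (p : ℕ) [Fact p.Prime], (g p).det ≠ 0) (S : Finset ℕ) :
    ∃ B : Matrix (Fin 3) (Fin 3) ℚ, B.det ≠ 0 ∧ ∀ (p : ℕ) [Fact p.Prime],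
      (p ∈ S → IsUnimodular (g p * padicMap p B)) ∧ (p ∉ S → IsUnimodular (padicMap p B)) := by
  classical
  induction S using Finset.induction_on with
  | empty =>
    refine ⟨1, by simp, fun p _ => ⟨by simp, fun _ => ?_⟩⟩
    have : padicMap p 1 = 1 := by simp [padicMap]
    rw [this]; exact isUnimodular_one
  | insert p S hpS ih =>
    obtain ⟨B, hB0, hB⟩ := ih
    by_cases hp : p.Prime
    · have : Fact p.Prime := ⟨hp⟩
      obtain ⟨C, h1, h2, h3⟩ := exists_away (M := g p * padicMap p B) (by
        rw [det_mul, det_padicMap]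
        exact mul_ne_zero (hg p) (by exact_mod_cast hB0))
      refine ⟨B * C, by rw [det_mul]; exact mul_ne_zero hB0 h2, fun q _ => ⟨fun hq => ?_, fun hq => ?_⟩⟩
      · rw [padicMap_mul, ← mul_assoc]
        by_cases hqp : q = p
        · subst hqp; exact h3
        · exact ((hB q).1 ((Finset.mem_insert.1 hq).resolve_left hqp)).mul (h1 q hqp)
      · rw [Finset.mem_insert, not_or] at hq
        rw [padicMap_mul]
        exact ((hB q).2 hq.2).mul (h1 q hq.1)
    · refine ⟨B, hB0, fun q hq => ⟨fun h => ?_, fun h => ?_⟩⟩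
      · refine (hB q).1 ((Finset.mem_insert.1 h).resolve_left ?_)
        rintro rfl; exact hp hq.out
      · exact (hB q).2 fun h' => h (Finset.mem_insert_of_mem h')

end TernaryCubic

end

section

open Matrix

namespace TernaryCubic

/-- Base change of a ternary cubic along a ring homomorphism. -/
def map {F K : Type*} [CommRing F] [CommRing K] (f : F →+* K) (U : TernaryCubic F) :
    TernaryCubic K :=
  ⟨f U.a, f U.b, f U.c, f U.a2, f U.a3, f U.b1, f U.b3, f U.c1, f U.c2, f U.m⟩

lemma eval_map {F K : Type*} [CommRing F] [CommRing K] (f : F →+* K) (U : TernaryCubic F)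
    (v : Fin 3 → F) : (U.map f).eval (fun i => f (v i)) = f (U.eval v) := by
  simp [eval, map]

lemma c4_map {F K : Type*} [CommRing F] [CommRing K] (f : F →+* K) (U : TernaryCubic F) :
    (U.map f).c4 = f U.c4 := by
  simp [c4, map, map_ofNat]

lemma c6_map {F K : Type*} [CommRing F] [CommRing K] (f : F →+* K) (U : TernaryCubic F) :
    (U.map f).c6 = f U.c6 := by
  simp [c6, map, map_ofNat]

lemma exists_int_of_forall_norm_le_one {x : ℚ}
    (h : ∀ (p : ℕ) [Fact p.Prime], ‖(x : ℚ_[p])‖ ≤ 1) : ∃ k : ℤ, (k : ℚ) = x := by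
  refine ⟨x.num, ?_⟩
  have hden : x.den = 1 := by
    by_contra hne
    obtain ⟨p, hp, hd⟩ := Nat.exists_prime_and_dvd hne
    have : Fact p.Prime := ⟨hp⟩
    have h1 := h p
    have hn : ¬ (p : ℤ) ∣ x.num := fun hn => by
      have := Nat.dvd_gcd (Int.natCast_dvd.1 hn) hd
      rw [x.reduced] at this
      exact hp.one_lt.ne' (Nat.dvd_one.1 this)
    have h2 : ‖(x.num : ℚ_[p])‖ = 1 :=
      le_antisymm (Padic.norm_int_le_one _) (not_lt.1 fun h => hn (Padic.norm_intCast_lt_one_iff.1 h))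
    have h3 : ‖(x.den : ℚ_[p])‖ < 1 := by
      have := (Padic.norm_intCast_lt_one_iff (p := p) (k := x.den)).2 (by exact_mod_cast hd)
      exact_mod_cast this
    have h4 : (x : ℚ_[p]) * (x.den : ℚ_[p]) = x.num := by exact_mod_cast Rat.mul_den_eq_num x
    have h5 : ‖(x : ℚ_[p])‖ * ‖(x.den : ℚ_[p])‖ = 1 := by rw [← norm_mul, h4, h2]
    nlinarith [norm_nonneg (x : ℚ_[p]), norm_nonneg (x.den : ℚ_[p])]
  conv_rhs => rw [← Rat.num_div_den x, hden]
  simp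

lemma exists_finset_norm_le_one (x : ℚ) :
    ∃ S : Finset ℕ, ∀ (p : ℕ) [Fact p.Prime], p ∉ S → ‖(x : ℚ_[p])‖ ≤ 1 := by
  refine ⟨x.den.primeFactors, fun p hp h => ?_⟩
  apply Padic.norm_rat_le_one
  intro hd
  exact h (Nat.mem_primeFactors.2 ⟨hp.out, hd, x.den_nz⟩)

/-- An integral model over `ℤ` of a ternary cubic over `ℚ` which has good local models. -/
theorem exists_global_model {U : TernaryCubic ℚ} {κ : ℚ} (hκ : κ ≠ 0)
    (g : ∀ (p : ℕ) [Fact p.Prime], Matrix (Fin 3) (Fin 3) ℚ_[p])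
    (n : ∀ (p : ℕ) [Fact p.Prime], ℚ_[p])
    (h1 : ∀ (p : ℕ) [Fact p.Prime], ‖n p * (g p).det‖ = ‖(κ : ℚ_[p])‖)
    (h2 : ∀ (p : ℕ) [Fact p.Prime], ∀ v, (∀ i, ‖(g p).mulVec v i‖ ≤ 1) →
      ‖(U.map (Rat.castHom ℚ_[p])).eval v‖ ≤ ‖n p‖) (p₀ : ℕ) [Fact p₀.Prime] :
    ∃ B : Matrix (Fin 3) (Fin 3) ℚ, B.det ≠ 0 ∧
      (∀ x : Fin 3 → ℤ, ∃ k : ℤ, U.eval (B.mulVec fun i => (x i : ℚ)) = k * (κ * B.det)) ∧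
      IsUnimodular (g p₀ * padicMap p₀ B) ∧ ‖n p₀‖ = ‖((κ * B.det : ℚ) : ℚ_[p₀])‖ := by
  classical
  obtain ⟨Sa, hSa⟩ := exists_finset_norm_le_one U.a
  obtain ⟨Sb, hSb⟩ := exists_finset_norm_le_one U.b
  obtain ⟨Sc, hSc⟩ := exists_finset_norm_le_one U.c
  obtain ⟨Sa2, hSa2⟩ := exists_finset_norm_le_one U.a2
  obtain ⟨Sa3, hSa3⟩ := exists_finset_norm_le_one U.a3
  obtain ⟨Sb1, hSb1⟩ := exists_finset_norm_le_one U.b1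
  obtain ⟨Sb3, hSb3⟩ := exists_finset_norm_le_one U.b3
  obtain ⟨Sc1, hSc1⟩ := exists_finset_norm_le_one U.c1
  obtain ⟨Sc2, hSc2⟩ := exists_finset_norm_le_one U.c2
  obtain ⟨Sm, hSm⟩ := exists_finset_norm_le_one U.m
  obtain ⟨Sk, hSk⟩ := exists_finset_norm_le_one κ⁻¹
  have hgd : ∀ (p : ℕ) [Fact p.Prime], (g p).det ≠ 0 := fun p _ h => by
    have := h1 p
    rw [h, mul_zero, norm_zero, eq_comm, norm_eq_zero] at this
    exact hκ (by exact_mod_cast this)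
  obtain ⟨B, hB0, hB⟩ := exists_lattice_basis g hgd
    ({p₀} ∪ Sa ∪ Sb ∪ Sc ∪ Sa2 ∪ Sa3 ∪ Sb1 ∪ Sb3 ∪ Sc1 ∪ Sc2 ∪ Sm ∪ Sk)
  have hn : ∀ (p : ℕ) [Fact p.Prime], IsUnimodular (g p * padicMap p B) →
      ‖n p‖ = ‖((κ * B.det : ℚ) : ℚ_[p])‖ := fun p _ h => by
    have h3 := h.2
    rw [det_mul, norm_mul, det_padicMap] at h3
    rw [Rat.cast_mul, norm_mul, ← h1 p, norm_mul, mul_assoc, h3, mul_one]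
  have hp₀ := (hB p₀).1 (by simp)
  refine ⟨B, hB0, fun x => ?_, hp₀, hn p₀ hp₀⟩
  have hne : κ * B.det ≠ 0 := mul_ne_zero hκ hB0
  obtain ⟨k, hk⟩ := exists_int_of_forall_norm_le_one
    (x := U.eval (B.mulVec fun i => (x i : ℚ)) / (κ * B.det)) (fun p _ => by
      have hx : ∀ i, ‖((x i : ℤ) : ℚ_[p])‖ ≤ 1 := fun i => Padic.norm_int_le_one _
      have e1 : (fun i => Rat.castHom ℚ_[p] ((B.mulVec fun i => (x i : ℚ)) i)) =
          (padicMap p B).mulVec fun i => (x i : ℚ_[p]) := by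
        ext i
        simp [Matrix.mulVec, dotProduct, padicMap]
      have e2 : ((U.eval (B.mulVec fun i => (x i : ℚ)) : ℚ) : ℚ_[p]) =
          (U.map (Rat.castHom ℚ_[p])).eval ((padicMap p B).mulVec fun i => (x i : ℚ_[p])) := by
        rw [← e1, eval_map]; rfl
      have hne' : 0 < ‖((κ * B.det : ℚ) : ℚ_[p])‖ := norm_pos_iff.2 (by exact_mod_cast hne)
      rw [Rat.cast_div, norm_div, e2, div_le_one hne', Rat.cast_mul]
      by_cases hS : p ∈ {p₀} ∪ Sa ∪ Sb ∪ Sc ∪ Sa2 ∪ Sa3 ∪ Sb1 ∪ Sb3 ∪ Sc1 ∪ Sc2 ∪ Sm ∪ Sk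
      · have hu := (hB p).1 hS
        have := h2 p ((padicMap p B).mulVec fun i => (x i : ℚ_[p])) (fun i => by
          rw [Matrix.mulVec_mulVec]
          exact norm_mulVec_le hu.1 hx i)
        rw [hn p hu, Rat.cast_mul] at this
        exact this
      · have hu := (hB p).2 hS
        simp only [Finset.mem_union, not_or] at hS
        have hd : ‖((B.det : ℚ) : ℚ_[p])‖ = 1 := by rw [← det_padicMap]; exact hu.2
        have hk : 1 ≤ ‖(κ : ℚ_[p])‖ := by
          have h3 := hSk p hS.2
          rw [Rat.cast_inv, norm_inv] at h3
          have hpos : 0 < ‖(κ : ℚ_[p])‖ := norm_pos_iff.2 (by exact_mod_cast hκ)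
          rwa [inv_le_one₀ hpos] at h3
        rw [norm_mul, hd, mul_one]
        refine le_trans ?_ hk
        refine norm_eval_le_one ?_ ?_ ?_ ?_ ?_ ?_ ?_ ?_ ?_ ?_ (norm_mulVec_le hu.1 hx) <;>
          simp only [map, eq_ratCast]
        · exact hSa p (by tauto)
        · exact hSb p (by tauto)
        · exact hSc p (by tauto)
        · exact hSa2 p (by tauto)
        · exact hSa3 p (by tauto)
        · exact hSb1 p (by tauto)
        · exact hSb3 p (by tauto)
        · exact hSc1 p (by tauto)
        · exact hSc2 p (by tauto)
        · exact hSm p (by tauto))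
  exact ⟨k, by rw [hk]; field_simp⟩

section bounds

variable {A B C b c d R : ℝ}

lemma one_lt_of_bounds {N : Matrix (Fin 3) (Fin 3) ℝ} (h : AlmostReduced N A B C b c d) {r : ℝ}
    (hR : 0 < R) (hr : R * (A * B * C) = r) : r < 343 / 1000 * (R * A ^ 3) → False := fun hlt => by
  obtain ⟨hA, hB, hC, hb, hc, hd, -, -, -, -, h1, h2⟩ := h
  have k1 : 7 / 10 * A ≤ B := by nlinarith
  have k2 : 7 / 10 * B ≤ C := by nlinarith
  have k3 : 49 / 100 * A ≤ C := by linarith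
  have k4 : (7 / 10 * A) * (49 / 100 * A) ≤ B * C := mul_le_mul k1 k3 (by positivity) hB.le
  have k5 : A * ((7 / 10 * A) * (49 / 100 * A)) ≤ A * (B * C) := mul_le_mul_of_nonneg_left k4 hA.le
  have k6 := mul_le_mul_of_nonneg_left k5 hR.le
  nlinarith

lemma bounds_aux {t s : ℝ} (ht : 7 / 10 ≤ t) (hs : 7 / 10 * t ≤ s) (hts : t * s ≤ 9 / 10) :
    (1 / 4 + t) ^ 3 < 10 * (t * s) ∧ (1 / 4 + t / 4 + s) ^ 3 < 10 * (t * s) := by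
  have ht1 : t ≤ 114 / 100 := by nlinarith
  have hs1 : s ≤ 129 / 100 := by nlinarith
  have hs0 : 49 / 100 ≤ s := by linarith
  constructor
  · have h1 : 1 / 4 + t ≤ 136 / 100 * t := by linarith
    have h2 : (1 / 4 + t) ^ 3 ≤ (136 / 100 * t) ^ 3 := by gcongr
    have h3 : t ^ 3 ≤ 114 / 100 * t ^ 2 := by nlinarith [sq_nonneg t]
    nlinarith
  · obtain ⟨u, hu⟩ : ∃ u, u = 1 / 4 + t / 4 + s := ⟨_, rfl⟩
    have hu0 : 0 < u := by rw [hu]; linarith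
    have hu1 : u ≤ 172 / 100 := by
      rw [hu]
      nlinarith
    rw [← hu]
    have h2 : u ^ 2 ≤ (172 / 100) ^ 2 := by gcongr
    have h3 : u ^ 3 ≤ (172 / 100) ^ 2 * u := by nlinarith
    rw [hu] at h3
    rw [hu]
    nlinarith [mul_nonneg (sub_nonneg.2 ht) (sub_nonneg.2 hs0)]

lemma lt_of_bounds {N : Matrix (Fin 3) (Fin 3) ℝ} (h : AlmostReduced N A B C b c d)
    (hR : 0 < R) (hr : R * (A * B * C) = 9 / 10) (h1 : 1 ≤ R * A ^ 3) (j : Fin 3) :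
    R * (∑ i, N i j ^ 2) ^ 3 < 9 := by
  by_contra hj
  rw [not_lt] at hj
  have hlt := one_lt_of_bounds h hR hr
  obtain ⟨hA, hB, hC, hb, hc, hd, c0, c1, c2, -, l1, l2⟩ := h
  obtain ⟨t, rfl⟩ : ∃ t, B = t * A := ⟨B / A, by field_simp⟩
  obtain ⟨s, rfl⟩ : ∃ s, C = s * A := ⟨C / A, by field_simp⟩
  have hts : R * A ^ 3 * (t * s) = 9 / 10 := by rw [← hr]; ring
  have ht : 7 / 10 ≤ t := by
    have : (7 / 10) * A ≤ t * A := by nlinarith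
    exact le_of_mul_le_mul_right this hA
  have hs : 7 / 10 * t ≤ s := by
    have : (7 / 10 * t) * A ≤ s * A := by nlinarith
    exact le_of_mul_le_mul_right this hA
  have hts' : t * s ≤ 9 / 10 := by
    have : 0 ≤ t * s := by nlinarith
    nlinarith
  obtain ⟨b1, b2⟩ := bounds_aux ht hs hts'
  have hRA : 0 < R * A ^ 3 := by positivity
  have m1 := mul_lt_mul_of_pos_left b1 hRA
  have m2 := mul_lt_mul_of_pos_left b2 hRA
  fin_cases j
  · simp only [Fin.zero_eta, c0] at hj
    exact hlt (by nlinarith)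
  · simp only [Fin.mk_one, c1] at hj
    have : R * (b ^ 2 * A + t * A) ^ 3 ≤ R * ((1 / 4 + t) * A) ^ 3 := by
      gcongr; nlinarith
    nlinarith
  · simp only [Fin.reduceFinMk, c2] at hj
    have : R * (c ^ 2 * A + d ^ 2 * (t * A) + s * A) ^ 3 ≤ R * ((1 / 4 + t / 4 + s) * A) ^ 3 := by
      gcongr; nlinarith
    nlinarith

end bounds

end TernaryCubic

end

section

open Matrix

namespace TernaryCubic

lemma exists_real_bound {U : TernaryCubic ℝ} {κ : ℝ} (hκ : κ ≠ 0) (h4 : U.c4 = 48 * κ ^ 4)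
    (h6 : U.c6 = 0) {v : Fin 3 → ℝ} (hv : v ≠ 0) (h : U.eval v = 0) :
    ∃ (H : Matrix (Fin 3) (Fin 3) ℝ) (ν : ℝ), ν ^ 2 * H.det ^ 2 = 3 / 10 * κ ^ 2 ∧
      ∀ w, U.eval w ^ 2 ≤ ν ^ 2 * (∑ i, H.mulVec w i ^ 2) ^ 3 := by
  obtain ⟨δ, hδ, g, ν, hd, -, he, -, -⟩ := exists_eqv_weier_real hκ h4 h6 hv h
  have s1 : √(3 / 4 : ℝ) ^ 2 = 3 / 4 := Real.sq_sqrt (by norm_num)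
  have s2 : √(2 / 5 : ℝ) ^ 2 = 2 / 5 := Real.sq_sqrt (by norm_num)
  refine ⟨Matrix.diagonal ![1, √(3 / 4), √(2 / 5)] * g, ν, ?_, fun w => ?_⟩
  · rw [← sq_abs κ, ← hδ, sq_abs, ← hd, det_mul, det_diagonal, Fin.prod_univ_three]
    simp only [cons_val_zero, cons_val_one, cons_val]
    linear_combination ν ^ 2 * g.det ^ 2 * (√(2 / 5 : ℝ) ^ 2 * s1 + 3 / 4 * s2)
  · rw [he, mul_pow]
    refine mul_le_mul_of_nonneg_left ((weier_bound _).trans_eq ?_) (sq_nonneg _)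
    rw [Fin.sum_univ_three, ← mulVec_mulVec]
    simp only [mulVec_diagonal, cons_val_zero, cons_val_one, cons_val, one_mul, mul_pow, s1, s2]

lemma exists_column_bound {U : TernaryCubic ℚ} {κ : ℚ} {κ' r : ℝ} (hκ : κ ≠ 0)
    (hκ' : κ' ^ 2 = r * (κ : ℝ) ^ 2) (hr : 0 < r)
    (h4 : (U.map (Rat.castHom ℝ)).c4 = 48 * κ' ^ 4)
    (h6 : U.c6 = 0) {v : Fin 3 → ℝ} (hv : v ≠ 0) (h : (U.map (Rat.castHom ℝ)).eval v = 0)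
    {B : Matrix (Fin 3) (Fin 3) ℚ} (hB : B.det ≠ 0) :
    ∃ (V : Matrix (Fin 3) (Fin 3) ℤ) (N : Matrix (Fin 3) (Fin 3) ℝ) (A₁ A₂ A₃ b c d R : ℝ),
      V.det ^ 2 = 1 ∧ AlmostReduced N A₁ A₂ A₃ b c d ∧ 0 < R ∧
      R * (A₁ * A₂ * A₃) = 3 / 10 * r ∧
      ∀ (j : Fin 3) (k : ℤ), U.eval (B.mulVec fun i => (V i j : ℚ)) = k * (κ * B.det) →
        (k : ℝ) ^ 2 ≤ R * (∑ i, N i j ^ 2) ^ 3 := by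
  have hκ0 : κ' ≠ 0 := by
    rintro rfl
    have : (κ : ℝ) ≠ 0 := by exact_mod_cast hκ
    have : 0 < r * (κ : ℝ) ^ 2 := by positivity
    rw [← hκ'] at this
    simp at this
  obtain ⟨H, ν, h1, h2⟩ := exists_real_bound hκ0 h4 (by rw [c6_map, h6, map_zero]) hv h
  have hB' : (B.map (Rat.castHom ℝ)).det = (B.det : ℝ) := ((Rat.castHom ℝ).map_det B).symm
  have hBr : (B.det : ℝ) ≠ 0 := by exact_mod_cast hB
  have hκr : (κ : ℝ) ≠ 0 := by exact_mod_cast hκ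
  have hpos : 0 < ν ^ 2 * H.det ^ 2 := by rw [h1]; positivity
  have hν : ν ≠ 0 := by rintro rfl; simp at hpos
  have hH : H.det ≠ 0 := by intro h; simp [h] at hpos
  obtain ⟨V, hV, A₁, A₂, A₃, b, c, d, hred⟩ := exists_almostReduced
    (G := H * B.map (Rat.castHom ℝ)) (by rw [det_mul, hB']; exact mul_ne_zero hH hBr)
  have hdet := hred.det_sq
  refine ⟨V, _, A₁, A₂, A₃, b, c, d, ν ^ 2 / (κ * B.det) ^ 2, hV, hred, by positivity, ?_,
    fun j k hk => ?_⟩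
  · rw [← hdet, det_mul, det_mul, hB']
    have : (V.map (Int.cast : ℤ → ℝ)).det = V.det := (Int.cast_det V).symm
    rw [this, mul_pow, mul_pow, show ((V.det : ℤ) : ℝ) ^ 2 = 1 by exact_mod_cast hV]
    field_simp
    linear_combination 10 * h1 + 3 * hκ'
  · have e1 : (fun i => Rat.castHom ℝ ((B.mulVec fun i => (V i j : ℚ)) i)) =
        (B.map (Rat.castHom ℝ)).mulVec fun i => (V i j : ℝ) := by
      ext i
      simp [Matrix.mulVec, dotProduct]
    have e2 : (k : ℝ) * (κ * B.det) = (U.map (Rat.castHom ℝ)).eval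
        ((B.map (Rat.castHom ℝ)).mulVec fun i => (V i j : ℝ)) := by
      rw [← e1, eval_map, hk]; simp
    have h3 := h2 ((B.map (Rat.castHom ℝ)).mulVec fun i => (V i j : ℝ))
    rw [← e2, mulVec_mulVec, mul_pow] at h3
    rw [div_mul_eq_mul_div, le_div_iff₀ (by positivity)]
    exact h3

lemma eq_zero_of_sq_lt_one {k : ℤ} (h : (k : ℝ) ^ 2 < 1) : k = 0 := by
  have : k ^ 2 < 1 := by exact_mod_cast h
  exact pow_eq_zero_iff two_ne_zero |>.1 (by nlinarith [sq_nonneg k])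

lemma mulVec_column_ne_zero {B : Matrix (Fin 3) (Fin 3) ℚ} (hB : B.det ≠ 0)
    {V : Matrix (Fin 3) (Fin 3) ℤ} (hV : V.det ^ 2 = 1) (j : Fin 3) :
    (B.mulVec fun i => (V i j : ℚ)) ≠ 0 := by
  intro h
  have h1 : (fun i => (V i j : ℚ)) = 0 := by
    by_contra h0
    exact hB (exists_mulVec_eq_zero_iff.1 ⟨_, h0, h⟩)
  have h2 : V.det = 0 := Matrix.det_eq_zero_of_column_eq_zero j fun i => by
    have := congrFun h1 i
    simpa using this
  simp [h2] at hV

/-- A ternary cubic over `ℚ` with the invariants of `y² = x³ - x` which has zeros everywhere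
locally has a rational zero. -/
theorem exists_rat_zero {U : TernaryCubic ℚ} {κ : ℚ} (hκ : κ ≠ 0) (h4 : U.c4 = 48 * κ ^ 4)
    (h6 : U.c6 = 0) {v : Fin 3 → ℝ} (hv : v ≠ 0) (h : (U.map (Rat.castHom ℝ)).eval v = 0)
    (hloc : ∀ (p : ℕ) [Fact p.Prime], LocalModel (U.map (Rat.castHom ℚ_[p])) κ) :
    ∃ w : Fin 3 → ℚ, w ≠ 0 ∧ U.eval w = 0 := by
  choose g n h1 h2 using fun p (hp : Fact p.Prime) => hloc p
  obtain ⟨B, hB, hk, -, -⟩ := exists_global_model hκ (fun p hp => g p hp) (fun p hp => n p hp)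
    (fun p hp => h1 p hp) (fun p hp => h2 p hp) 2
  obtain ⟨V, N, A₁, A₂, A₃, b, c, d, R, hV, hred, hR, hRA, hcol⟩ :=
    exists_column_bound (κ' := κ) (r := 1) hκ (by ring) one_pos
      (by rw [c4_map, h4]; simp) h6 hv h hB
  obtain ⟨k, hk⟩ := hk fun i => V i 0
  refine ⟨_, mulVec_column_ne_zero hB hV 0, ?_⟩
  have hk0 : k = 0 := by
    have h3 := hcol 0 k hk
    rw [hred.col_zero] at h3
    apply eq_zero_of_sq_lt_one
    by_contra! h5
    exact one_lt_of_bounds hred hR hRA (by nlinarith)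
  rw [hk, hk0]; simp

lemma exists_unit_entry {p : ℕ} [Fact p.Prime] {M : Matrix (Fin 3) (Fin 3) ℚ_[p]}
    (hM : IsUnimodular M) {V : Matrix (Fin 3) (Fin 3) ℤ} (hV : V.det ^ 2 = 1) :
    ∃ j, ‖M.mulVec (fun i => (V i j : ℚ_[p])) 2‖ = 1 := by
  by_contra! hne
  have hle : ∀ i j, ‖M.mulVec (fun i => (V i j : ℚ_[p])) i‖ ≤ 1 := fun i j =>
    norm_mulVec_le hM.1 (fun _ => Padic.norm_int_le_one _) i
  have hdet : (M * V.map (Int.cast : ℤ → ℚ_[p])).det ^ 2 = M.det ^ 2 := by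
    have : (V.map (Int.cast : ℤ → ℚ_[p])).det = V.det := (Int.cast_det V).symm
    rw [det_mul, this, mul_pow, show ((V.det : ℤ) : ℚ_[p]) ^ 2 = 1 by exact_mod_cast hV, mul_one]
  have hn : ‖(M * V.map (Int.cast : ℤ → ℚ_[p])).det‖ = 1 := by
    have := congrArg norm hdet
    rw [norm_pow, norm_pow, hM.2] at this
    exact (sq_eq_sq₀ (norm_nonneg _) zero_le_one).1 this
  have hent : ∀ i j, (M * V.map (Int.cast : ℤ → ℚ_[p])) i j =
      M.mulVec (fun i => (V i j : ℚ_[p])) i := fun i j => rfl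
  have hlt : ∀ j, ‖M.mulVec (fun i => (V i j : ℚ_[p])) 2‖ < 1 := fun j =>
    lt_of_le_of_ne (hle 2 j) (hne j)
  refine absurd hn (ne_of_lt ?_)
  have hcof : ∀ a b c d : ℚ_[p], ‖a‖ ≤ 1 → ‖b‖ ≤ 1 → ‖c‖ ≤ 1 → ‖d‖ ≤ 1 → ‖a * b - c * d‖ ≤ 1 :=
    fun a b c d ha hb hc hd => by
    rw [sub_eq_add_neg]
    exact (Padic.nonarchimedean _ _).trans (max_le
      (by rw [norm_mul]; exact mul_le_one₀ ha (norm_nonneg _) hb)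
      (by rw [norm_neg, norm_mul]; exact mul_le_one₀ hc (norm_nonneg _) hd))
  have hterm : ∀ x y : ℚ_[p], ‖x‖ < 1 → ‖y‖ ≤ 1 → ‖x * y‖ < 1 := fun x y hx hy => by
    rw [norm_mul]; exact mul_lt_one_of_nonneg_of_lt_one_left (norm_nonneg _) hx hy
  have hexp : ∀ T : Matrix (Fin 3) (Fin 3) ℚ_[p], T.det =
      T 2 0 * (T 0 1 * T 1 2 - T 0 2 * T 1 1) + T 2 1 * (T 0 2 * T 1 0 - T 0 0 * T 1 2) +
        T 2 2 * (T 0 0 * T 1 1 - T 0 1 * T 1 0) := fun T => by rw [det_fin_three]; ring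
  rw [hexp]
  simp only [hent]
  refine (Padic.nonarchimedean _ _).trans_lt (max_lt
    ((Padic.nonarchimedean _ _).trans_lt (max_lt ?_ ?_)) ?_) <;>
  exact hterm _ _ (hlt _) (hcof _ _ _ _ (hle _ _) (hle _ _) (hle _ _) (hle _ _))

/-- A ternary cubic over `ℚ` with the invariants of `y² = x³ - 9x` which has zeros everywhere
locally has a rational zero. -/
theorem exists_rat_zero_nine {U : TernaryCubic ℚ} {κ : ℚ} (hκ : κ ≠ 0)
    (h4 : U.c4 = 48 * 9 * κ ^ 4)
    (h6 : U.c6 = 0) {v : Fin 3 → ℝ} (hv : v ≠ 0) (h : (U.map (Rat.castHom ℝ)).eval v = 0)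
    (hloc : ∀ (p : ℕ) [Fact p.Prime], LocalModel (U.map (Rat.castHom ℚ_[p])) κ)
    (hloc3 : LocalModelLine (U.map (Rat.castHom ℚ_[3])) κ) :
    ∃ w : Fin 3 → ℚ, w ≠ 0 ∧ U.eval w = 0 := by
  obtain ⟨g3, n3, a1, a2, a3⟩ := hloc3
  have hex : ∀ (p : ℕ) (_ : Fact p.Prime), ∃ (g : Matrix (Fin 3) (Fin 3) ℚ_[p]) (ν : ℚ_[p]),
      ‖ν * g.det‖ = ‖(κ : ℚ_[p])‖ ∧ (∀ v, (∀ i, ‖g.mulVec v i‖ ≤ 1) →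
        ‖(U.map (Rat.castHom ℚ_[p])).eval v‖ ≤ ‖ν‖) ∧ (p = 3 → ∀ v, (∀ i, ‖g.mulVec v i‖ ≤ 1) →
        ‖g.mulVec v 2‖ = 1 → p * ‖(U.map (Rat.castHom ℚ_[p])).eval v‖ ≤ ‖ν‖) := by
    intro p hp
    by_cases h3 : p = 3
    · subst h3
      exact ⟨g3, n3, a1, a2, fun _ => a3⟩
    · obtain ⟨g, ν, b1, b2⟩ := hloc p
      exact ⟨g, ν, b1, b2, fun h => absurd h h3⟩
  choose g n h1 h2 h3 using hex
  obtain ⟨B, hB, hk, hu, hn⟩ := exists_global_model hκ (fun p hp => g p hp) (fun p hp => n p hp)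
    (fun p hp => h1 p hp) (fun p hp => h2 p hp) 3
  have hs : √(3 : ℝ) ^ 2 = 3 := Real.sq_sqrt (by norm_num)
  obtain ⟨V, N, A₁, A₂, A₃, b, c, d, R, hV, hred, hR, hRA, hcol⟩ :=
    exists_column_bound (κ' := √3 * κ) (r := 3) hκ (by rw [mul_pow, hs]) (by norm_num)
      (by
        rw [c4_map, h4]
        simp only [eq_ratCast]
        push_cast
        rw [mul_pow, show √(3 : ℝ) ^ 4 = (√(3 : ℝ) ^ 2) ^ 2 by ring, hs]
        ring) h6 hv h hB
  choose k hk using fun j => hk fun i => V i j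
  by_cases hz : ∃ j, k j = 0
  · obtain ⟨j, hj⟩ := hz
    exact ⟨_, mulVec_column_ne_zero hB hV j, by rw [hk, hj]; simp⟩
  exfalso
  push Not at hz
  have hk1 : ∀ j, 1 ≤ ((k j : ℤ) : ℝ) ^ 2 := fun j => by
    by_contra! hlt
    exact hz j (eq_zero_of_sq_lt_one hlt)
  have hR1 : 1 ≤ R * A₁ ^ 3 := by
    have := hcol 0 (k 0) (hk 0)
    rw [hred.col_zero] at this
    exact (hk1 0).trans this
  obtain ⟨j, hj⟩ := exists_unit_entry hu hV
  have hlt := lt_of_bounds hred hR (by rw [hRA]; norm_num) hR1 j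
  have hle := hcol j (k j) (hk j)
  have hd : (3 : ℤ) ∣ k j := by
    have e1 : (fun i => Rat.castHom ℚ_[3] ((B.mulVec fun i => (V i j : ℚ)) i)) =
        (padicMap 3 B).mulVec fun i => (V i j : ℚ_[3]) := by
      ext i
      simp [Matrix.mulVec, dotProduct, padicMap]
    have h5 := h3 3 _ rfl ((padicMap 3 B).mulVec fun i => (V i j : ℚ_[3])) (fun i => by
      rw [mulVec_mulVec]
      exact norm_mulVec_le hu.1 (fun _ => Padic.norm_int_le_one _) i)
      (by rw [mulVec_mulVec]; exact hj)
    rw [← e1, eval_map, hk, hn] at h5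
    simp only [eq_ratCast] at h5
    rw [Rat.cast_mul, norm_mul] at h5
    have hpos : 0 < ‖((κ * B.det : ℚ) : ℚ_[3])‖ :=
      norm_pos_iff.2 (by exact_mod_cast mul_ne_zero hκ hB)
    have h6 : ((3 : ℕ) : ℝ) * ‖((k j : ℤ) : ℚ_[3])‖ ≤ 1 := by
      refine le_of_mul_le_mul_right ?_ hpos
      calc _ = ((3 : ℕ) : ℝ) * (‖(((k j : ℤ) : ℚ) : ℚ_[3])‖ * ‖((κ * B.det : ℚ) : ℚ_[3])‖) := by
            rw [Rat.cast_intCast]; ring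
        _ ≤ _ := by rw [one_mul]; exact h5
    have h7 : ‖((k j : ℤ) : ℚ_[3])‖ < 1 := by
      push_cast at h6
      linarith [norm_nonneg ((k j : ℤ) : ℚ_[3])]
    exact_mod_cast Padic.norm_intCast_lt_one_iff.1 h7
  obtain ⟨l, hl⟩ := hd
  have hl0 : l ≠ 0 := by rintro rfl; exact hz j (by simpa using hl)
  have hl1 : (1 : ℝ) ≤ (l : ℝ) ^ 2 := by
    by_contra! hlt
    exact hl0 (eq_zero_of_sq_lt_one hlt)
  rw [hl] at hle
  push_cast at hle
  nlinarith

end TernaryCubic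

end

section

section pencil

variable {F : Type*} [Field F]

/-- The plane cubic attached to three collinear points of `y² = x³ - x`, with `u₀ + u₁ + u₂ = -m`. -/
def collinearCubic (m c : F) (x u : Fin 3 → F) : F :=
  -(u 0 * u 1 * u 2) - m * (u 0 * u 1 + u 0 * u 2 + u 1 * u 2) +
    (u 0 * x 0 + u 1 * x 1 + u 2 * x 2) + m ^ 3 + 2 * c

lemma collinearCubic_expand {m c : F} {x : Fin 3 → F} (hx : ∀ i, x i ≠ 0) (hc : c ≠ 0)
    (e₁ : x 0 + x 1 + x 2 = m ^ 2)
    (e₂ : x 0 * x 1 + x 0 * x 2 + x 1 * x 2 = -(1 + 2 * m * c)) (e₃ : x 0 * x 1 * x 2 = c ^ 2)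
    {u : Fin 3 → F} (hu : u 0 + u 1 + u 2 = -m) {d₀ d₂ : F} (h₀ : u 0 = -(m + c / x 0) + d₀)
    (h₂ : u 2 = -(m + c / x 2) + d₂) :
    collinearCubic m c x u = -d₀ / x 2 - d₂ / x 0 - c * (d₀ ^ 2 / x 2 + d₂ ^ 2 / x 0) +
      2 * d₀ * d₂ * (m + c / x 1 + 1 / c) + d₀ * d₂ * (d₀ + d₂) := by
  obtain ⟨g₀, hg₀⟩ : ∃ g, g = (x 0)⁻¹ := ⟨_, rfl⟩
  obtain ⟨g₁, hg₁⟩ : ∃ g, g = (x 1)⁻¹ := ⟨_, rfl⟩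
  obtain ⟨g₂, hg₂⟩ : ∃ g, g = (x 2)⁻¹ := ⟨_, rfl⟩
  have k₀ : g₀ * x 0 = 1 := by rw [hg₀, inv_mul_cancel₀ (hx 0)]
  have k₁ : g₁ * x 1 = 1 := by rw [hg₁, inv_mul_cancel₀ (hx 1)]
  have k₂ : g₂ * x 2 = 1 := by rw [hg₂, inv_mul_cancel₀ (hx 2)]
  obtain ⟨b, hb⟩ : ∃ b, b = c⁻¹ := ⟨_, rfl⟩
  have hb' : b * c = 1 := by rw [hb, inv_mul_cancel₀ hc]
  simp only [div_eq_mul_inv, ← hg₀, ← hg₁, ← hg₂, ← hb, one_mul] at h₀ h₂ ⊢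
  have p02 : c ^ 2 * (g₀ * g₂) = x 1 := by
    linear_combination -g₀ * g₂ * e₃ + x 1 * (k₀ * x 2 * g₂ + k₂)
  have p01 : c ^ 2 * (g₀ * g₁) = x 2 := by
    linear_combination -g₀ * g₁ * e₃ + x 2 * (k₀ * x 1 * g₁ + k₁)
  have p12 : c ^ 2 * (g₁ * g₂) = x 0 := by
    linear_combination -g₁ * g₂ * e₃ + x 0 * (k₁ * x 2 * g₂ + k₂)
  have hsum : c * (g₀ + g₁ + g₂) = -b - 2 * m := by
    have : c ^ 2 * (g₀ + g₁ + g₂) = -(1 + 2 * m * c) := by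
      linear_combination e₂ - (g₀ + g₁ + g₂) * e₃ + k₀ * x 1 * x 2 + k₁ * x 0 * x 2 + k₂ * x 0 * x 1
    linear_combination b * this - (c * (g₀ + g₁ + g₂) + 2 * m) * hb'
  have r₀ : (m + c * g₀) ^ 2 = x 0 - g₀ := by
    linear_combination -e₁ + g₀ * e₂ - (x 1 + x 2) * k₀ - g₀ ^ 2 * e₃ + g₀ * x 1 * x 2 * k₀
  have r₂ : (m + c * g₂) ^ 2 = x 2 - g₂ := by
    linear_combination -e₁ + g₂ * e₂ - (x 1 + x 0) * k₂ - g₂ ^ 2 * e₃ + g₂ * x 1 * x 0 * k₂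
  have hab : (m + c * g₀) * (m + c * g₂) = m ^ 2 + m * c * (g₀ + g₂) + x 1 := by
    linear_combination p02
  have hU : collinearCubic m c x u = u 0 * u 2 * (u 0 + u 2) + m * (u 0 + u 2) ^ 2 +
      (u 0 + u 2) * (x 0 + x 2) + u 0 * x 0 + u 2 * x 2 + m * (x 0 + x 2) + 2 * c := by
    have h1 : u 1 = -m - u 0 - u 2 := by linear_combination hu
    have h2 : x 1 = m ^ 2 - x 0 - x 2 := by linear_combination e₁
    rw [collinearCubic, h1, h2]; ring
  rw [hU, h₀, h₂]
  linear_combination (2 * m + c * (g₀ + g₂)) * (-hab - e₁) - c * (k₀ + k₂) + 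
    d₀ * (2 * hab + r₂ + 2 * e₁) + d₂ * (2 * hab + r₀ + 2 * e₁) - 2 * d₀ * d₂ * hsum

end pencil

end

section

section pencil

variable {F : Type*} [Field F]

lemma pencil_coeff {t v₁ v₂ A E₀ E₂ : F} (ht : t ≠ 0) (hv₁ : v₁ ≠ 0) (hv₂ : v₂ ≠ 0) {f : F}
    (hf : f = 1 - t ^ 4 * A ^ 2) (hf0 : f ≠ 0) (hrel : 1 + v₁ + v₂ = 2 * A * t ^ 4 * v₁ * v₂)
    {Q₀ Q₂ K₀ K₂ K₁ a₀ a₁ a₂ Y : F} (hQ₀ : Q₀ = A + f * v₁ * v₂) (hQ₂ : Q₂ = A + f * v₁)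
    (hK₀ : K₀ = 2 * A * v₁ * v₂ * E₀) (hK₂ : K₂ = 2 * A * v₁ * E₂)
    (hK₁ : K₁ = 2 * A * v₂ * (t - E₀ - E₂))
    (ha₀ : a₀ = 1 - t ^ 3 * K₀) (ha₁ : a₁ = 1 - t ^ 3 * K₁) (ha₂ : a₂ = 1 - t ^ 3 * K₂)
    (hY : Y = K₀ * E₀ * v₂ + K₂ * E₂ - K₀ * E₂ - v₂ * K₂ * E₀ + t * (a₀ * E₀ * v₂ * Q₂ ^ 2 +
      a₂ * E₂ * Q₀ ^ 2 - A ^ 2 * (a₀ * E₂ + v₂ * a₂ * E₀)))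
    {b : F} (hb : b = f * t ^ 3 * v₁ * v₂) (X : F) {d₀ d₂ : F} (hd₀ : d₀ = -X * (t * a₀) - b * (E₀ / t))
    (hd₂ : d₂ = -X * (t * v₂ * a₂) - b * (E₂ / t)) :
    b⁻¹ * (-d₀ * (t ^ 2 * v₂ ^ 2 * (1 - (t ^ 2 * Q₂) ^ 2)) - d₂ * (t ^ 2 * (1 - (t ^ 2 * Q₀) ^ 2)) -
      b⁻¹ * (d₀ ^ 2 * (t ^ 2 * v₂ ^ 2 * (1 - (t ^ 2 * Q₂) ^ 2)) +
        d₂ ^ 2 * (t ^ 2 * (1 - (t ^ 2 * Q₀) ^ 2))) +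
      2 * d₀ * d₂ * (v₁⁻¹ / t + b) + d₀ * d₂ * (d₀ + d₂)) =
    (t * (E₀ * v₂ ^ 2 * (1 - (t ^ 2 * Q₂) ^ 2) + E₂ * (1 - (t ^ 2 * Q₀) ^ 2)) -
        ((E₀ * v₂ - E₂) ^ 2 - E₀ ^ 2 * v₂ ^ 2 * (t ^ 2 * Q₂) ^ 2 - E₂ ^ 2 * (t ^ 2 * Q₀) ^ 2 +
          2 * (t ^ 2 * A) ^ 2 * v₂ * E₀ * E₂) + 2 * (f * t ^ 2 * v₁ * v₂) ^ 2 * E₀ * E₂ -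
        f ^ 2 * t ^ 3 * v₁ ^ 2 * v₂ ^ 2 * E₀ * E₂ * (E₀ + E₂)) +
      (f⁻¹ * v₁⁻¹ * (v₂ * a₀ * (1 - (t ^ 2 * Q₂) ^ 2) + a₂ * (1 - (t ^ 2 * Q₀) ^ 2)) +
        2 * f⁻¹ * v₁⁻¹ * t ^ 2 * Y + 2 * (a₀ * E₂ + v₂ * a₂ * E₀) * f * t ^ 3 * v₁ * v₂ -
        f * t ^ 2 * v₁ * v₂ * (2 * a₀ * E₀ * E₂ + a₀ * E₂ ^ 2 + v₂ * a₂ * E₀ ^ 2 +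
          2 * v₂ * a₂ * E₀ * E₂)) * X +
      (-4 * f⁻¹ * t ^ 4 * A ^ 2 * (E₀ * v₂ - E₂) ^ 2 +
        2 * t ^ 2 * A * f⁻¹ * v₁⁻¹ * (a₀ ^ 2 + a₂ ^ 2 * v₂) + t ^ 2 * (a₀ ^ 2 + v₂ ^ 2 * a₂ ^ 2) +
        2 * t ^ 2 * v₂ * a₀ * a₂ - t * v₂ * a₀ * a₂ * (E₀ + E₂) -
        t * (a₀ * E₂ + v₂ * a₂ * E₀) * (a₀ + v₂ * a₂)) * X ^ 2 +
      f⁻¹ * a₀ * a₁ * a₂ * X ^ 3 := by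
  have hs : a₀ + v₂ * a₂ + v₁ * a₁ = 0 := by
    rw [ha₀, ha₁, ha₂, hK₀, hK₁, hK₂]; linear_combination hrel
  have G₀ : (E₀ / t) * (t ^ 2 * v₂ ^ 2 * (1 - (t ^ 2 * Q₂) ^ 2)) +
      (E₂ / t) * (t ^ 2 * (1 - (t ^ 2 * Q₀) ^ 2)) -
      ((E₀ / t) ^ 2 * (t ^ 2 * v₂ ^ 2 * (1 - (t ^ 2 * Q₂) ^ 2)) +
      (E₂ / t) ^ 2 * (t ^ 2 * (1 - (t ^ 2 * Q₀) ^ 2))) +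
      2 * b * (E₀ / t) * (E₂ / t) * (v₁⁻¹ / t + b) - b ^ 2 * (E₀ / t) * (E₂ / t) * (E₀ / t + E₂ / t) =
      (t * (E₀ * v₂ ^ 2 * (1 - (t ^ 2 * Q₂) ^ 2) + E₂ * (1 - (t ^ 2 * Q₀) ^ 2)) -
        ((E₀ * v₂ - E₂) ^ 2 - E₀ ^ 2 * v₂ ^ 2 * (t ^ 2 * Q₂) ^ 2 - E₂ ^ 2 * (t ^ 2 * Q₀) ^ 2 +
          2 * (t ^ 2 * A) ^ 2 * v₂ * E₀ * E₂) + 2 * (f * t ^ 2 * v₁ * v₂) ^ 2 * E₀ * E₂ -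
        f ^ 2 * t ^ 3 * v₁ ^ 2 * v₂ ^ 2 * E₀ * E₂ * (E₀ + E₂)) := by
    clear hQ₀ hQ₂ hY ha₀ ha₁ ha₂ hK₀ hK₁ hK₂ hd₀ hd₂ hs hrel
    subst hb
    field_simp
    linear_combination (2 * E₀ * E₂ * v₂) * hf
  have G₁ : b⁻¹ * ((t * a₀) * (t ^ 2 * v₂ ^ 2 * (1 - (t ^ 2 * Q₂) ^ 2)) +
        (t * v₂ * a₂) * (t ^ 2 * (1 - (t ^ 2 * Q₀) ^ 2))) -
      2 * b⁻¹ * ((t * a₀) * (E₀ / t) * (t ^ 2 * v₂ ^ 2 * (1 - (t ^ 2 * Q₂) ^ 2)) +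
        (t * v₂ * a₂) * (E₂ / t) * (t ^ 2 * (1 - (t ^ 2 * Q₀) ^ 2))) +
      2 * ((t * a₀) * (E₂ / t) + (t * v₂ * a₂) * (E₀ / t)) * (v₁⁻¹ / t + b) -
      b * (((t * a₀) * (E₂ / t) + (t * v₂ * a₂) * (E₀ / t)) * (E₀ / t + E₂ / t) +
        (E₀ / t) * (E₂ / t) * ((t * a₀) + (t * v₂ * a₂))) =
      (f⁻¹ * v₁⁻¹ * (v₂ * a₀ * (1 - (t ^ 2 * Q₂) ^ 2) + a₂ * (1 - (t ^ 2 * Q₀) ^ 2)) +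
        2 * f⁻¹ * v₁⁻¹ * t ^ 2 * Y + 2 * (a₀ * E₂ + v₂ * a₂ * E₀) * f * t ^ 3 * v₁ * v₂ -
        f * t ^ 2 * v₁ * v₂ * (2 * a₀ * E₀ * E₂ + a₀ * E₂ ^ 2 + v₂ * a₂ * E₀ ^ 2 +
          2 * v₂ * a₂ * E₀ * E₂)) := by
    have hY' : t ^ 3 * Y = -a₀ * E₀ * v₂ * (1 - (t ^ 2 * Q₂) ^ 2) - a₂ * E₂ * (1 - (t ^ 2 * Q₀) ^ 2) +
        f * (a₀ * E₂ + v₂ * a₂ * E₀) := by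
      rw [hY, hf, ha₀, ha₂]; ring
    clear hQ₀ hQ₂ hY ha₀ ha₁ ha₂ hK₀ hK₁ hK₂ hd₀ hd₂ hs hrel hf
    subst hb
    field_simp
    linear_combination -(2 : F) * hY'
  have G₂ : b⁻¹ * (-b⁻¹ * ((t * a₀) ^ 2 * (t ^ 2 * v₂ ^ 2 * (1 - (t ^ 2 * Q₂) ^ 2)) +
        (t * v₂ * a₂) ^ 2 * (t ^ 2 * (1 - (t ^ 2 * Q₀) ^ 2))) +
      2 * (t * a₀) * (t * v₂ * a₂) * (v₁⁻¹ / t + b) -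
      b * ((t * a₀) * (t * v₂ * a₂) * (E₀ / t + E₂ / t) +
        ((t * a₀) * (E₂ / t) + (t * v₂ * a₂) * (E₀ / t)) * ((t * a₀) + (t * v₂ * a₂)))) =
      (-4 * f⁻¹ * t ^ 4 * A ^ 2 * (E₀ * v₂ - E₂) ^ 2 +
        2 * t ^ 2 * A * f⁻¹ * v₁⁻¹ * (a₀ ^ 2 + a₂ ^ 2 * v₂) + t ^ 2 * (a₀ ^ 2 + v₂ ^ 2 * a₂ ^ 2) +
        2 * t ^ 2 * v₂ * a₀ * a₂ - t * v₂ * a₀ * a₂ * (E₀ + E₂) -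
        t * (a₀ * E₂ + v₂ * a₂ * E₀) * (a₀ + v₂ * a₂)) := by
    have hN : a₀ - a₂ = -2 * A * t ^ 3 * v₁ * (E₀ * v₂ - E₂) := by
      rw [ha₀, ha₂, hK₀, hK₂]; ring
    have k₂ : 1 - (t ^ 2 * Q₂) ^ 2 = f * (1 - 2 * t ^ 4 * A * v₁ - t ^ 4 * f * v₁ ^ 2) := by
      rw [hQ₂]; linear_combination -hf
    have k₀ : 1 - (t ^ 2 * Q₀) ^ 2 =
        f * (1 - 2 * t ^ 4 * A * v₁ * v₂ - t ^ 4 * f * (v₁ * v₂) ^ 2) := by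
      rw [hQ₀]; linear_combination -hf
    rw [k₀, k₂]
    clear hQ₀ hQ₂ hY ha₀ ha₁ ha₂ hK₀ hK₁ hK₂ hd₀ hd₂ hs hrel hf k₀ k₂ G₀ G₁
    subst hb
    field_simp
    linear_combination -(a₀ - a₂ - 2 * A * t ^ 3 * v₁ * (E₀ * v₂ - E₂)) * hN
  have G₃ : -b⁻¹ * ((t * a₀) * (t * v₂ * a₂) * ((t * a₀) + (t * v₂ * a₂))) = f⁻¹ * a₀ * a₁ * a₂ := by
    clear hQ₀ hQ₂ hY ha₀ ha₁ ha₂ hK₀ hK₁ hK₂ hd₀ hd₂ hf hrel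
    subst hb
    field_simp
    linear_combination -(a₀ * a₂) * hs
  rw [← G₀, ← G₁, ← G₂, ← G₃, hd₀, hd₂]
  have hbb : b ≠ 0 := by
    rw [hb]; exact mul_ne_zero (mul_ne_zero (mul_ne_zero hf0 (pow_ne_zero _ ht)) hv₁) hv₂
  clear hQ₀ hQ₂ hY ha₀ ha₁ ha₂ hK₀ hK₁ hK₂ hd₀ hd₂ hs hrel hf G₀ G₁ G₂ G₃
  generalize t ^ 2 * v₂ ^ 2 * (1 - (t ^ 2 * Q₂) ^ 2) = H₂
  generalize t ^ 2 * (1 - (t ^ 2 * Q₀) ^ 2) = H₀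
  generalize v₁⁻¹ / t = S
  generalize E₀ / t = e₀
  generalize E₂ / t = e₂
  generalize t * v₂ * a₂ = α₂
  generalize t * a₀ = α₀
  field_simp
  ring

end pencil

end

section

section pencil

variable {F : Type*} [NormedField F] [IsUltrametricDist F]

lemma ultra_add_le {x y : F} {r : ℝ} (hx : ‖x‖ ≤ r) (hy : ‖y‖ ≤ r) : ‖x + y‖ ≤ r :=
  (IsUltrametricDist.norm_add_le_max x y).trans (max_le hx hy)

lemma ultra_add_lt {x y : F} {r : ℝ} (hx : ‖x‖ < r) (hy : ‖y‖ < r) : ‖x + y‖ < r :=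
  (IsUltrametricDist.norm_add_le_max x y).trans_lt (max_lt hx hy)

lemma ultra_add_eq {x y : F} (h : ‖y‖ < ‖x‖) : ‖x + y‖ = ‖x‖ := by
  rw [IsUltrametricDist.norm_add_eq_max_of_norm_ne_norm h.ne', max_eq_left h.le]

variable (F) in
/-- The closed unit ball of a nonarchimedean normed field. -/
def closedUnitBall : Subring F where
  carrier := {x | ‖x‖ ≤ 1}
  mul_mem' {x y} hx hy := by
    simp only [Set.mem_ofPred_eq, norm_mul] at *; exact mul_le_one₀ hx (norm_nonneg _) hy
  one_mem' := by simp
  add_mem' hx hy := ultra_add_le hx hy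
  zero_mem' := by simp
  neg_mem' := by simp

variable (F) in
/-- The open unit ball, as an ideal of the closed unit ball. -/
def openUnitBall : Ideal (closedUnitBall F) where
  carrier := {x | ‖(x : F)‖ < 1}
  add_mem' hx hy := ultra_add_lt hx hy
  zero_mem' := by simp
  smul_mem' x y hy := by
    simp only [Set.mem_ofPred_eq, smul_eq_mul, Subring.coe_mul, norm_mul] at *
    exact mul_lt_one_of_nonneg_of_lt_one_right x.2 (norm_nonneg _) hy

lemma mk_openUnitBall_eq_zero {x : closedUnitBall F} :
    Ideal.Quotient.mk (openUnitBall F) x = 0 ↔ ‖(x : F)‖ < 1 :=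
  Ideal.Quotient.eq_zero_iff_mem

lemma norm_eq_one_of_mk_eq_neg_one {x : closedUnitBall F}
    (h : Ideal.Quotient.mk (openUnitBall F) x = -1) : ‖(x : F)‖ = 1 := by
  have : Ideal.Quotient.mk (openUnitBall F) (x + 1) = 0 := by rw [map_add, h]; simp
  rw [mk_openUnitBall_eq_zero] at this
  have h2 : (x : F) = -1 + ((x + 1 : closedUnitBall F) : F) := by simp
  have h3 : ‖(-1 : F)‖ = 1 := by simp
  rw [h2, ultra_add_eq (by rw [h3]; exact this), h3]

theorem exists_pencil_coeff {m c : F} {x e : Fin 3 → F} (e₁ : x 0 + x 1 + x 2 = m ^ 2)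
    (e₂ : x 0 * x 1 + x 0 * x 2 + x 1 * x 2 = -(1 + 2 * m * c)) (e₃ : x 0 * x 1 * x 2 = c ^ 2)
    (hρ : 1 < ‖x 0‖) (hx₁ : ‖x 1‖ = ‖x 0‖) (hx₂ : ‖x 2‖ = ‖x 0‖) (he : e 0 + e 1 + e 2 = 1)
    (he₀ : ‖e 0‖ ^ 2 ≤ ‖x 0‖) (he₂ : ‖e 2‖ ^ 2 ≤ ‖x 0‖) {t : Fin 3 → F}
    (ht : ∀ i, t i = x i / (m * x i + c)) (hN : ‖e 0 * t 2 - e 2 * t 0‖ < 1) :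
    ∃ g₀ g₁ g₂ g₃ : F, ‖g₀‖ < 1 ∧ ‖g₁‖ = 1 ∧ ‖g₂‖ < 1 ∧ ‖g₃‖ ≤ 1 ∧
      ∀ (X : F) (u : Fin 3 → F),
        (∀ i, u i = -(m + c / x i) + X * (-t i + (t 0 + t 1 + t 2) * e i) - e i / c) →
        c * collinearCubic m c x u = g₀ + g₁ * X + g₂ * X ^ 2 + g₃ * X ^ 3 := by
  have hρ0 : 0 < ‖x 0‖ := one_pos.trans hρ
  have hxn : ∀ i, ‖x i‖ = ‖x 0‖ := by intro i; fin_cases i <;> simp [hx₁, hx₂]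
  have hx : ∀ i, x i ≠ 0 := fun i => norm_pos_iff.1 (by rw [hxn]; exact hρ0)
  have hcn : ‖c‖ ^ 2 = ‖x 0‖ ^ 3 := by
    rw [← norm_pow, ← e₃, norm_mul, norm_mul, hxn 1, hxn 2]; ring
  have hmn : ‖m‖ ^ 2 ≤ ‖x 0‖ := by
    rw [← norm_pow, ← e₁]
    exact ultra_add_le (ultra_add_le le_rfl hx₁.le) hx₂.le
  have hc : c ≠ 0 := by
    rintro rfl; rw [norm_zero] at hcn; have := pow_pos hρ0 3; simp at hcn; linarith
  obtain ⟨y, hy⟩ : ∃ y : Fin 3 → F, ∀ i, y i = m * x i + c := ⟨_, fun _ => rfl⟩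
  have hroot : ∀ i, x i ^ 3 - m ^ 2 * x i ^ 2 - (1 + 2 * m * c) * x i - c ^ 2 = 0 := by
    intro i
    have : x i ^ 3 - m ^ 2 * x i ^ 2 - (1 + 2 * m * c) * x i - c ^ 2 =
      (x i - x 0) * (x i - x 1) * (x i - x 2) := by
      linear_combination x i ^ 2 * e₁ - x i * e₂ + e₃
    rw [this]; fin_cases i <;> simp
  have hyx : ∀ i, y i ^ 2 = x i ^ 3 - x i := by
    intro i; rw [hy]; linear_combination -(hroot i)
  have hyn : ∀ i, ‖y i‖ ^ 2 = ‖x 0‖ ^ 3 := by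
    intro i
    rw [← norm_pow, hyx, sub_eq_add_neg, ultra_add_eq, norm_pow, hxn]
    rw [norm_neg, norm_pow, hxn]
    exact lt_self_pow₀ hρ (by norm_num)
  have hy0 : ∀ i, y i ≠ 0 := by
    intro i h0
    have := hyn i
    rw [h0, norm_zero] at this; have := pow_pos hρ0 3; simp at *; linarith
  have hty : ∀ i, t i * y i = x i := by
    intro i; rw [ht, ← hy, div_mul_cancel₀ _ (hy0 i)]
  have htn : ∀ i, ‖t i‖ ^ 2 * ‖x 0‖ = 1 := by
    intro i
    have h1 := congrArg (‖·‖ ^ 2) (hty i)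
    simp only [norm_mul, mul_pow, hyn, hxn] at h1
    have : ‖x 0‖ ^ 2 * (‖t i‖ ^ 2 * ‖x 0‖ - 1) = 0 := by linear_combination h1
    have := (mul_eq_zero.1 this).resolve_left (pow_ne_zero _ hρ0.ne')
    linarith
  have ht0 : ∀ i, t i ≠ 0 := fun i h0 => by simpa [h0] using htn i
  have hprod : y 0 * y 1 * y 2 = c * (c ^ 2 - m ^ 2) := by
    rw [hy, hy, hy]; linear_combination m ^ 3 * e₃ + m ^ 2 * c * e₂ + m * c ^ 2 * e₁
  have hcm : c ^ 2 - m ^ 2 ≠ 0 := by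
    intro h0
    rw [h0, mul_zero] at hprod
    simp [hy0] at hprod
  have hxyy : x 0 * y 1 * y 2 + y 0 * x 1 * y 2 + y 0 * y 1 * x 2 = -2 * m * c := by
    rw [hy, hy, hy]; linear_combination 3 * m ^ 2 * e₃ + 2 * m * c * e₂ + c ^ 2 * e₁
  have hsumt : (t 0 + t 1 + t 2) * c = -2 * m * (t 0 * t 1 * t 2) := by
    rw [ht, ht, ht, ← hy, ← hy, ← hy]
    have := hy0 0; have := hy0 1; have := hy0 2
    field_simp
    linear_combination c * hxyy + 2 * m * e₃
  have hprodt : (c ^ 2 - m ^ 2) * (t 0 * t 1 * t 2) = c := by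
    rw [ht, ht, ht, ← hy, ← hy, ← hy]
    have := hy0 0; have := hy0 1; have := hy0 2
    field_simp
    linear_combination (c ^ 2 - m ^ 2) * e₃ - c * hprod
  obtain ⟨T, hT⟩ : ∃ T, T = t 0 := ⟨_, rfl⟩
  obtain ⟨v₁, hv₁⟩ : ∃ v, v = t 1 / T := ⟨_, rfl⟩
  obtain ⟨v₂, hv₂⟩ : ∃ v, v = t 2 / T := ⟨_, rfl⟩
  obtain ⟨A, hA⟩ : ∃ v, v = -m / (c * T ^ 2) := ⟨_, rfl⟩
  obtain ⟨E₀, hE₀⟩ : ∃ v, v = e 0 * T := ⟨_, rfl⟩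
  obtain ⟨E₂, hE₂⟩ : ∃ v, v = e 2 * T := ⟨_, rfl⟩
  obtain ⟨f, hf⟩ : ∃ v, v = 1 - T ^ 4 * A ^ 2 := ⟨_, rfl⟩
  have hT0 : T ≠ 0 := hT ▸ ht0 0
  have hTn : ‖T‖ ^ 2 * ‖x 0‖ = 1 := hT ▸ htn 0
  have hTn0 : 0 < ‖T‖ := norm_pos_iff.2 hT0
  have hT1 : ‖T‖ < 1 := by
    by_contra! h
    nlinarith [one_le_pow₀ h (n := 2)]
  have hvn : ∀ i, ‖t i / T‖ = 1 := by
    intro i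
    rw [norm_div, div_eq_one_iff_eq hTn0.ne']
    have h1 : ‖t i‖ ^ 2 = ‖T‖ ^ 2 := mul_right_cancel₀ hρ0.ne' ((htn i).trans hTn.symm)
    exact (pow_left_inj₀ (norm_nonneg _) (norm_nonneg _) two_ne_zero).1 h1
  have hv₁n : ‖v₁‖ = 1 := hv₁ ▸ hvn 1
  have hv₂n : ‖v₂‖ = 1 := hv₂ ▸ hvn 2
  have hv₁0 : v₁ ≠ 0 := norm_pos_iff.1 (hv₁n ▸ one_pos)
  have hv₂0 : v₂ ≠ 0 := norm_pos_iff.1 (hv₂n ▸ one_pos)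
  have sq_le : ∀ z : F, ‖z‖ ^ 2 ≤ 1 → ‖z‖ ≤ 1 := fun z hz =>
    (pow_le_one_iff_of_nonneg (norm_nonneg _) two_ne_zero).1 hz
  have hAn : ‖A‖ ≤ 1 := by
    apply sq_le
    have h1 : ‖A‖ ^ 2 * ‖x 0‖ = ‖m‖ ^ 2 := by
      have : A * (c * T ^ 2) = -m := by
        rw [hA, div_mul_cancel₀ _ (mul_ne_zero hc (pow_ne_zero _ hT0))]
      have h2 := congrArg (‖·‖ ^ 2) this
      simp only [norm_mul, mul_pow, norm_pow, norm_neg, hcn] at h2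
      rw [← h2]
      linear_combination -(‖A‖ ^ 2 * ‖x 0‖ * (‖T‖ ^ 2 * ‖x 0‖ + 1)) * hTn
    nlinarith
  have hen : ∀ z : F, ‖z‖ ^ 2 ≤ ‖x 0‖ → ‖z * T‖ ≤ 1 := by
    intro z hz
    apply sq_le
    rw [norm_mul, mul_pow, ← hTn, mul_comm]
    exact mul_le_mul_of_nonneg_left hz (by positivity)
  have hE₀n : ‖E₀‖ ≤ 1 := hE₀ ▸ hen _ he₀
  have hE₂n : ‖E₂‖ ≤ 1 := hE₂ ▸ hen _ he₂
  have hfn : ‖f‖ = 1 := by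
    rw [hf, sub_eq_add_neg, ultra_add_eq, norm_one]
    rw [norm_neg, norm_mul, norm_pow, norm_pow, norm_one]
    calc ‖T‖ ^ 4 * ‖A‖ ^ 2 ≤ ‖T‖ ^ 4 * 1 := by gcongr; exact pow_le_one₀ (norm_nonneg _) hAn
      _ < 1 := by rw [mul_one]; exact pow_lt_one₀ (norm_nonneg _) hT1 (by norm_num)
  have hf0 : f ≠ 0 := norm_pos_iff.1 (hfn ▸ one_pos)
  have ht1 : t 1 = v₁ * T := by rw [hv₁, div_mul_cancel₀ _ hT0]
  have ht2 : t 2 = v₂ * T := by rw [hv₂, div_mul_cancel₀ _ hT0]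
  have hmA : m = -A * (c * T ^ 2) := by
    rw [hA]; field_simp
  rw [ht1, ht2, ← hT] at hsumt hprodt
  have hrel : 1 + v₁ + v₂ = 2 * A * T ^ 4 * v₁ * v₂ := by
    have : c * T * (1 + v₁ + v₂ - 2 * A * T ^ 4 * v₁ * v₂) = 0 := by
      rw [hmA] at hsumt; linear_combination hsumt
    have := (mul_eq_zero.1 this).resolve_left (mul_ne_zero hc hT0)
    linear_combination this
  have hb : c⁻¹ = f * T ^ 3 * v₁ * v₂ := by
    rw [inv_eq_iff_eq_inv]
    apply eq_inv_of_mul_eq_one_left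
    have : c * (c * (f * T ^ 3 * v₁ * v₂) - 1) = 0 := by
      rw [hmA] at hprodt; rw [hf]; linear_combination hprodt
    have := (mul_eq_zero.1 this).resolve_left hc
    linear_combination this
  have hcb : c = (f * T ^ 3 * v₁ * v₂)⁻¹ := by rw [← hb, inv_inv]
  have hbc : f * T ^ 3 * v₁ * v₂ * c = 1 := by rw [← hb, inv_mul_cancel₀ hc]
  have hxi : ∀ i, (x i)⁻¹ * (c * t i) = 1 - m * t i := by
    intro i
    have h1 := hty i
    rw [hy] at h1
    have := hx i
    field_simp
    linear_combination h1
  have hx0' : T ^ 2 * (A + f * v₁ * v₂) = (x 0)⁻¹ := by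
    have h1 := hxi 0
    rw [← hT] at h1
    apply mul_right_cancel₀ (mul_ne_zero hc hT0)
    rw [h1, hmA]; linear_combination hbc
  have hx2' : T ^ 2 * (A + f * v₁) = (x 2)⁻¹ := by
    have h1 := hxi 2
    apply mul_right_cancel₀ (mul_ne_zero hc (ht0 2))
    rw [h1, hmA, ht2]; linear_combination hbc
  have hsq : ∀ i, t i ^ 2 * (1 - (x i)⁻¹ ^ 2) = (x i)⁻¹ := by
    intro i
    have h1 : t i ^ 2 * y i ^ 2 = x i ^ 2 := by rw [← mul_pow, hty]
    rw [hyx] at h1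
    have h2 := hx i
    field_simp
    apply mul_left_cancel₀ (hx i)
    linear_combination h1
  have hs1 : m + c / x 1 = v₁⁻¹ / T := by
    have h1 : v₁⁻¹ / T = (t 1)⁻¹ := by rw [ht1, mul_inv, div_eq_mul_inv]
    rw [h1, div_eq_mul_inv]
    apply eq_inv_of_mul_eq_one_left
    linear_combination hxi 1
  have c2 : ((2 : closedUnitBall F) : F) = 2 := rfl
  have c4 : ((4 : closedUnitBall F) : F) = 4 := rfl
  obtain ⟨τ, hτ⟩ : ∃ z : closedUnitBall F, (z : F) = T := ⟨⟨T, hT1.le⟩, rfl⟩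
  obtain ⟨w₁, hw₁⟩ : ∃ z : closedUnitBall F, (z : F) = v₁ := ⟨⟨v₁, hv₁n.le⟩, rfl⟩
  obtain ⟨w₂, hw₂⟩ : ∃ z : closedUnitBall F, (z : F) = v₂ := ⟨⟨v₂, hv₂n.le⟩, rfl⟩
  obtain ⟨W, hW⟩ : ∃ z : closedUnitBall F, (z : F) = v₁⁻¹ :=
    ⟨⟨v₁⁻¹, (by rw [norm_inv, hv₁n, inv_one] : ‖v₁⁻¹‖ = 1).le⟩, rfl⟩
  obtain ⟨B, hB⟩ : ∃ z : closedUnitBall F, (z : F) = A := ⟨⟨A, hAn⟩, rfl⟩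
  obtain ⟨D₀, hD₀⟩ : ∃ z : closedUnitBall F, (z : F) = E₀ := ⟨⟨E₀, hE₀n⟩, rfl⟩
  obtain ⟨D₂, hD₂⟩ : ∃ z : closedUnitBall F, (z : F) = E₂ := ⟨⟨E₂, hE₂n⟩, rfl⟩
  obtain ⟨h, hh⟩ : ∃ z : closedUnitBall F, (z : F) = f := ⟨⟨f, hfn.le⟩, rfl⟩
  obtain ⟨φ, hφ⟩ : ∃ z : closedUnitBall F, (z : F) = f⁻¹ :=
    ⟨⟨f⁻¹, (by rw [norm_inv, hfn, inv_one] : ‖f⁻¹‖ = 1).le⟩, rfl⟩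
  have kτ : Ideal.Quotient.mk (openUnitBall F) τ = 0 := mk_openUnitBall_eq_zero.2 (hτ ▸ hT1)
  have kN : Ideal.Quotient.mk (openUnitBall F) (D₀ * w₂ - D₂) = 0 := by
    rw [mk_openUnitBall_eq_zero]
    push_cast
    rw [hD₀, hw₂, hD₂, hE₀, hE₂]
    rw [ht2, ← hT] at hN
    convert hN using 2; ring
  have kW : W * w₁ = 1 := by
    apply Subtype.ext
    push_cast
    rw [hW, hw₁, inv_mul_cancel₀ hv₁0]
  have kφ : φ * h = 1 := by
    apply Subtype.ext
    push_cast
    rw [hφ, hh, inv_mul_cancel₀ hf0]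
  have kh : h = 1 - τ ^ 4 * B ^ 2 := by
    apply Subtype.ext
    push_cast
    rw [hh, hτ, hB, hf]
  have kr : 1 + w₁ + w₂ = 2 * B * τ ^ 4 * w₁ * w₂ := by
    apply Subtype.ext
    push_cast
    rw [hw₁, hw₂, hB, hτ, hrel]; rfl
  obtain ⟨Q₀, hQ₀⟩ : ∃ Q, Q = B + h * w₁ * w₂ := ⟨_, rfl⟩
  obtain ⟨Q₂, hQ₂⟩ : ∃ Q, Q = B + h * w₁ := ⟨_, rfl⟩
  obtain ⟨K₀, hK₀⟩ : ∃ K, K = 2 * B * w₁ * w₂ * D₀ := ⟨_, rfl⟩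
  obtain ⟨K₂, hK₂⟩ : ∃ K, K = 2 * B * w₁ * D₂ := ⟨_, rfl⟩
  obtain ⟨K₁, hK₁⟩ : ∃ K, K = 2 * B * w₂ * (τ - D₀ - D₂) := ⟨_, rfl⟩
  obtain ⟨a₀, ha₀⟩ : ∃ a, a = 1 - τ ^ 3 * K₀ := ⟨_, rfl⟩
  obtain ⟨a₁, ha₁⟩ : ∃ a, a = 1 - τ ^ 3 * K₁ := ⟨_, rfl⟩
  obtain ⟨a₂, ha₂⟩ : ∃ a, a = 1 - τ ^ 3 * K₂ := ⟨_, rfl⟩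
  obtain ⟨Y, hY⟩ : ∃ Y, Y = K₀ * D₀ * w₂ + K₂ * D₂ - K₀ * D₂ - w₂ * K₂ * D₀ +
      τ * (a₀ * D₀ * w₂ * Q₂ ^ 2 + a₂ * D₂ * Q₀ ^ 2 - B ^ 2 * (a₀ * D₂ + w₂ * a₂ * D₀)) :=
    ⟨_, rfl⟩
  refine ⟨((τ * (D₀ * w₂ ^ 2 * (1 - (τ ^ 2 * Q₂) ^ 2) + D₂ * (1 - (τ ^ 2 * Q₀) ^ 2)) -
        ((D₀ * w₂ - D₂) ^ 2 - D₀ ^ 2 * w₂ ^ 2 * (τ ^ 2 * Q₂) ^ 2 - D₂ ^ 2 * (τ ^ 2 * Q₀) ^ 2 +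
          2 * (τ ^ 2 * B) ^ 2 * w₂ * D₀ * D₂) + 2 * (h * τ ^ 2 * w₁ * w₂) ^ 2 * D₀ * D₂ -
        h ^ 2 * τ ^ 3 * w₁ ^ 2 * w₂ ^ 2 * D₀ * D₂ * (D₀ + D₂) : closedUnitBall F) : F),
      ((φ * W * (w₂ * a₀ * (1 - (τ ^ 2 * Q₂) ^ 2) + a₂ * (1 - (τ ^ 2 * Q₀) ^ 2)) +
        2 * φ * W * τ ^ 2 * Y + 2 * (a₀ * D₂ + w₂ * a₂ * D₀) * h * τ ^ 3 * w₁ * w₂ -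
        h * τ ^ 2 * w₁ * w₂ * (2 * a₀ * D₀ * D₂ + a₀ * D₂ ^ 2 + w₂ * a₂ * D₀ ^ 2 +
          2 * w₂ * a₂ * D₀ * D₂) : closedUnitBall F) : F),
      ((-4 * φ * τ ^ 4 * B ^ 2 * (D₀ * w₂ - D₂) ^ 2 +
        2 * τ ^ 2 * B * φ * W * (a₀ ^ 2 + a₂ ^ 2 * w₂) + τ ^ 2 * (a₀ ^ 2 + w₂ ^ 2 * a₂ ^ 2) +
        2 * τ ^ 2 * w₂ * a₀ * a₂ - τ * w₂ * a₀ * a₂ * (D₀ + D₂) -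
        τ * (a₀ * D₂ + w₂ * a₂ * D₀) * (a₀ + w₂ * a₂) : closedUnitBall F) : F),
      ((φ * a₀ * a₁ * a₂ : closedUnitBall F) : F), ?_, ?_, ?_, (φ * a₀ * a₁ * a₂).2, ?_⟩
  · rw [← mk_openUnitBall_eq_zero]
    simp only [map_add, map_sub, map_mul, map_pow, kτ] at kN ⊢
    linear_combination -(Ideal.Quotient.mk (openUnitBall F) D₀ *
      Ideal.Quotient.mk (openUnitBall F) w₂ - Ideal.Quotient.mk (openUnitBall F) D₂) * kN
  · apply norm_eq_one_of_mk_eq_neg_one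
    have kr' := congrArg (Ideal.Quotient.mk (openUnitBall F)) kr
    have kφ' := congrArg (Ideal.Quotient.mk (openUnitBall F)) kφ
    have kW' := congrArg (Ideal.Quotient.mk (openUnitBall F)) kW
    rw [kh] at kφ'
    rw [ha₀, ha₂]
    simp only [map_add, map_sub, map_mul, map_pow, map_one, kτ] at kr' kφ' kW' ⊢
    linear_combination Ideal.Quotient.mk (openUnitBall F) φ *
      Ideal.Quotient.mk (openUnitBall F) W * kr' - kφ' -
      Ideal.Quotient.mk (openUnitBall F) φ * kW'
  · rw [← mk_openUnitBall_eq_zero]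
    simp only [map_add, map_sub, map_mul, map_pow, kτ]
    ring
  · intro X u hu
    have hd₀ : u 0 = -(m + c / x 0) + (-X * (T * a₀) - f * T ^ 3 * v₁ * v₂ * (E₀ / T)) := by
      rw [hu 0, div_eq_mul_inv (e 0), hb, ha₀, hK₀, ht1, ht2, ← hT, hE₀]
      push_cast
      rw [hτ, hB, hw₁, hw₂, hD₀, hE₀, c2]
      field_simp
      linear_combination X * e 0 * T * hrel
    have hd₂ : u 2 = -(m + c / x 2) + (-X * (T * v₂ * a₂) - f * T ^ 3 * v₁ * v₂ * (E₂ / T)) := by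
      rw [hu 2, div_eq_mul_inv (e 2), hb, ha₂, hK₂, ht1, ht2, ← hT, hE₂]
      push_cast
      rw [hτ, hB, hw₁, hD₂, hE₂, c2]
      field_simp
      linear_combination X * e 2 * T * hrel
    have hus : u 0 + u 1 + u 2 = -m := by
      have hinv : (x 0)⁻¹ + (x 1)⁻¹ + (x 2)⁻¹ = -(1 + 2 * m * c) / c ^ 2 := by
        have := hx 0; have := hx 1; have := hx 2
        rw [← e₂, ← e₃]
        field_simp
        ring
      rw [hu, hu, hu]
      have h1 : c * ((x 0)⁻¹ + (x 1)⁻¹ + (x 2)⁻¹) = -c⁻¹ - 2 * m := by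
        rw [hinv]; field_simp; ring
      simp only [div_eq_mul_inv] at *
      linear_combination -h1 + (X * (t 0 + t 1 + t 2) - c⁻¹) * he
    rw [collinearCubic_expand hx hc e₁ e₂ e₃ hus hd₀ hd₂, hs1, one_div, hb]
    have key := pencil_coeff (E₀ := E₀) (E₂ := E₂) (Q₀ := Q₀) (Q₂ := Q₂) (K₀ := K₀) (K₁ := K₁)
      (K₂ := K₂) (a₀ := a₀) (a₁ := a₁) (a₂ := a₂) (Y := Y) hT0 hv₁0 hv₂0 hf hf0 hrel
      (by simp [hQ₀, hB, hh, hw₁, hw₂]) (by simp [hQ₂, hB, hh, hw₁])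
      (by simp [hK₀, c2, hB, hw₁, hw₂, hD₀]) (by simp [hK₂, c2, hB, hw₁, hD₂])
      (by simp [hK₁, c2, hB, hw₂, hτ, hD₀, hD₂]) (by simp [ha₀, hτ]) (by simp [ha₁, hτ])
      (by simp [ha₂, hτ]) (by simp [hY, hτ, hD₀, hD₂, hw₂, hB]) rfl X rfl rfl
    have kQ₀ : (Q₀ : F) = A + f * v₁ * v₂ := by simp [hQ₀, hB, hh, hw₁, hw₂]
    have kQ₂ : (Q₂ : F) = A + f * v₁ := by simp [hQ₂, hB, hh, hw₁]
    have k0 : T ^ 2 * (1 - (T ^ 2 * Q₀) ^ 2) = (x 0)⁻¹ := by rw [kQ₀, hx0', hT, hsq 0]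
    have k2 : T ^ 2 * v₂ ^ 2 * (1 - (T ^ 2 * Q₂) ^ 2) = (x 2)⁻¹ := by
      
      rw [kQ₂, hx2']
      have := hsq 2
      rw [ht2] at this
      linear_combination this
    rw [k0, k2] at key
    push_cast
    simp only [c2, c4, hτ, hD₀, hD₂, hw₁, hw₂, hB, hh, hφ, hW]
    rw [← key, ← hcb]
    ring

end pencil

end

section

section

variable {p : ℕ} [Fact p.Prime]

open Polynomial in
lemma Padic.exists_cubic_root {g₀ g₁ g₂ g₃ : ℚ_[p]} (h₀ : ‖g₀‖ < 1) (h₁ : ‖g₁‖ = 1)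
    (h₂ : ‖g₂‖ ≤ 1) (h₃ : ‖g₃‖ ≤ 1) :
    ∃ X : ℚ_[p], g₀ + g₁ * X + g₂ * X ^ 2 + g₃ * X ^ 3 = 0 := by
  obtain ⟨g₀, rfl⟩ : ∃ z : ℤ_[p], (z : ℚ_[p]) = g₀ := ⟨⟨_, h₀.le⟩, rfl⟩
  obtain ⟨g₁, rfl⟩ : ∃ z : ℤ_[p], (z : ℚ_[p]) = g₁ := ⟨⟨_, h₁.le⟩, rfl⟩
  obtain ⟨g₂, rfl⟩ : ∃ z : ℤ_[p], (z : ℚ_[p]) = g₂ := ⟨⟨_, h₂⟩, rfl⟩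
  obtain ⟨g₃, rfl⟩ : ∃ z : ℤ_[p], (z : ℚ_[p]) = g₃ := ⟨⟨_, h₃⟩, rfl⟩
  let F : ℤ_[p][X] := C g₀ + C g₁ * X + C g₂ * X ^ 2 + C g₃ * X ^ 3
  have e0 : F.aeval (0 : ℤ_[p]) = g₀ := by simp [F]
  have e1 : F.derivative.aeval (0 : ℤ_[p]) = g₁ := by simp [F]
  obtain ⟨z, hz, -⟩ := hensels_lemma (F := F) (a := (0 : ℤ_[p])) (by
    rw [e0, e1, show ‖g₁‖ = 1 from h₁]; simpa using h₀)
  refine ⟨z, ?_⟩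
  have : g₀ + g₁ * z + g₂ * z ^ 2 + g₃ * z ^ 3 = 0 := by simpa [F] using hz
  exact_mod_cast congrArg ((↑) : ℤ_[p] → ℚ_[p]) this

lemma cubic_coeff_mem {K L : Type*} [Field K] [Field L] [CharZero L] [Algebra K L] {g₀ g₁ g₂ g₃ : L}
    (h : ∀ X : K, ∃ Y : K, algebraMap K L Y =
      g₀ + g₁ * algebraMap K L X + g₂ * algebraMap K L X ^ 2 + g₃ * algebraMap K L X ^ 3) :
    ∃ k₀ k₁ k₂ k₃ : K, algebraMap K L k₀ = g₀ ∧ algebraMap K L k₁ = g₁ ∧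
      algebraMap K L k₂ = g₂ ∧ algebraMap K L k₃ = g₃ := by
  obtain ⟨y₀, h₀⟩ := h 0
  obtain ⟨y₁, h₁⟩ := h 1
  obtain ⟨y₂, h₂⟩ := h (-1)
  obtain ⟨y₃, h₃⟩ := h 2
  simp only [map_zero, map_one, map_neg, map_ofNat] at h₀ h₁ h₂ h₃
  refine ⟨y₀, -y₀ / 2 + y₁ - y₂ / 3 - y₃ / 6, (y₁ + y₂) / 2 - y₀,
    (y₃ - 3 * y₁ + 3 * y₀ - y₂) / 6, ?_, ?_, ?_, ?_⟩ <;>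
  simp only [map_add, map_sub, map_neg, map_mul, map_div₀, map_ofNat, h₀, h₁, h₂, h₃] <;> ring

end

section cubicField

variable {K L : Type*} [Field K] [Field L] [Algebra K L]

/-- The value at `l` of the quadratic polynomial `A + B X + C X²`. -/
def quad (l : L) (A B C : K) : L :=
  algebraMap K L A + algebraMap K L B * l + algebraMap K L C * l ^ 2

open Polynomial in
lemma irreducible_X_pow_three_sub {a : K} (hn : ∀ y : K, y ^ 3 ≠ a) :
    Irreducible (X ^ 3 - C a : K[X]) :=
  X_pow_sub_C_irreducible_of_prime Nat.prime_three hn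

open Polynomial in
lemma minpoly_cbrt {a : K} (hn : ∀ y : K, y ^ 3 ≠ a) {l : L} (hl : l ^ 3 = algebraMap K L a) :
    minpoly K l = X ^ 3 - C a :=
  (minpoly.eq_of_irreducible_of_monic (irreducible_X_pow_three_sub hn) (by simp [hl])
    (monic_X_pow_sub_C _ (by norm_num))).symm

open Polynomial in
lemma isIntegral_cbrt {a : K} {l : L} (hl : l ^ 3 = algebraMap K L a) : IsIntegral K l :=
  ⟨X ^ 3 - C a, monic_X_pow_sub_C _ (by norm_num), by simp [hl]⟩

open IntermediateField in
lemma quad_mem (l : L) (A B C : K) : quad l A B C ∈ K⟮l⟯ := by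
  have h := mem_adjoin_simple_self K l
  exact add_mem (add_mem (IntermediateField.algebraMap_mem _ _) (mul_mem (IntermediateField.algebraMap_mem _ _) h))
    (mul_mem (IntermediateField.algebraMap_mem _ _) (pow_mem h _))

open IntermediateField Polynomial in
lemma exists_quad {a : K} {l : L} (hl : l ^ 3 = algebraMap K L a) {y : L} (hy : y ∈ K⟮l⟯) :
    ∃ A B C : K, y = quad l A B C := by
  have hi := isIntegral_cbrt hl
  rw [← IntermediateField.mem_toSubalgebra,
    IntermediateField.adjoin_simple_toSubalgebra_of_isAlgebraic hi.isAlgebraic,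
    Algebra.adjoin_singleton_eq_range_aeval] at hy
  obtain ⟨f, rfl⟩ := hy
  have hm : (X ^ 3 - C a : K[X]).Monic := monic_X_pow_sub_C _ (by norm_num)
  refine ⟨(f %ₘ (X ^ 3 - C a)).coeff 0, (f %ₘ (X ^ 3 - C a)).coeff 1,
    (f %ₘ (X ^ 3 - C a)).coeff 2, ?_⟩
  have h1 : aeval l f = aeval l (f %ₘ (X ^ 3 - C a)) := by
    conv_lhs => rw [← modByMonic_add_div f (X ^ 3 - C a)]
    simp [hl]
  have h2 : (f %ₘ (X ^ 3 - C a)).natDegree < 3 := by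
    have := natDegree_modByMonic_lt f hm (by
      intro h; have := congrArg natDegree h; rw [natDegree_X_pow_sub_C] at this; simp at this)
    rwa [natDegree_X_pow_sub_C] at this
  change aeval l f = _
  rw [h1, aeval_eq_sum_range' h2]
  simp [Finset.sum_range_succ, quad, Algebra.smul_def]

lemma map_quad {σ : L ≃ₐ[K] L} {l l' : L} (h : σ l = l') (A B C : K) :
    σ (quad l A B C) = quad l' A B C := by
  simp [quad, h]

lemma quad_sum {l ω : L} (hω : ω ^ 2 + ω + 1 = 0) (A B C : K) :
    quad l A B C + quad (ω * l) A B C + quad (ω ^ 2 * l) A B C = 3 * algebraMap K L A := by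
  simp only [quad]
  linear_combination (algebraMap K L B * l + (ω ^ 2 - ω + 1) * algebraMap K L C * l ^ 2) * hω

lemma exists_algEquiv_cbrt [Normal K L] {a : K} (hn : ∀ y : K, y ^ 3 ≠ a) {l l' : L}
    (hl : l ^ 3 = algebraMap K L a) (hl' : l' ^ 3 = algebraMap K L a) :
    ∃ σ : L ≃ₐ[K] L, σ l = l' := by
  have : IsConjRoot K l' l := by rw [IsConjRoot, minpoly_cbrt hn hl, minpoly_cbrt hn hl']
  exact this.exists_algEquiv

end cubicField

end

section

/-- The ternary cubic whose rational points divide the point with abscissa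
`D M² / 3 + ξ₁ a^{1/3} + ξ₂ a^{2/3}` by `1 - σ`. -/
def descentCubic {F : Type*} [Field F] (D a ξ₁ ξ₂ M C : F) : TernaryCubic F where
  a := -(D * a)
  b := -(D * a ^ 2)
  c := 2 * C + 10 * D * M ^ 3 / 27
  a2 := 0
  a3 := 0
  b1 := 0
  b3 := 0
  c1 := 3 * a * ξ₂
  c2 := 3 * a * ξ₁
  m := 2 * a * D * M

section

variable {F : Type*} [Field F] [CharZero F] {D a ξ₁ ξ₂ M C : F}

lemma descentCubic_c4 (R₁ : D ^ 2 * M ^ 4 / 3 - 3 * a * ξ₁ * ξ₂ = -(1 + 2 * D * M * C)) :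
    (descentCubic D a ξ₁ ξ₂ M C).c4 = 432 * D ^ 2 * a ^ 4 := by
  simp only [descentCubic, TernaryCubic.c4]
  linear_combination (-(432 * D ^ 2 * a ^ 4)) * R₁

lemma descentCubic_c6 (R₁ : D ^ 2 * M ^ 4 / 3 - 3 * a * ξ₁ * ξ₂ = -(1 + 2 * D * M * C))
    (R₂ : a * ξ₁ ^ 3 + a ^ 2 * ξ₂ ^ 3 =
      2 * D ^ 3 * M ^ 6 / 27 + (1 + 2 * D * M * C) * (D * M ^ 2 / 3) + D * C ^ 2) :
    (descentCubic D a ξ₁ ξ₂ M C).c6 = 0 := by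
  simp only [descentCubic, TernaryCubic.c6]
  linear_combination 7776 * a ^ 6 * D ^ 4 * M ^ 2 * R₁ + 23328 * a ^ 6 * D ^ 3 * R₂

variable {l : Fin 3 → F} {ω δ : F}

lemma collinearCubic_eq_descentCubic (hω : ω ^ 2 + ω + 1 = 0) (h₁ : l 1 = ω * l 0)
    (h₂ : l 2 = ω ^ 2 * l 0) (hl : l 0 ^ 3 = a) (hδ : δ ^ 2 = D) {x u : Fin 3 → F}
    (hx : ∀ i, x i = D * M ^ 2 / 3 + ξ₁ * l i + ξ₂ * l i ^ 2) {r s : F}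
    (hu : ∀ i, u i = δ * (r * l i + s * l i ^ 2 - M / 3)) :
    collinearCubic (δ * M) (δ * C) x u = δ * (descentCubic D a ξ₁ ξ₂ M C).eval ![r, s, 1] := by
  obtain ⟨w, hw⟩ : ∃ w, w = ω ^ 2 := ⟨_, rfl⟩
  have hs : w + ω + 1 = 0 := by rw [hw, hω]
  have hp : ω * w = 1 := by rw [hw]; linear_combination (ω - 1) * hω
  have hw2 : w ^ 2 = ω := by rw [hw]; linear_combination (ω ^ 2 - ω) * hω
  have x0 := hx 0
  have x1 := hx 1
  have x2 := hx 2
  have u0 := hu 0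
  have u1 := hu 1
  have u2 := hu 2
  rw [h₁, mul_pow, ← hw] at x1 u1
  rw [h₂, ← hw, mul_pow, hw2] at x2 u2
  have k1 : ∃ v, v = ω * (r * l 0) + w * (s * l 0 ^ 2) := ⟨_, rfl⟩
  have k2 : ∃ v, v = w * (r * l 0) + ω * (s * l 0 ^ 2) := ⟨_, rfl⟩
  obtain ⟨v₁, k1⟩ := k1
  obtain ⟨v₂, k2⟩ := k2
  have sv : v₁ + v₂ = -(r * l 0 + s * l 0 ^ 2) := by
    rw [k1, k2]; linear_combination (r * l 0 + s * l 0 ^ 2) * hs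
  have pv : v₁ * v₂ = (r * l 0) ^ 2 - (r * l 0) * (s * l 0 ^ 2) + (s * l 0 ^ 2) ^ 2 := by
    rw [k1, k2]
    linear_combination ((r * l 0) ^ 2 + (s * l 0 ^ 2) ^ 2 - 2 * (r * l 0) * (s * l 0 ^ 2)) * hp +
      (r * l 0) * (s * l 0 ^ 2) * (w + ω - 1) * hs
  have xv : v₁ * x 1 + v₂ * x 2 = -(r * l 0 + s * l 0 ^ 2) * (D * M ^ 2 / 3) -
      (r * ξ₁ * l 0 ^ 2 + s * ξ₂ * l 0 ^ 4) + 2 * (r * ξ₂ + s * ξ₁) * l 0 ^ 3 := by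
    rw [x1, x2]
    linear_combination (D * M ^ 2 / 3) * sv + (ξ₁ * l 0 * ω + ξ₂ * l 0 ^ 2 * w) * k1 +
      (ξ₁ * l 0 * w + ξ₂ * l 0 ^ 2 * ω) * k2 + (2 * (r * ξ₂ + s * ξ₁) * l 0 ^ 3
        - 2 * (r * ξ₁ * l 0 ^ 2 + s * ξ₂ * l 0 ^ 4)) * hp +
      (r * ξ₁ * l 0 ^ 2 + s * ξ₂ * l 0 ^ 4) * (w + ω - 1) * hs
  have sx : x 1 + x 2 = 2 * (D * M ^ 2 / 3) - ξ₁ * l 0 - ξ₂ * l 0 ^ 2 := by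
    rw [x1, x2]; linear_combination (ξ₁ * l 0 + ξ₂ * l 0 ^ 2) * hs
  replace u1 : u 1 = δ * (v₁ - M / 3) := by rw [u1, k1]; ring
  replace u2 : u 2 = δ * (v₂ - M / 3) := by rw [u2, k2]; ring
  have e1 : u 1 + u 2 = δ * (-(r * l 0 + s * l 0 ^ 2) - 2 * M / 3) := by
    rw [u1, u2]; linear_combination δ * sv
  have e2 : u 1 * u 2 = δ ^ 2 * (((r * l 0) ^ 2 - (r * l 0) * (s * l 0 ^ 2) + (s * l 0 ^ 2) ^ 2) +
      (r * l 0 + s * l 0 ^ 2) * (M / 3) + (M / 3) ^ 2) := by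
    rw [u1, u2]; linear_combination δ ^ 2 * pv - δ ^ 2 * (M / 3) * sv
  have e3 : u 1 * x 1 + u 2 * x 2 = δ * (-(r * l 0 + s * l 0 ^ 2) * (D * M ^ 2 / 3) -
      (r * ξ₁ * l 0 ^ 2 + s * ξ₂ * l 0 ^ 4) + 2 * (r * ξ₂ + s * ξ₁) * l 0 ^ 3 -
      M / 3 * (2 * (D * M ^ 2 / 3) - ξ₁ * l 0 - ξ₂ * l 0 ^ 2)) := by
    rw [u1, u2]; linear_combination δ * xv - δ * (M / 3) * sx
  have : collinearCubic (δ * M) (δ * C) x u = -(u 0 * (u 1 * u 2)) -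
      δ * M * (u 0 * (u 1 + u 2) + u 1 * u 2) + (u 0 * x 0 + (u 1 * x 1 + u 2 * x 2)) +
      (δ * M) ^ 3 + 2 * (δ * C) := by rw [collinearCubic]; ring
  rw [this, e1, e2, e3, u0, x0]
  simp only [descentCubic, TernaryCubic.eval]
  simp
  rw [← hl, ← hδ]
  ring

end

end

section

section

variable {F : Type*} [Field F] [CharZero F] {D a ξ₁ ξ₂ M C : F} {l : Fin 3 → F} {ω : F}

omit [CharZero F] in
lemma conj_symm (hω : ω ^ 2 + ω + 1 = 0) (h₁ : l 1 = ω * l 0)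
    (h₂ : l 2 = ω ^ 2 * l 0) (hl : l 0 ^ 3 = a) {s : F} {x : Fin 3 → F}
    (hx : ∀ i, x i = s + ξ₁ * l i + ξ₂ * l i ^ 2) :
    x 0 + x 1 + x 2 = 3 * s ∧ x 0 * x 1 + x 0 * x 2 + x 1 * x 2 = 3 * s ^ 2 - 3 * a * ξ₁ * ξ₂ ∧
      x 0 * x 1 * x 2 = s ^ 3 + a * ξ₁ ^ 3 + a ^ 2 * ξ₂ ^ 3 - 3 * s * a * ξ₁ * ξ₂ := by
  have hw2 : (ω ^ 2) ^ 2 = ω := by linear_combination (ω ^ 2 - ω) * hω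
  have x0 := hx 0
  have x1 := hx 1
  have x2 := hx 2
  rw [h₁, mul_pow, show ω ^ 2 = - 1 - ω by linear_combination hω] at x1
  rw [h₂, mul_pow, hw2, show ω ^ 2 = - 1 - ω by linear_combination hω] at x2
  obtain ⟨p, hp⟩ : ∃ p, p = ξ₁ * l 0 := ⟨_, rfl⟩
  obtain ⟨q, hq⟩ : ∃ q, q = ξ₂ * l 0 ^ 2 := ⟨_, rfl⟩
  have hpq : p * q = a * ξ₁ * ξ₂ := by rw [hp, hq, ← hl]; ring
  have hp3 : p ^ 3 = a * ξ₁ ^ 3 := by rw [hp, ← hl]; ring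
  have hq3 : q ^ 3 = a ^ 2 * ξ₂ ^ 3 := by rw [hq, ← hl]; ring
  have s12 : x 1 + x 2 = 2 * s - p - q := by rw [x1, x2, hp, hq]; ring
  have p12 : x 1 * x 2 = s ^ 2 - s * (p + q) + (p ^ 2 - p * q + q ^ 2) := by
    rw [x1, x2, hp, hq]
    linear_combination (-(ξ₁ * l 0) ^ 2 + 2 * ξ₁ * l 0 * (ξ₂ * l 0 ^ 2) - (ξ₂ * l 0 ^ 2) ^ 2) * hω
  rw [← hp, ← hq] at x0
  refine ⟨?_, ?_, ?_⟩
  · rw [x0]; linear_combination s12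
  · rw [x0]; linear_combination (s + p + q) * s12 + p12 - 3 * hpq
  · rw [x0]; linear_combination (s + p + q) * p12 - 3 * s * hpq + hp3 + hq3

end

section

variable {p : ℕ} [Fact p.Prime]

local notation "α" => algebraMap ℚ_[p] (PadicAlgCl p)

lemma PadicAlgCl.norm_algEquiv (σ : PadicAlgCl p ≃ₐ[ℚ_[p]] PadicAlgCl p) (x : PadicAlgCl p) :
    ‖σ x‖ = ‖x‖ := (spectralNorm_eq_of_equiv σ x).symm

open IntermediateField in
theorem exists_padic_zero_of_pencil {D a ξ₁ ξ₂ M C : ℚ_[p]}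
    (R₁ : D ^ 2 * M ^ 4 / 3 - 3 * a * ξ₁ * ξ₂ = -(1 + 2 * D * M * C))
    (R₂ : a * ξ₁ ^ 3 + a ^ 2 * ξ₂ ^ 3 =
      2 * D ^ 3 * M ^ 6 / 27 + (1 + 2 * D * M * C) * (D * M ^ 2 / 3) + D * C ^ 2)
    (hD : D ≠ 0) (hn : ∀ y : ℚ_[p], y ^ 3 ≠ a) {δ ω : PadicAlgCl p}
    (hδ : δ ^ 2 = α D) (hω : ω ^ 2 + ω + 1 = 0) {l x e : Fin 3 → PadicAlgCl p} (hl : l 0 ^ 3 = α a)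
    (h₁ : l 1 = ω * l 0) (h₂ : l 2 = ω ^ 2 * l 0)
    (hx : ∀ i, x i = quad (l i) (D * M ^ 2 / 3) ξ₁ ξ₂) (hρ : 1 < ‖x 0‖) {E₁ E₂ : ℚ_[p]}
    (he : ∀ i, e i = quad (l i) (1 / 3) E₁ E₂) (hE : ‖e 0‖ ^ 2 ≤ ‖x 0‖)
    (hN : ‖e 0‖ ≤ 1 ∨ ∀ (σ : PadicAlgCl p ≃ₐ[ℚ_[p]] PadicAlgCl p), ∀ y ∈ ℚ_[p]⟮l 0⟯, y ≠ 0 →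
      ‖σ y - y‖ < ‖y‖) :
    ∃ v : Fin 3 → ℚ_[p], v ≠ 0 ∧ (descentCubic D a ξ₁ ξ₂ M C).eval v = 0 := by
  have hω3 : ω ^ 3 = 1 := by linear_combination (ω - 1) * hω
  obtain ⟨σ₁, hσ₁⟩ := exists_algEquiv_cbrt (K := ℚ_[p]) hn hl (l' := l 1) (by
    rw [h₁, mul_pow, hω3, hl, one_mul])
  obtain ⟨σ₂, hσ₂⟩ := exists_algEquiv_cbrt (K := ℚ_[p]) hn hl (l' := l 2) (by
    rw [h₂, mul_pow, ← pow_mul, mul_comm 2 3, pow_mul, hω3, hl, one_pow, one_mul])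
  have hδ0 : δ ≠ 0 := by rintro rfl; exact hD (by simpa using hδ.symm)
  obtain ⟨f₁, f₂, f₃⟩ := conj_symm hω h₁ h₂ hl (x := x) (s := α (D * M ^ 2 / 3)) (ξ₁ := α ξ₁)
    (ξ₂ := α ξ₂) (fun i => by rw [hx, quad])
  have e₁ : x 0 + x 1 + x 2 = (δ * α M) ^ 2 := by
    rw [f₁, mul_pow, hδ]; simp only [map_div₀, map_mul, map_pow, map_ofNat]; ring
  have e₂ : x 0 * x 1 + x 0 * x 2 + x 1 * x 2 = -(1 + 2 * (δ * α M) * (δ * α C)) := by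
    rw [f₂]
    have := congrArg α R₁
    simp only [map_sub, map_div₀, map_mul, map_pow, map_neg, map_add, map_one, map_ofNat] at this ⊢
    linear_combination this + 2 * α M * α C * hδ
  have e₃ : x 0 * x 1 * x 2 = (δ * α C) ^ 2 := by
    rw [f₃]
    have t₁ := congrArg α R₁
    have t₂ := congrArg α R₂
    simp only [map_sub, map_div₀, map_mul, map_pow, map_neg, map_add, map_one, map_ofNat] at t₁ t₂ ⊢
    linear_combination t₂ + (α D * α M ^ 2 / 3) * t₁ - α C ^ 2 * hδ
  have c₁ : σ₁ (x 0) = x 1 := by rw [hx, hx, map_quad hσ₁]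
  have c₂ : σ₂ (x 0) = x 2 := by rw [hx, hx, map_quad hσ₂]
  have d₁ : σ₁ (e 0) = e 1 := by rw [he, he, map_quad hσ₁]
  have d₂ : σ₂ (e 0) = e 2 := by rw [he, he, map_quad hσ₂]
  have n₁ : ‖x 1‖ = ‖x 0‖ := by rw [← c₁, PadicAlgCl.norm_algEquiv]
  have n₂ : ‖x 2‖ = ‖x 0‖ := by rw [← c₂, PadicAlgCl.norm_algEquiv]
  have n₃ : ‖e 2‖ = ‖e 0‖ := by rw [← d₂, PadicAlgCl.norm_algEquiv]
  have hρ0 : 0 < ‖x 0‖ := one_pos.trans hρ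
  have x0 : x 0 ≠ 0 := norm_pos_iff.1 hρ0
  have x1 : x 1 ≠ 0 := norm_pos_iff.1 (n₁ ▸ hρ0)
  have x2 : x 2 ≠ 0 := norm_pos_iff.1 (n₂ ▸ hρ0)
  have hC : C ≠ 0 := by
    rintro rfl
    simp [x0, x1, x2] at e₃
  have hαC : α C ≠ 0 := by simpa using hC
  have hαD : α D ≠ 0 := by simpa using hD
  have hαx : x 0 ∈ ℚ_[p]⟮l 0⟯ := hx 0 ▸ quad_mem _ _ _ _
  have hαe : e 0 ∈ ℚ_[p]⟮l 0⟯ := he 0 ▸ quad_mem _ _ _ _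
  have hαm : ∀ y, α y ∈ ℚ_[p]⟮l 0⟯ := IntermediateField.algebraMap_mem _
  obtain ⟨T, hT⟩ : ∃ T : Fin 3 → PadicAlgCl p, ∀ i, T i = x i / (α M * x i + α C) :=
    ⟨_, fun _ => rfl⟩
  have hT0 : T 0 ∈ ℚ_[p]⟮l 0⟯ := by
    rw [hT]; exact div_mem hαx (add_mem (mul_mem (hαm _) hαx) (hαm _))
  have a₁ : σ₁ (T 0) = T 1 := by simp [hT, c₁]
  have a₂ : σ₂ (T 0) = T 2 := by simp [hT, c₂]
  obtain ⟨A, B, B', hA⟩ := exists_quad hl hT0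
  have hTsum : T 0 + T 1 + T 2 = 3 * α A := by
    rw [← quad_sum hω A B B', ← a₁, ← a₂, hA, map_quad hσ₁, map_quad hσ₂, h₁, h₂]
  have hesum : e 0 + e 1 + e 2 = 1 := by
    rw [he, he, he, h₁, h₂, quad_sum hω, map_div₀, map_ofNat]; simp
  have hy : (δ * α M * x 0 + δ * α C) ^ 2 = x 0 ^ 3 - x 0 := by
    linear_combination -x 0 ^ 2 * e₁ + x 0 * e₂ - e₃
  have hyn : ‖δ * α M * x 0 + δ * α C‖ ^ 2 = ‖x 0‖ ^ 3 := by
    rw [← norm_pow, hy, sub_eq_add_neg, ultra_add_eq, norm_pow]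
    rw [norm_neg, norm_pow]
    exact lt_self_pow₀ hρ (by norm_num)
  obtain ⟨t, ht⟩ : ∃ t : Fin 3 → PadicAlgCl p, ∀ i, t i = x i / (δ * α M * x i + δ * α C) :=
    ⟨_, fun _ => rfl⟩
  have htT : ∀ i, t i = T i / δ := by
    intro i; rw [ht, hT, div_div]; congr 1; ring
  have htn : ‖t 0‖ ^ 2 * ‖x 0‖ = 1 := by
    rw [ht, norm_div, div_pow, hyn]; field_simp
  have htn' : ‖T 0‖ = ‖t 0‖ * ‖δ‖ := by
    rw [htT, norm_div, div_mul_cancel₀ _ (by simpa using hδ0)]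
  have ht2 : ‖t 2‖ = ‖t 0‖ := by
    rw [htT, htT, ← a₂, norm_div, norm_div, PadicAlgCl.norm_algEquiv]
  have ht0 : 0 < ‖t 0‖ := by
    rcases (norm_nonneg (t 0)).eq_or_lt with h | h
    · rw [← h] at htn; norm_num at htn
    · exact h
  have hT0' : T 0 ≠ 0 := by
    rw [← norm_pos_iff, htn']; exact mul_pos ht0 (norm_pos_iff.2 hδ0)
  have hnorm : ‖e 0 * t 2 - e 2 * t 0‖ < 1 := by
    rcases hN with h | h
    · have ht1 : ‖t 0‖ < 1 := by
        by_contra hc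
        nlinarith [not_lt.1 hc, one_le_pow₀ (not_lt.1 hc) (n := 2)]
      rw [sub_eq_add_neg]
      apply ultra_add_lt
      · rw [norm_mul, ht2]; exact mul_lt_one_of_nonneg_of_lt_one_right h (norm_nonneg _) ht1
      · rw [norm_neg, norm_mul, n₃]; exact mul_lt_one_of_nonneg_of_lt_one_right h (norm_nonneg _) ht1
    · have he0 : e 0 ≠ 0 := by
        intro h0
        rw [h0, ← d₁, ← d₂, h0] at hesum; simp at hesum
      have k1 := h σ₂ _ hαe he0
      have k2 := h σ₂ _ hT0 hT0'
      rw [d₂] at k1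
      rw [a₂] at k2
      have hle : ‖e 0‖ * ‖t 0‖ ≤ 1 := by
        have : (‖e 0‖ * ‖t 0‖) ^ 2 ≤ 1 := by
          rw [mul_pow, ← htn, mul_comm (_ ^ 2)]; gcongr
        exact (sq_le_one_iff₀ (by positivity)).1 this
      have hen : 0 < ‖e 0‖ := norm_pos_iff.2 he0
      have : e 0 * t 2 - e 2 * t 0 = -((e 2 - e 0) * t 2) + e 2 * ((T 2 - T 0) / δ) := by
        rw [htT, htT]; ring
      refine lt_of_lt_of_le ?_ hle
      rw [this]
      apply ultra_add_lt
      · rw [norm_neg, norm_mul, ht2]; gcongr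
      · rw [norm_mul, n₃, norm_div]
        gcongr
        rw [div_lt_iff₀ (norm_pos_iff.2 hδ0), ← htn']; exact k2
  obtain ⟨g₀, g₁, g₂, g₃, hg₀, hg₁, hg₂, hg₃, hg⟩ := exists_pencil_coeff e₁ e₂ e₃ hρ n₁ n₂ hesum
    hE (n₃ ▸ hE) ht hnorm
  have key : ∀ X : ℚ_[p], ∃ r s : ℚ_[p],
      α (D * C * (descentCubic D a ξ₁ ξ₂ M C).eval ![r, s, 1]) =
        g₀ + g₁ * α X + g₂ * α X ^ 2 + g₃ * α X ^ 3 := by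
    intro X
    obtain ⟨w, hw⟩ : ∃ w : Fin 3 → PadicAlgCl p, ∀ i, w i = -(α M + α C / x i) +
      α (X / D) * (-T i + 3 * α A * e i) - e i / α (D * C) := ⟨_, fun _ => rfl⟩
    have hw0 : w 0 ∈ ℚ_[p]⟮l 0⟯ := by
      rw [hw]
      have h3 : (3 : PadicAlgCl p) * α A = α (3 * A) := by rw [map_mul, map_ofNat]
      rw [h3]
      exact sub_mem (add_mem (neg_mem (add_mem (hαm _) (div_mem (hαm _) hαx))) (mul_mem (hαm _)
        (add_mem (neg_mem hT0) (mul_mem (hαm _) hαe)))) (div_mem hαe (hαm _))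
    have b₁ : σ₁ (w 0) = w 1 := by
      rw [hw, hw]; simp only [map_add, map_sub, map_neg, map_mul, map_div₀, map_ofNat,
        AlgEquiv.commutes, a₁, c₁, d₁]
    have b₂ : σ₂ (w 0) = w 2 := by
      rw [hw, hw]; simp only [map_add, map_sub, map_neg, map_mul, map_div₀, map_ofNat,
        AlgEquiv.commutes, a₂, c₂, d₂]
    have hwsum : w 0 + w 1 + w 2 = -α M := by
      have hinv : α C * (1 / x 0 + 1 / x 1 + 1 / x 2) = -1 / (α D * α C) - 2 * α M := by
        have e₂' : x 0 * x 1 + x 0 * x 2 + x 1 * x 2 = -(1 + 2 * α D * α M * α C) := by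
          rw [e₂, ← hδ]; ring
        have e₃' : x 0 * x 1 * x 2 = α D * α C ^ 2 := by rw [e₃, ← hδ]; ring
        have : α C * (1 / x 0 + 1 / x 1 + 1 / x 2) =
            α C * (x 0 * x 1 + x 0 * x 2 + x 1 * x 2) / (x 0 * x 1 * x 2) := by
          field_simp; ring
        rw [this, e₂', e₃']
        field_simp; ring
      rw [hw, hw, hw, map_mul]
      linear_combination (-1) * hinv - α (X / D) * hTsum +
        (α (X / D) * 3 * α A - 1 / (α D * α C)) * hesum
    obtain ⟨W, r, s, hW⟩ := exists_quad hl hw0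
    have hWM : α W = -(α M / 3) := by
      have := quad_sum (l := l 0) hω W r s
      rw [← h₁, ← h₂, ← map_quad hσ₁, ← map_quad hσ₂, ← hW, b₁, b₂, hwsum] at this
      linear_combination -this / 3
    have hwi : ∀ i, w i = α r * l i + α s * l i ^ 2 - α M / 3 := by
      have : ∀ i, w i = quad (l i) W r s := by
        intro i
        fin_cases i
        · exact hW
        · change w 1 = quad (l 1) _ _ _; rw [← b₁, hW, map_quad hσ₁]
        · change w 2 = quad (l 2) _ _ _; rw [← b₂, hW, map_quad hσ₂]
      intro i; rw [this, quad, hWM]; ring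
    refine ⟨r, s, ?_⟩
    have hcol := collinearCubic_eq_descentCubic (ξ₁ := α ξ₁) (ξ₂ := α ξ₂) (C := α C) hω h₁ h₂ hl hδ
      (x := x) (u := fun i => δ * w i) (r := α r) (s := α s) (M := α M)
      (fun i => by rw [hx, quad]; simp only [map_div₀, map_mul, map_pow, map_ofNat]) (fun i => by rw [hwi])
    rw [← hg (α X) (fun i => δ * w i) ?_, hcol]
    · rw [map_mul, map_mul]
      have : α ((descentCubic D a ξ₁ ξ₂ M C).eval ![r, s, 1]) =
          (descentCubic (α D) (α a) (α ξ₁) (α ξ₂) (α M) (α C)).eval ![α r, α s, 1] := by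
        simp [descentCubic, TernaryCubic.eval, map_ofNat]
      rw [this, ← hδ]; ring
    · intro i
      have hTs : t 0 + t 1 + t 2 = 3 * α A / δ := by
        rw [htT, htT, htT, ← hTsum]; ring
      have hxi : x i ≠ 0 := by fin_cases i <;> assumption
      rw [hTs, htT, hw, map_div₀, map_mul, ← hδ]
      field_simp
  obtain ⟨k₀, k₁, k₂, k₃, rfl, rfl, rfl, rfl⟩ := cubic_coeff_mem (K := ℚ_[p])
    (fun X => (key X).elim fun r h => h.elim fun s h => ⟨_, h⟩)
  rw [PadicAlgCl.norm_extends] at hg₀ hg₁ hg₂ hg₃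
  obtain ⟨X, hX⟩ := Padic.exists_cubic_root hg₀ hg₁ hg₂.le hg₃
  obtain ⟨r, s, hrs⟩ := key X
  refine ⟨![r, s, 1], fun h => by simpa using congrFun h 2, ?_⟩
  have : α (D * C * (descentCubic D a ξ₁ ξ₂ M C).eval ![r, s, 1]) = α 0 := by
    rw [hrs, ← hX]; simp
  have := (algebraMap ℚ_[p] (PadicAlgCl p)).injective this
  simpa [hD, hC] using this

end

end

section

namespace Ecurve

open WeierstrassCurve.Affine

section

variable {F : Type*} [Field F]

lemma equation {x y : F} : (Ecurve F).Equation x y ↔ y ^ 2 = x ^ 3 - x := by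
  rw [equation_iff]; simp [Ecurve, sub_eq_add_neg]

lemma negY_eq (x y : F) : (Ecurve F).negY x y = -y := by simp [negY, Ecurve]

variable [NeZero (2 : F)]

lemma nonsingular {x y : F} (h : y ^ 2 = x ^ 3 - x) : (Ecurve F).Nonsingular x y := by
  rw [nonsingular_iff', equation]
  refine ⟨h, ?_⟩
  by_contra! hc
  have h2 : (2 : F) ≠ 0 := two_ne_zero
  obtain ⟨h3, h4⟩ := hc
  simp only [Ecurve] at h3 h4
  have hy : y = 0 := by
    have : 2 * y = 0 := by linear_combination h4
    exact (mul_eq_zero.1 this).resolve_left h2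
  subst hy
  have h5 : x * (x ^ 2 - 1) = 0 := by linear_combination -h
  have h6 : (3 * x ^ 2 - 1 : F) = 0 := by linear_combination -h3
  have h7 : (2 : F) * x = 0 := by linear_combination x * h6 - 3 * h5
  have h8 := (mul_eq_zero.1 h7).resolve_left h2
  rw [h8] at h6; simp at h6

/-- The affine point with coordinates `(x, y)`. -/
def pt {x y : F} (h : y ^ 2 = x ^ 3 - x) : (Ecurve F).Point := .some x y (nonsingular h)

lemma eq_zero_or_pt (P : (Ecurve F).Point) :
    P = 0 ∨ ∃ (x y : F) (h : y ^ 2 = x ^ 3 - x), P = pt h := by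
  rcases P with _ | ⟨x, y, h⟩
  · exact Or.inl rfl
  · exact Or.inr ⟨x, y, equation.1 h.1, rfl⟩

lemma pt_ne_zero {x y : F} (h : y ^ 2 = x ^ 3 - x) : pt h ≠ 0 := Point.some_ne_zero _

lemma pt_inj {x y x' y' : F} {h : y ^ 2 = x ^ 3 - x} {h' : y' ^ 2 = x' ^ 3 - x'} :
    pt h = pt h' ↔ x = x' ∧ y = y' := by
  simp [pt]

lemma pt_congr {x y x' y' : F} (h : y ^ 2 = x ^ 3 - x) (hx : x = x') (hy : y = y') :
    pt h = pt (x := x') (y := y') (by rw [← hx, ← hy, h]) := by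
  subst hx hy; rfl

lemma neg_pt {x y : F} (h : y ^ 2 = x ^ 3 - x) :
    -pt h = pt (x := x) (y := -y) (by rw [neg_sq, h]) := by
  rw [pt, Point.neg_some, pt]
  simp only [negY_eq]

variable [DecidableEq F]

lemma add_pt_of_ne {x₁ y₁ x₂ y₂ m : F} (h₁ : y₁ ^ 2 = x₁ ^ 3 - x₁) (h₂ : y₂ ^ 2 = x₂ ^ 3 - x₂)
    (hxy : ¬(x₁ = x₂ ∧ y₁ = -y₂)) (hm : (Ecurve F).slope x₁ x₂ y₁ y₂ = m) :
    ∃ h, pt h₁ + pt h₂ = pt (x := m ^ 2 - x₁ - x₂) (y := -(m * (m ^ 2 - x₁ - x₂ - x₁) + y₁)) h := by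
  subst hm
  have hx : ¬(x₁ = x₂ ∧ y₁ = (Ecurve F).negY x₂ y₂) := by rwa [negY_eq]
  have := Point.add_some hx (h₁ := nonsingular h₁) (h₂ := nonsingular h₂)
  have h' := (nonsingular_add (nonsingular h₁) (nonsingular h₂) hx).1
  have hX : (Ecurve F).addX x₁ x₂ ((Ecurve F).slope x₁ x₂ y₁ y₂) =
    (Ecurve F).slope x₁ x₂ y₁ y₂ ^ 2 - x₁ - x₂ := by simp [addX, Ecurve]
  have hY : (Ecurve F).addY x₁ x₂ y₁ ((Ecurve F).slope x₁ x₂ y₁ y₂) =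
    -((Ecurve F).slope x₁ x₂ y₁ y₂ * ((Ecurve F).slope x₁ x₂ y₁ y₂ ^ 2 - x₁ - x₂ - x₁) + y₁) := by
    rw [addY, negY_eq, negAddY, hX]
  rw [equation] at h'
  simp only [hX, hY] at h'
  refine ⟨h', ?_⟩
  rw [pt, pt, this, pt]
  simp only [hX, hY]

lemma pt_add_neg {x₁ y₁ x₂ y₂ : F} (h₁ : y₁ ^ 2 = x₁ ^ 3 - x₁) (h₂ : y₂ ^ 2 = x₂ ^ 3 - x₂)
    (hx : x₁ = x₂) (hy : y₁ = -y₂) : pt h₁ + pt h₂ = 0 := by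
  subst hx hy
  have := neg_pt h₂
  rw [← this, neg_add_cancel]

lemma slope_of_ne {x₁ x₂ y₁ y₂ m : F} (hx : x₁ ≠ x₂) (h : m * (x₁ - x₂) = y₁ - y₂) :
    (Ecurve F).slope x₁ x₂ y₁ y₂ = m := by
  rw [slope_of_X_ne hx, ← h, mul_div_cancel_right₀ _ (sub_ne_zero.2 hx)]

lemma slope_self {x y m : F} (hy : y ≠ 0) (h : m * (2 * y) = 3 * x ^ 2 - 1) :
    (Ecurve F).slope x x y y = m := by
  have h2 : 2 * y ≠ 0 := mul_ne_zero two_ne_zero hy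
  rw [slope_of_Y_ne rfl, negY_eq]
  · simp only [Ecurve]
    rw [div_eq_iff (by convert h2 using 1; ring)]
    linear_combination -h
  · rw [negY_eq]; intro h; exact h2 (by linear_combination h)

lemma pt_add_of_ne {x₁ y₁ x₂ y₂ m : F} (h₁ : y₁ ^ 2 = x₁ ^ 3 - x₁) (h₂ : y₂ ^ 2 = x₂ ^ 3 - x₂)
    (hx : x₁ ≠ x₂) (hm : m * (x₁ - x₂) = y₁ - y₂) :
    ∃ h, pt h₁ + pt h₂ = pt (x := m ^ 2 - x₁ - x₂) (y := -(m * (m ^ 2 - x₁ - x₂ - x₁) + y₁)) h :=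
  add_pt_of_ne h₁ h₂ (fun h => hx h.1) (slope_of_ne hx hm)

lemma pt_add_self {x y m : F} (h : y ^ 2 = x ^ 3 - x) (hy : y ≠ 0)
    (hm : m * (2 * y) = 3 * x ^ 2 - 1) :
    ∃ h', pt h + pt h = pt (x := m ^ 2 - x - x) (y := -(m * (m ^ 2 - x - x - x) + y)) h' :=
  add_pt_of_ne h h (fun h' => hy (by
    have : 2 * y = 0 := by linear_combination h'.2
    exact (mul_eq_zero.1 this).resolve_left two_ne_zero)) (slope_self hy hm)

/-- If a nonvertical line meets the curve in the points `P₁`, `P₂`, `P₃` then their sum is zero. -/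
lemma sum_eq_zero_of_line {x₁ y₁ x₂ y₂ x₃ y₃ m c : F} (h₁ : y₁ ^ 2 = x₁ ^ 3 - x₁)
    (h₂ : y₂ ^ 2 = x₂ ^ 3 - x₂) (h₃ : y₃ ^ 2 = x₃ ^ 3 - x₃) (k₁ : y₁ = m * x₁ + c)
    (k₂ : y₂ = m * x₂ + c) (k₃ : y₃ = m * x₃ + c) (e₁ : x₁ + x₂ + x₃ = m ^ 2)
    (e₂ : x₁ * x₂ + x₁ * x₃ + x₂ * x₃ = -(1 + 2 * m * c)) :
    pt h₁ + pt h₂ + pt h₃ = 0 := by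
  have hslope : ¬(x₁ = x₂ ∧ y₁ = -y₂) ∧ (Ecurve F).slope x₁ x₂ y₁ y₂ = m := by
    by_cases hx : x₁ = x₂
    · subst hx
      have hy : y₁ = y₂ := by rw [k₁, k₂]
      subst hy
      have hm : m * (2 * y₁) = 3 * x₁ ^ 2 - 1 := by
        rw [k₁]; linear_combination e₂ - 2 * x₁ * e₁
      have hy : y₁ ≠ 0 := by
        rintro rfl
        have h6 : (3 * x₁ ^ 2 - 1 : F) = 0 := by linear_combination -hm
        have h7 : (2 : F) * x₁ = 0 := by linear_combination x₁ * h6 + 3 * h₁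
        have h8 := (mul_eq_zero.1 h7).resolve_left two_ne_zero
        rw [h8] at h6; simp at h6
      refine ⟨fun h' => hy ?_, slope_self hy hm⟩
      have : 2 * y₁ = 0 := by linear_combination h'.2
      exact (mul_eq_zero.1 this).resolve_left two_ne_zero
    · exact ⟨fun h => hx h.1, slope_of_ne hx (by rw [k₁, k₂]; ring)⟩
  obtain ⟨h, hadd⟩ := add_pt_of_ne h₁ h₂ hslope.1 hslope.2
  rw [hadd]
  exact pt_add_neg _ _ (by linear_combination -e₁)
    (by rw [k₁, k₃]; linear_combination m * e₁)

lemma exists_line {x₁ y₁ x₂ y₂ x₃ y₃ : F} {h₁ : y₁ ^ 2 = x₁ ^ 3 - x₁}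
    {h₂ : y₂ ^ 2 = x₂ ^ 3 - x₂} {h₃ : y₃ ^ 2 = x₃ ^ 3 - x₃} (h : pt h₁ + pt h₂ + pt h₃ = 0) :
    ∃ m c, y₁ = m * x₁ + c ∧ y₂ = m * x₂ + c ∧ y₃ = m * x₃ + c ∧ x₁ + x₂ + x₃ = m ^ 2 ∧
      x₁ * x₂ + x₁ * x₃ + x₂ * x₃ = -(1 + 2 * m * c) ∧ x₁ * x₂ * x₃ = c ^ 2 := by
  have hxy : ¬(x₁ = x₂ ∧ y₁ = -y₂) := by
    rintro ⟨hx, hy⟩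
    rw [pt_add_neg h₁ h₂ hx hy, zero_add] at h
    exact pt_ne_zero _ h
  obtain ⟨m, hm⟩ : ∃ m, (Ecurve F).slope x₁ x₂ y₁ y₂ = m := ⟨_, rfl⟩
  obtain ⟨h', hadd⟩ := add_pt_of_ne h₁ h₂ hxy hm
  rw [hadd, ← eq_neg_iff_add_eq_zero, neg_pt, pt_inj] at h
  obtain ⟨hx3, hy3⟩ := h
  have e₁ : x₁ + x₂ + x₃ = m ^ 2 := by linear_combination -hx3
  have k₃ : y₃ = m * x₃ + (y₁ - m * x₁) := by linear_combination hy3 + m * hx3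
  refine ⟨m, y₁ - m * x₁, by ring, ?_⟩
  by_cases hx : x₁ = x₂
  · subst hx
    have h4 : (y₁ - y₂) * (y₁ + y₂) = 0 := by linear_combination h₁ - h₂
    have h5 : y₁ + y₂ ≠ 0 := fun h0 => hxy ⟨rfl, by linear_combination h0⟩
    have h6 : y₁ = y₂ := sub_eq_zero.1 ((mul_eq_zero.1 h4).resolve_right h5)
    subst h6
    have hy : y₁ ≠ 0 := by rintro rfl; simp at h5
    have hm' : m * (2 * y₁) = 3 * x₁ ^ 2 - 1 := by
      rw [← hm, slope_of_Y_ne rfl, negY_eq]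
      · simp only [Ecurve]
        have : y₁ - -y₁ = 2 * y₁ := by ring
        rw [this, div_mul_cancel₀ _ (mul_ne_zero two_ne_zero hy)]; ring
      · rw [negY_eq]; intro h; exact h5 (by linear_combination h)
    refine ⟨by ring, k₃, e₁, ?_, ?_⟩
    · linear_combination 2 * x₁ * e₁ + hm'
    · linear_combination x₁ ^ 2 * e₁ - h₁ + x₁ * hm'
  · have hm' : m * (x₁ - x₂) = y₁ - y₂ := by
      rw [← hm, slope_of_X_ne hx, div_mul_cancel₀ _ (sub_ne_zero.2 hx)]
    have e₂ : x₁ * x₂ + x₁ * x₃ + x₂ * x₃ = -(1 + 2 * m * (y₁ - m * x₁)) := by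
      apply mul_right_cancel₀ (sub_ne_zero.2 hx)
      linear_combination (x₁ ^ 2 - x₂ ^ 2) * e₁ + h₁ - h₂ -
        (m * x₁ - m * x₂ - y₁ - y₂) * hm'
    refine ⟨by linear_combination hm', k₃, e₁, e₂, ?_⟩
    linear_combination x₁ * e₂ - x₁ ^ 2 * e₁ - h₁

end

section map

variable {F K : Type*} [Field F] [Field K] [NeZero (2 : F)] [NeZero (2 : K)] [DecidableEq F]
  [DecidableEq K]

omit [NeZero (2 : F)] [NeZero (2 : K)] [DecidableEq F] [DecidableEq K] in
lemma map_eqn (f : F →+* K) {x y : F} (h : y ^ 2 = x ^ 3 - x) : f y ^ 2 = f x ^ 3 - f x := by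
  rw [← map_pow, h, map_sub, map_pow]

/-- The map on points induced by a ring homomorphism. -/
def mapFun (f : F →+* K) : (Ecurve F).Point → (Ecurve K).Point
  | .zero => 0
  | .some _ _ h => pt (map_eqn f (equation.1 h.1))

/-- The group homomorphism on points induced by a ring homomorphism. -/
def map (f : F →+* K) : (Ecurve F).Point →+ (Ecurve K).Point :=
  AddMonoidHom.mk' (mapFun f) (by
    have h0 : mapFun f 0 = 0 := rfl
    have hpt : ∀ {x y : F} (h : y ^ 2 = x ^ 3 - x), mapFun f (pt h) = pt (map_eqn f h) :=
      fun h => rfl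
    have hneg : ∀ P, mapFun f (-P) = - mapFun f P := by
      intro P
      rcases eq_zero_or_pt P with rfl | ⟨x, y, h, rfl⟩
      · simp [h0]
      · rw [neg_pt, hpt, hpt, neg_pt]; exact pt_congr _ rfl (map_neg f y)
    intro P Q
    rcases eq_zero_or_pt P with rfl | ⟨x, y, h, rfl⟩
    · simp [h0]
    rcases eq_zero_or_pt Q with rfl | ⟨x', y', h', rfl⟩
    · simp [h0]
    rcases eq_zero_or_pt (-(pt h + pt h')) with h1 | ⟨x₃, y₃, h₃, h1⟩
    · have h2 : pt h' = - pt h := by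
        rw [eq_neg_iff_add_eq_zero, add_comm, ← neg_eq_zero, h1]
      rw [neg_eq_zero.1 h1, h2, hneg, add_neg_cancel, h0]
    · have hs : pt h + pt h' + pt h₃ = 0 := by rw [← h1, add_neg_cancel]
      obtain ⟨m, c, k₁, k₂, k₃, e₁, e₂, -⟩ := exists_line hs
      have := sum_eq_zero_of_line (map_eqn f h) (map_eqn f h') (map_eqn f h₃) (m := f m) (c := f c)
        (by rw [k₁]; simp) (by rw [k₂]; simp) (by rw [k₃]; simp)
        (by rw [← map_add, ← map_add, e₁, map_pow])
        (by simp only [← map_mul, ← map_add, e₂]; simp [map_ofNat])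
      rw [neg_eq_iff_eq_neg.1 h1, hneg, hpt, hpt, hpt, eq_comm, eq_neg_iff_add_eq_zero, this])

lemma map_pt (f : F →+* K) {x y : F} (h : y ^ 2 = x ^ 3 - x) : map f (pt h) = pt (map_eqn f h) :=
  rfl

end map

end Ecurve

end

section

namespace Ecurve

section

variable {F : Type*} [Field F]

lemma exists_cube_root_of_unity [Finite F] (h : 3 ∣ Nat.card F - 1) :
    ∃ ω : F, ω ^ 2 + ω + 1 = 0 := by
  have : Fact (Nat.Prime 3) := ⟨Nat.prime_three⟩
  obtain ⟨u, hu⟩ := exists_prime_orderOf_dvd_card' (G := Fˣ) 3 (by rwa [Nat.card_units])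
  refine ⟨u, ?_⟩
  have h3 : (u : F) ^ 3 = 1 := by
    rw [← Units.val_pow_eq_pow_val, ← hu, pow_orderOf_eq_one]; simp
  have h1 : (u : F) - 1 ≠ 0 := by
    intro h0
    have : u = 1 := Units.ext (sub_eq_zero.1 h0)
    rw [this, orderOf_one] at hu
    norm_num at hu
  apply mul_left_cancel₀ h1
  linear_combination h3

lemma three_dvd_card [Finite F] [NeZero (2 : F)] {ω D s M C : F} (hω : ω ^ 2 + ω + 1 = 0)
    (hD : D = 1 ∨ D = -3)
    (h₁ : 3 * s = D * M ^ 2) (h₂ : 3 * s ^ 2 = -(1 + 2 * D * M * C)) (h₃ : s ^ 3 = D * C ^ 2) :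
    3 ∣ Nat.card (Ecurve F).Point := by
  classical
  obtain ⟨δ, hδ⟩ : ∃ δ : F, δ ^ 2 = D := by
    rcases hD with rfl | rfl
    · exact ⟨1, one_pow 2⟩
    · exact ⟨2 * ω + 1, by linear_combination 4 * hω⟩
  have hQ : (δ * M * s + δ * C) ^ 2 = s ^ 3 - s := by
    linear_combination (M * s + C) ^ 2 * hδ - s ^ 2 * h₁ + s * h₂ - h₃
  have h3 : pt hQ + pt hQ + pt hQ = 0 := by
    refine sum_eq_zero_of_line (m := δ * M) (c := δ * C) hQ hQ hQ rfl rfl rfl ?_ ?_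
    · linear_combination h₁ - M ^ 2 * hδ
    · linear_combination h₂ + 2 * M * C * hδ
  have h3' : addOrderOf (pt hQ) = 3 := by
    refine addOrderOf_eq_prime (hp := ⟨Nat.prime_three⟩) ?_ (pt_ne_zero _)
    rw [← h3]; abel
  rw [← h3']
  exact addOrderOf_dvd_natCard _

end

lemma not_conditionP {p : ℕ} (hp : p.Prime) (h2 : p ≠ 2) (h3 : p ≠ 3) {D s M C : ZMod p}
    (hD : D = 1 ∨ D = -3)
    (h₁ : 3 * s = D * M ^ 2) (h₂ : 3 * s ^ 2 = -(1 + 2 * D * M * C)) (h₃ : s ^ 3 = D * C ^ 2) :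
    ¬ConditionP p hp := by
  have : Fact p.Prime := ⟨hp⟩
  rw [ConditionP, not_not]
  obtain ⟨f, hf⟩ : ∃ f, f = if p % 3 = 1 then 1 else 2 := ⟨_, rfl⟩
  rw [← hf]
  have hmod : p ^ f % 3 = 1 := by
    have : p % 3 ≠ 0 := fun h =>
      h3 ((Nat.prime_dvd_prime_iff_eq Nat.prime_three hp).1 (Nat.dvd_of_mod_eq_zero h)).symm
    have h4 : p % 3 < 3 := Nat.mod_lt _ (by norm_num)
    rw [hf, Nat.pow_mod]
    split_ifs with h
    · simp [h]
    · have : p % 3 = 2 := by omega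
      simp [this]
  have hf0 : f ≠ 0 := by rw [hf]; split_ifs <;> norm_num
  have : NeZero (2 : GaloisField p f) := ⟨by
    have h := CharP.cast_eq_zero_iff (GaloisField p f) p 2
    intro h0
    rw [Nat.cast_ofNat, h0, eq_self_iff_true, true_iff, Nat.prime_dvd_prime_iff_eq hp
      Nat.prime_two] at h
    exact h2 h⟩
  obtain ⟨ω, hω⟩ := exists_cube_root_of_unity (F := GaloisField p f) (by
    rw [GaloisField.card p f hf0]
    omega)
  have q₁ := congrArg (algebraMap (ZMod p) (GaloisField p f)) h₁
  have q₂ := congrArg (algebraMap (ZMod p) (GaloisField p f)) h₂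
  have q₃ := congrArg (algebraMap (ZMod p) (GaloisField p f)) h₃
  simp only [map_mul, map_pow, map_neg, map_add, map_one, map_ofNat] at q₁ q₂ q₃
  refine three_dvd_card hω ?_ q₁ q₂ q₃
  rcases hD with rfl | rfl
  · exact Or.inl (map_one _)
  · exact Or.inr (by rw [map_neg, map_ofNat])

end Ecurve

end

section

open TernaryCubic

section

variable {p : ℕ} [Fact p.Prime]

local notation "α" => algebraMap ℚ_[p] (PadicAlgCl p)

lemma Padic.valuation_eq_zero_of_norm {x : ℚ_[p]} (h : ‖x‖ = 1) : x.valuation = 0 := by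
  have hx : x ≠ 0 := by rintro rfl; simp at h
  rw [Padic.norm_eq_zpow_neg_valuation hx] at h
  have h1 : (1 : ℝ) < p := by exact_mod_cast (Fact.out : p.Prime).one_lt
  rw [zpow_eq_one_iff_right₀ (by positivity) h1.ne'] at h
  omega

/-- `κ` is the scaling factor of the descent cubic compared with a Weierstrass model. -/
def IsScale {F : Type*} [Field F] (D a κ : F) : Prop :=
  (D = 1 ∧ κ = a) ∨ (D = -3 ∧ κ = 3 * a)

lemma descentCubic_eval_cbrt {F : Type*} [Field F] {D a ξ₁ ξ₂ M C y : F} (hy : y ^ 3 = a) :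
    (descentCubic D a ξ₁ ξ₂ M C).eval ![-y, 1, 0] = 0 := by
  simp [TernaryCubic.eval, descentCubic, ← hy]; ring

lemma localModel_descentCubic_of_zero {D a ξ₁ ξ₂ M C κ : ℚ_[p]}
    (R₁ : D ^ 2 * M ^ 4 / 3 - 3 * a * ξ₁ * ξ₂ = -(1 + 2 * D * M * C))
    (R₂ : a * ξ₁ ^ 3 + a ^ 2 * ξ₂ ^ 3 =
      2 * D ^ 3 * M ^ 6 / 27 + (1 + 2 * D * M * C) * (D * M ^ 2 / 3) + D * C ^ 2)
    (hκ : IsScale D a κ) (ha : a ≠ 0) {v : Fin 3 → ℚ_[p]} (hv : v ≠ 0)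
    (h : (descentCubic D a ξ₁ ξ₂ M C).eval v = 0) :
    LocalModel (descentCubic D a ξ₁ ξ₂ M C) κ := by
  have h4 := descentCubic_c4 (D := D) (a := a) (ξ₁ := ξ₁) (ξ₂ := ξ₂) (M := M) (C := C) R₁
  have h6 := descentCubic_c6 (D := D) (a := a) (ξ₁ := ξ₁) (ξ₂ := ξ₂) (M := M) (C := C) R₁ R₂
  rcases hκ with ⟨rfl, rfl⟩ | ⟨rfl, rfl⟩
  · refine localModel_of_zero (d := 9) ?_ (by norm_num) ha (by rw [h4]; ring) h6 hv h
    exact_mod_cast Padic.norm_int_le_one 9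
  · exact localModel_of_zero (d := 1) (by simp) one_ne_zero (mul_ne_zero three_ne_zero ha)
      (by rw [h4]; ring) h6 hv h

/-- The mod `p` obstruction. -/
lemma not_conditionP_of_norm_lt (hp : p.Prime) (h2 : p ≠ 2) (h3 : p ≠ 3) {D s M C : ℚ_[p]}
    (hD : D = 1 ∨ D = -3) (hs : ‖s‖ ≤ 1) (hM : ‖M‖ ≤ 1) (hC : ‖C‖ ≤ 1)
    (h₁ : 3 * s = D * M ^ 2) (h₂ : ‖3 * s ^ 2 + (1 + 2 * D * M * C)‖ < 1)
    (h₃ : ‖s ^ 3 - D * C ^ 2‖ < 1) : ¬ConditionP p hp := by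
  obtain ⟨s, rfl⟩ : ∃ z : ℤ_[p], (z : ℚ_[p]) = s := ⟨⟨_, hs⟩, rfl⟩
  obtain ⟨M, rfl⟩ : ∃ z : ℤ_[p], (z : ℚ_[p]) = M := ⟨⟨_, hM⟩, rfl⟩
  obtain ⟨C, rfl⟩ : ∃ z : ℤ_[p], (z : ℚ_[p]) = C := ⟨⟨_, hC⟩, rfl⟩
  obtain ⟨D, rfl, hD₂⟩ : ∃ z : ℤ_[p], (z : ℚ_[p]) = D ∧ (z = 1 ∨ z = -3) := by
    rcases hD with rfl | rfl
    · exact ⟨1, rfl, Or.inl rfl⟩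
    · exact ⟨-3, by push_cast; rfl, Or.inr rfl⟩
  have hk : ∀ z : ℤ_[p], ‖z‖ < 1 → PadicInt.toZMod z = 0 := fun z hz => by
    rw [← RingHom.mem_ker, PadicInt.ker_toZMod, IsLocalRing.mem_maximalIdeal,
      PadicInt.mem_nonunits]
    exact hz
  have q₁ : 3 * s = D * M ^ 2 := PadicInt.ext (by push_cast; exact h₁)
  have q₂ := hk (3 * s ^ 2 + (1 + 2 * D * M * C)) (by rw [PadicInt.norm_def]; push_cast; exact h₂)
  have q₃ := hk (s ^ 3 - D * C ^ 2) (by rw [PadicInt.norm_def]; push_cast; exact h₃)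
  have q₁ := congrArg PadicInt.toZMod q₁
  simp only [map_mul, map_pow, map_add, map_sub, map_one, map_ofNat] at q₁ q₂ q₃
  refine Ecurve.not_conditionP hp h2 h3 ?_ q₁ (eq_neg_of_add_eq_zero_left q₂) (sub_eq_zero.1 q₃)
  rcases hD₂ with rfl | rfl
  · exact Or.inl (map_one _)
  · exact Or.inr (by rw [map_neg, map_ofNat])

set_option maxHeartbeats 1000000 in
theorem localModel_descentCubic {D a ξ₁ ξ₂ M C κ : ℚ_[p]}
    (R₁ : D ^ 2 * M ^ 4 / 3 - 3 * a * ξ₁ * ξ₂ = -(1 + 2 * D * M * C))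
    (R₂ : a * ξ₁ ^ 3 + a ^ 2 * ξ₂ ^ 3 =
      2 * D ^ 3 * M ^ 6 / 27 + (1 + 2 * D * M * C) * (D * M ^ 2 / 3) + D * C ^ 2)
    (hκ : IsScale D a κ) (hp : p.Prime) (h3 : p ≠ 3)
    (ha : ‖a‖ = 1 ∨ a ≠ 0 ∧ ¬ 3 ∣ a.valuation ∧ p ≠ 2 ∧ ConditionP p hp) :
    LocalModel (descentCubic D a ξ₁ ξ₂ M C) κ := by
  have ha0 : a ≠ 0 := by
    rcases ha with ha | ha
    · rintro rfl; simp at ha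
    · exact ha.1
  by_cases hn : ∃ y, y ^ 3 = a
  · obtain ⟨y, hy⟩ := hn
    exact localModel_descentCubic_of_zero R₁ R₂ hκ ha0 (v := ![-y, 1, 0])
      (fun h => by simpa using congrFun h 1) (descentCubic_eval_cbrt hy)
  push Not at hn
  have n3 : ‖(3 : ℚ_[p])‖ = 1 := by
    have := Padic.norm_natCast_eq_one_iff (p := p) (n := 3)
    rw [Nat.cast_ofNat] at this
    rw [this, Nat.coprime_primes hp Nat.prime_three]
    exact h3
  have hD' : D = 1 ∨ D = -3 := by rcases hκ with h | h; exacts [Or.inl h.1, Or.inr h.1]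
  have nD : ‖D‖ = 1 := by
    rcases hD' with rfl | rfl <;> simp [n3]
  have hD0 : D ≠ 0 := by rintro rfl; simp at nD
  have n3' : ‖(3 : PadicAlgCl p)‖ = 1 := by
    rw [← map_ofNat α, PadicAlgCl.norm_extends, n3]
  obtain ⟨δ, hδ⟩ := IsAlgClosed.exists_pow_nat_eq (α D) (n := 2) (by norm_num)
  obtain ⟨θ, hθ⟩ := IsAlgClosed.exists_pow_nat_eq (-3 : PadicAlgCl p) (n := 2) (by norm_num)
  obtain ⟨ω, hω⟩ : ∃ ω : PadicAlgCl p, ω ^ 2 + ω + 1 = 0 :=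
    ⟨(θ - 1) / 2, by linear_combination hθ / 4⟩
  have hω3 : ω ^ 3 = 1 := by linear_combination (ω - 1) * hω
  have nω : ‖ω‖ = 1 := by
    have := congrArg norm hω3
    rw [norm_pow, norm_one] at this
    exact (pow_eq_one_iff_of_nonneg (norm_nonneg _) (by norm_num)).1 this
  obtain ⟨lam, hlam⟩ := IsAlgClosed.exists_pow_nat_eq (α a) (n := 3) (by norm_num)
  obtain ⟨l, hl⟩ : ∃ l : Fin 3 → PadicAlgCl p, l = ![lam, ω * lam, ω ^ 2 * lam] := ⟨_, rfl⟩
  have l0 : l 0 ^ 3 = α a := by rw [hl]; exact hlam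
  have l1 : l 1 = ω * l 0 := by rw [hl]; rfl
  have l2 : l 2 = ω ^ 2 * l 0 := by rw [hl]; rfl
  obtain ⟨x, hx⟩ : ∃ x : Fin 3 → PadicAlgCl p, ∀ i, x i = quad (l i) (D * M ^ 2 / 3) ξ₁ ξ₂ :=
    ⟨_, fun _ => rfl⟩
  rcases lt_or_ge 1 ‖x 0‖ with hρ | hρ
  · have ne : ‖α (1 / 3)‖ = 1 := by rw [PadicAlgCl.norm_extends, norm_div, norm_one, n3, div_one]
    obtain ⟨v, hv, h⟩ := exists_padic_zero_of_pencil R₁ R₂ hD0 hn hδ hω l0 l1 l2 hx hρ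
      (e := fun _ => α (1 / 3)) (E₁ := 0) (E₂ := 0)
      (fun i => by rw [quad, map_zero, zero_mul, zero_mul, add_zero, add_zero])
      (by rw [ne, one_pow]; exact hρ.le) (Or.inl ne.le)
    exact localModel_descentCubic_of_zero R₁ R₂ hκ ha0 hv h
  · have : ∀ i, ‖x i‖ ≤ 1 := by
      intro i
      obtain ⟨σ, hσ⟩ := exists_algEquiv_cbrt (K := ℚ_[p]) hn l0 (l' := l i) (by
        fin_cases i
        · exact l0
        · change l 1 ^ 3 = _; rw [l1, mul_pow, hω3, l0, one_mul]
        · change l 2 ^ 3 = _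
          rw [l2, mul_pow, ← pow_mul, mul_comm 2 3, pow_mul, hω3, l0, one_pow, one_mul])
      rw [hx, ← map_quad hσ, PadicAlgCl.norm_algEquiv, ← hx]
      exact hρ
    have hx0 := this 0
    have hx1 := this 1
    have hx2 := this 2
    obtain ⟨f₁, f₂, f₃⟩ := conj_symm hω l1 l2 l0 (x := x) (s := α (D * M ^ 2 / 3)) (ξ₁ := α ξ₁)
      (ξ₂ := α ξ₂) (fun i => by rw [hx, quad])
    obtain ⟨s, hs⟩ : ∃ s, s = D * M ^ 2 / 3 := ⟨_, rfl⟩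
    rw [← hs] at f₁ f₂ f₃ hx
    have add3 : ∀ {u v w : PadicAlgCl p}, ‖u‖ ≤ 1 → ‖v‖ ≤ 1 → ‖w‖ ≤ 1 → ‖u + v + w‖ ≤ 1 :=
      fun h1 h2 h3 => ultra_add_le (ultra_add_le h1 h2) h3
    have ns : ‖s‖ ≤ 1 := by
      have := add3 hx0 hx1 hx2
      rwa [f₁, norm_mul, n3', one_mul, PadicAlgCl.norm_extends] at this
    have hs3 : 3 * s = D * M ^ 2 := by rw [hs]; ring
    have nM : ‖M‖ ≤ 1 := by
      have := congrArg norm hs3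
      rw [norm_mul, norm_mul, n3, nD, one_mul, one_mul, norm_pow] at this
      rw [this] at ns
      exact (pow_le_one_iff_of_nonneg (norm_nonneg _) (by norm_num)).1 ns
    have hC2 : s ^ 3 + a * ξ₁ ^ 3 + a ^ 2 * ξ₂ ^ 3 - 3 * s * a * ξ₁ * ξ₂ = D * C ^ 2 := by
      rw [hs]; linear_combination R₂ + D * M ^ 2 / 3 * R₁
    have nC : ‖C‖ ≤ 1 := by
      have : α (D * C ^ 2) = x 0 * x 1 * x 2 := by
        rw [f₃, ← hC2]
        simp only [map_mul, map_add, map_sub, map_pow, map_ofNat]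
      have := congrArg norm this
      rw [PadicAlgCl.norm_extends, norm_mul, nD, one_mul, norm_pow, norm_mul, norm_mul] at this
      have h' : ‖C‖ ^ 2 ≤ 1 := by
        rw [this]
        exact mul_le_one₀ (mul_le_one₀ hx0 (norm_nonneg _) hx1) (norm_nonneg _) hx2
      exact (pow_le_one_iff_of_nonneg (norm_nonneg _) (by norm_num)).1 h'
    have nξ₁ : ‖a * ξ₁ ^ 3‖ ≤ 1 := by
      have h1 : 3 * (α ξ₁ * l 0) = x 0 + ω ^ 2 * x 1 + ω * x 2 := by
        rw [hx, hx, hx, l1, l2, quad, quad, quad]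
        linear_combination (-(α s) - α ξ₁ * l 0 * (ω - 1) * 2 -
          α ξ₂ * l 0 ^ 2 * (ω ^ 3 - ω + 1)) * hω
      have h2 : ‖x 0 + ω ^ 2 * x 1 + ω * x 2‖ ≤ 1 :=
        add3 hx0 (by rwa [norm_mul, norm_pow, nω, one_pow, one_mul])
          (by rwa [norm_mul, nω, one_mul])
      rw [← h1, norm_mul, n3', one_mul] at h2
      have h3 : α (a * ξ₁ ^ 3) = (α ξ₁ * l 0) ^ 3 := by
        rw [mul_pow, l0, map_mul, map_pow, mul_comm]
      rw [← PadicAlgCl.norm_extends, h3, norm_pow]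
      exact pow_le_one₀ (norm_nonneg _) h2
    have nξ₂ : ‖a ^ 2 * ξ₂ ^ 3‖ ≤ 1 := by
      have h1 : 3 * (α ξ₂ * l 0 ^ 2) = x 0 + ω * x 1 + ω ^ 2 * x 2 := by
        rw [hx, hx, hx, l1, l2, quad, quad, quad]
        linear_combination (-(α s) - α ξ₁ * l 0 * (ω ^ 2 - ω + 1) -
          α ξ₂ * l 0 ^ 2 * (ω - 1) * (ω ^ 3 + 2)) * hω
      have h2 : ‖x 0 + ω * x 1 + ω ^ 2 * x 2‖ ≤ 1 :=
        add3 hx0 (by rwa [norm_mul, nω, one_mul])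
          (by rwa [norm_mul, norm_pow, nω, one_pow, one_mul])
      rw [← h1, norm_mul, n3', one_mul] at h2
      have h3 : α (a ^ 2 * ξ₂ ^ 3) = (α ξ₂ * l 0 ^ 2) ^ 3 := by
        rw [mul_pow, ← pow_mul, mul_comm 2 3, pow_mul, l0, map_mul, map_pow, map_pow, mul_comm]
      rw [← PadicAlgCl.norm_extends, h3, norm_pow]
      exact pow_le_one₀ (norm_nonneg _) h2
    rcases ha with ha | ⟨-, hv, hp2, hP⟩
    · have n1 : ‖ξ₁‖ ≤ 1 := by
        rw [norm_mul, ha, one_mul, norm_pow] at nξ₁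
        exact (pow_le_one_iff_of_nonneg (norm_nonneg _) (by norm_num)).1 nξ₁
      have n2 : ‖ξ₂‖ ≤ 1 := by
        rw [norm_mul, norm_pow, ha, one_pow, one_mul, norm_pow] at nξ₂
        exact (pow_le_one_iff_of_nonneg (norm_nonneg _) (by norm_num)).1 nξ₂
      have nκ : ‖κ‖ = 1 := by
        rcases hκ with ⟨-, rfl⟩ | ⟨-, rfl⟩ <;> simp [ha, n3]
      refine ⟨1, 1, by simp [nκ], fun v hv => ?_⟩
      rw [norm_one]
      rw [Matrix.one_mulVec] at hv
      have two : ‖(2 : ℚ_[p])‖ ≤ 1 := by exact_mod_cast Padic.norm_int_le_one 2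
      have ten : ‖(10 : ℚ_[p])‖ ≤ 1 := by exact_mod_cast Padic.norm_int_le_one 10
      have n27 : ‖(27 : ℚ_[p])‖ = 1 := by rw [show (27 : ℚ_[p]) = 3 ^ 3 by norm_num]; simp [n3]
      refine norm_eval_le_one ?_ ?_ ?_ ?_ ?_ ?_ ?_ ?_ ?_ ?_ hv <;> simp only [descentCubic, norm_zero,
        norm_neg, norm_mul, norm_pow, nD, ha, n3, one_pow, one_mul, mul_one, le_refl, zero_le_one]
      · refine ultra_add_le ?_ ?_
        · rw [norm_mul]; exact mul_le_one₀ two (norm_nonneg _) nC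
        · rw [norm_div, n27, div_one, norm_mul, norm_mul, nD, mul_one, norm_pow]
          exact mul_le_one₀ ten (by positivity) (pow_le_one₀ (norm_nonneg _) nM)
      · exact n2
      · exact n1
      · exact mul_le_one₀ two (norm_nonneg _) nM
    · exfalso
      have k₁ : ‖a * ξ₁ ^ 3‖ < 1 := by
        refine lt_of_le_of_ne nξ₁ fun h => hv ?_
        have h0 : ξ₁ ≠ 0 := by rintro rfl; simp at h
        have := Padic.valuation_eq_zero_of_norm h
        rw [Padic.valuation_mul ha0 (pow_ne_zero _ h0), Padic.valuation_pow] at this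
        push_cast at this
        omega
      have k₂ : ‖a ^ 2 * ξ₂ ^ 3‖ < 1 := by
        refine lt_of_le_of_ne nξ₂ fun h => hv ?_
        have h0 : ξ₂ ≠ 0 := by rintro rfl; simp at h
        have := Padic.valuation_eq_zero_of_norm h
        rw [Padic.valuation_mul (pow_ne_zero _ ha0) (pow_ne_zero _ h0), Padic.valuation_pow,
          Padic.valuation_pow] at this
        push_cast at this
        omega
      have k₃ : ‖a * ξ₁ * ξ₂‖ < 1 := by
        have : ‖a * ξ₁ * ξ₂‖ ^ 3 < 1 := by
          rw [← norm_pow, show (a * ξ₁ * ξ₂) ^ 3 = (a * ξ₁ ^ 3) * (a ^ 2 * ξ₂ ^ 3) by ring, norm_mul]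
          exact mul_lt_one_of_nonneg_of_lt_one_left (norm_nonneg _) k₁ k₂.le
        exact (pow_lt_one_iff_of_nonneg (norm_nonneg _) (by norm_num)).1 this
      refine not_conditionP_of_norm_lt hp hp2 h3 hD' ns nM nC hs3 ?_ ?_ hP
      · have : 3 * s ^ 2 + (1 + 2 * D * M * C) = 3 * (a * ξ₁ * ξ₂) := by
          rw [hs]; linear_combination R₁
        rw [this, norm_mul, n3, one_mul]; exact k₃
      · have : s ^ 3 - D * C ^ 2 = -(a * ξ₁ ^ 3) + (-(a ^ 2 * ξ₂ ^ 3) + 3 * s * (a * ξ₁ * ξ₂)) := by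
          linear_combination hC2
        rw [this]
        refine ultra_add_lt (by rwa [norm_neg]) (ultra_add_lt (by rwa [norm_neg]) ?_)
        rw [norm_mul, norm_mul, n3, one_mul]
        exact mul_lt_one_of_nonneg_of_lt_one_right ns (norm_nonneg _) k₃

end

end

section

open TernaryCubic

section

local notation "α" => algebraMap ℚ_[3] (PadicAlgCl 3)

lemma three_le_norm {x : ℚ_[3]} (h : 1 < ‖x‖) : 3 ≤ ‖x‖ := by
  have := norm_le_inv_three (x := x⁻¹) (by rw [norm_inv]; exact inv_lt_one_of_one_lt₀ h)
  rw [norm_inv] at this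
  exact (inv_le_inv₀ (by positivity) (by norm_num)).1 this

lemma norm_sq_sub_one {a : ℚ_[3]} (ha : ‖a‖ = 1) : ‖a ^ 2 - 1‖ ≤ 3⁻¹ := by
  obtain ⟨a, rfl⟩ : ∃ z : ℤ_[3], (z : ℚ_[3]) = a := ⟨⟨_, ha.le⟩, rfl⟩
  have hk : ∀ z : ℤ_[3], ‖z‖ < 1 ↔ PadicInt.toZMod z = 0 := fun z => by
    rw [← RingHom.mem_ker, PadicInt.ker_toZMod, IsLocalRing.mem_maximalIdeal,
      PadicInt.mem_nonunits]
  have h0 : PadicInt.toZMod a ≠ 0 := fun h => by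
    have := (hk a).2 h
    rw [PadicInt.norm_def, ha] at this
    exact lt_irrefl _ this
  apply norm_le_inv_three
  have := (hk (a ^ 2 - 1)).2 (by
    rw [map_sub, map_pow, map_one]
    generalize PadicInt.toZMod a = b at h0
    revert b; decide)
  rw [PadicInt.norm_def] at this
  exact_mod_cast this

lemma norm_cube_sub_self {a : ℚ_[3]} (ha : ‖a‖ = 1) (hn : ∀ y, y ^ 3 ≠ a) : ‖a ^ 3 - a‖ = 3⁻¹ := by
  have e : a ^ 3 - a = a * (a ^ 2 - 1) := by ring
  have h1 := norm_sq_sub_one ha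
  have h2 : ‖a ^ 3 - a‖ ≤ 3⁻¹ := by rw [e, norm_mul, ha, one_mul]; exact h1
  by_contra hne
  have h3 := lt_of_le_of_ne h2 hne
  obtain ⟨c, hc⟩ : ∃ c, c = (a ^ 3 - a) / 9 := ⟨_, rfl⟩
  have hc' : ‖(a ^ 3 - a) / 3‖ ≤ 3⁻¹ := by
    apply norm_le_inv_three
    rw [norm_div, norm_three, div_inv_eq_mul]
    linarith
  have nc : ‖c‖ ≤ 1 := by
    rw [hc, show (a ^ 3 - a) / 9 = (a ^ 3 - a) / 3 / 3 by ring, norm_div, norm_three,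
      div_inv_eq_mul]
    linarith
  have n3 : ∀ z : ℚ_[3], ‖z‖ ≤ 1 → ‖3 * z‖ < 1 := fun z hz => by
    rw [norm_mul, norm_three]; linarith
  have two : ‖(2 : ℚ_[3])‖ ≤ 1 := by exact_mod_cast Padic.norm_int_le_one 2
  have nac : ‖a * c‖ ≤ 1 := by rw [norm_mul, ha, one_mul]; exact nc
  obtain ⟨Y, hY⟩ := Padic.exists_cubic_root (p := 3) (g₀ := -((a ^ 2 - 1) * c) + 3 * (a * c * c - c ^ 3))
    (g₁ := a ^ 2 + 3 * (-2 * (a * c) + 3 * c ^ 2)) (g₂ := 3 * (a - 3 * c)) (g₃ := 3)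
    (by
      refine ultra_add_lt ?_ (n3 _ ?_)
      · rw [norm_neg, norm_mul]
        nlinarith [norm_nonneg c, norm_nonneg (a ^ 2 - 1)]
      · rw [sub_eq_add_neg]
        refine ultra_add_le ?_ ?_
        · rw [norm_mul]; exact mul_le_one₀ nac (norm_nonneg _) nc
        · rw [norm_neg, norm_pow]; exact pow_le_one₀ (norm_nonneg _) nc)
    (by
      rw [ultra_add_eq]
      · rw [norm_pow, ha, one_pow]
      · rw [norm_pow, ha, one_pow]
        refine n3 _ (ultra_add_le ?_ (n3 _ ?_).le)
        · rw [norm_mul, norm_neg]; exact mul_le_one₀ two (norm_nonneg _) nac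
        · rw [norm_pow]; exact pow_le_one₀ (norm_nonneg _) nc)
    (by
      refine (n3 _ ?_).le
      rw [sub_eq_add_neg]
      exact ultra_add_le ha.le (by rw [norm_neg]; exact (n3 _ nc).le))
    (by rw [norm_three]; norm_num)
  refine hn (a + 3 * (Y - c)) ?_
  have : 9 * c = a ^ 3 - a := by rw [hc]; ring
  linear_combination 9 * hY + (-1) * this

lemma eq_zero_of_norm_cube_eq {b c : ℚ_[3]} {j : ℕ} (hj : ¬ 3 ∣ j)
    (h : ‖b ^ 3‖ = ‖3 ^ j * c ^ 3‖) : b = 0 := by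
  by_contra hb
  have hc : c ≠ 0 := by
    rintro rfl
    simp at h
    exact hb h
  have h3 : (3 : ℚ_[3]) ≠ 0 := by norm_num
  have h1 : ‖b ^ 3 * (3 ^ j * c ^ 3)⁻¹‖ = 1 := by
    rw [norm_mul, norm_inv, h, mul_inv_cancel₀]
    exact norm_ne_zero_iff.2 (mul_ne_zero (pow_ne_zero _ h3) (pow_ne_zero _ hc))
  have := Padic.valuation_eq_zero_of_norm h1
  have v3 : (3 : ℚ_[3]).valuation = 1 := by exact_mod_cast Padic.valuation_p (p := 3)
  rw [Padic.valuation_mul (pow_ne_zero _ hb) (inv_ne_zero (mul_ne_zero (pow_ne_zero _ h3)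
    (pow_ne_zero _ hc))), Padic.valuation_inv, Padic.valuation_mul (pow_ne_zero _ h3)
    (pow_ne_zero _ hc), Padic.valuation_pow, Padic.valuation_pow, Padic.valuation_pow, v3] at this
  push_cast at this
  omega

lemma ultra_norm_eq_max {F : Type*} [NormedField F] [IsUltrametricDist F] {u v w : F}
    (huv : ‖u‖ = ‖v‖ → u = 0) (huw : ‖u‖ = ‖w‖ → u = 0) (hvw : ‖v‖ = ‖w‖ → v = 0) :
    ‖u + v + w‖ = max (max ‖u‖ ‖v‖) ‖w‖ := by
  have h1 : ‖u + v‖ = max ‖u‖ ‖v‖ := by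
    by_cases h : ‖u‖ = ‖v‖
    · have hu := huv h
      rw [hu, norm_zero] at h
      rw [hu, norm_eq_zero.1 h.symm]; simp
    · exact IsUltrametricDist.norm_add_eq_max_of_norm_ne_norm h
  by_cases h : ‖u + v‖ = ‖w‖
  · rw [h1] at h
    have : ‖w‖ = 0 := by
      rcases max_choice ‖u‖ ‖v‖ with h2 | h2
      · rw [h2] at h; rw [← h, huw h, norm_zero]
      · rw [h2] at h; rw [← h, hvw h, norm_zero]
    rw [norm_eq_zero.1 this, add_zero, h1, norm_zero, max_eq_left (le_max_of_le_left (norm_nonneg u))]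
  · rw [IsUltrametricDist.norm_add_eq_max_of_norm_ne_norm h, h1]

section

variable {a : ℚ_[3]} {l : PadicAlgCl 3}

lemma norm_cbrt (ha : ‖a‖ = 1) (hl : l ^ 3 = α a) : ‖l‖ = 1 := by
  have := congrArg norm hl
  rw [norm_pow, PadicAlgCl.norm_extends, ha] at this
  exact (pow_eq_one_iff_of_nonneg (norm_nonneg _) (by norm_num)).1 this

lemma norm_algebraMap_three : ‖(3 : PadicAlgCl 3)‖ = 3⁻¹ := by
  rw [← map_ofNat α, PadicAlgCl.norm_extends, norm_three]

lemma norm_cbrt_sub (ha : ‖a‖ = 1) (hn : ∀ y, y ^ 3 ≠ a) (hl : l ^ 3 = α a) :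
    ‖l - α a‖ ^ 3 = 3⁻¹ := by
  have nl := norm_cbrt ha hl
  have na : ‖α a‖ = 1 := by rw [PadicAlgCl.norm_extends, ha]
  have e : (l - α a) ^ 3 = -α (a ^ 3 - a) + -(3 * (α a * l * (l - α a))) := by
    rw [map_sub, map_pow]; linear_combination hl
  have n1 : ‖-α (a ^ 3 - a)‖ = 3⁻¹ := by
    rw [norm_neg, PadicAlgCl.norm_extends, norm_cube_sub_self ha hn]
  have n2 : ‖-(3 * (α a * l * (l - α a)))‖ = 3⁻¹ * ‖l - α a‖ := by
    rw [norm_neg, norm_mul, norm_mul, norm_mul, na, nl, norm_algebraMap_three]; ring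
  have n3 : ‖l - α a‖ ≤ 1 := by
    rw [sub_eq_add_neg]; exact ultra_add_le nl.le (by rw [norm_neg, na])
  have n4 : ‖l - α a‖ ^ 3 ≤ 3⁻¹ := by
    rw [← norm_pow, e]
    exact ultra_add_le n1.le (by rw [n2]; linarith)
  have n5 : ‖l - α a‖ < 1 := by
    by_contra h
    rw [le_antisymm n3 (not_lt.1 h)] at n4
    norm_num at n4
  rw [← norm_pow, e, ultra_add_eq, n1]
  rw [n1, n2]; linarith

lemma quad_eq_sub (A B C : ℚ_[3]) : quad l A B C =
    α (A + a * B + a ^ 2 * C) + α (B + 2 * a * C) * (l - α a) + α C * (l - α a) ^ 2 := by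
  simp only [quad, map_add, map_mul, map_pow, map_ofNat]; ring

lemma norm_quad_sub (ha : ‖a‖ = 1) (hn : ∀ y, y ^ 3 ≠ a) (hl : l ^ 3 = α a) (b₀ b₁ b₂ : ℚ_[3]) :
    ‖α b₀ + α b₁ * (l - α a) + α b₂ * (l - α a) ^ 2‖ =
      max (max ‖b₀‖ (‖b₁‖ * ‖l - α a‖)) (‖b₂‖ * ‖l - α a‖ ^ 2) := by
  have h := norm_cbrt_sub ha hn hl
  rw [ultra_norm_eq_max]
  · simp only [norm_mul, norm_pow, PadicAlgCl.norm_extends]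
  all_goals
    simp only [norm_mul, norm_pow, PadicAlgCl.norm_extends]
    intro k
    have k' := congrArg (· ^ 3) k
    simp only [mul_pow] at k'
  · rw [h] at k'
    rw [eq_zero_of_norm_cube_eq (b := b₀) (c := b₁) (j := 1) (by norm_num), map_zero]
    rw [norm_pow, norm_mul, norm_pow, norm_pow, norm_three, k']; ring
  · rw [← pow_mul, mul_comm 2 3, pow_mul _ 3 2, h] at k'
    rw [eq_zero_of_norm_cube_eq (b := b₀) (c := b₂) (j := 2) (by norm_num), map_zero]
    rw [norm_pow, norm_mul, norm_pow, norm_pow, norm_three, k']; ring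
  · rw [← pow_mul, mul_comm 2 3, pow_mul _ 3 2, h] at k'
    rw [eq_zero_of_norm_cube_eq (b := b₁) (c := b₂) (j := 1) (by norm_num), map_zero, zero_mul]
    rw [norm_pow, norm_mul, norm_pow, norm_pow, norm_three]; linarith

open IntermediateField in
lemma norm_algEquiv_sub_lt (ha : ‖a‖ = 1) (hn : ∀ y, y ^ 3 ≠ a) (hl : l ^ 3 = α a)
    (σ : PadicAlgCl 3 ≃ₐ[ℚ_[3]] PadicAlgCl 3) {y : PadicAlgCl 3} (hy : y ∈ ℚ_[3]⟮l⟯) (hy0 : y ≠ 0) :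
    ‖σ y - y‖ < ‖y‖ := by
  obtain ⟨A, B, C, rfl⟩ := exists_quad hl hy
  have hN := norm_cbrt_sub ha hn hl
  have hN0 : 0 ≤ ‖l - α a‖ := norm_nonneg _
  have hmax := norm_quad_sub ha hn hl (A + a * B + a ^ 2 * C) (B + 2 * a * C) C
  rw [← quad_eq_sub] at hmax
  have hη : ‖σ l - l‖ < ‖l - α a‖ := by
    rcases eq_or_ne (σ l - l) 0 with h0 | h0
    · rw [h0, norm_zero]
      refine lt_of_le_of_ne hN0 fun h => ?_
      rw [← h] at hN; norm_num at hN
    · have e : (σ l - l) ^ 2 = -(3 * (σ l * l)) := by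
        have h1 : σ l ^ 3 = α a := by rw [← map_pow, hl, AlgEquiv.commutes]
        apply mul_left_cancel₀ h0
        linear_combination h1 - hl
      have n1 : ‖σ l - l‖ ^ 2 = ‖l - α a‖ ^ 3 := by
        rw [← norm_pow, e, norm_neg, norm_mul, norm_mul, PadicAlgCl.norm_algEquiv,
          norm_cbrt ha hl, norm_algebraMap_three, hN]; norm_num
      have n2 : ‖l - α a‖ < 1 := by
        by_contra h
        have := one_le_pow₀ (n := 3) (not_lt.1 h)
        rw [hN] at this; norm_num at this
      have n3 : 0 < ‖l - α a‖ := by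
        refine lt_of_le_of_ne hN0 fun h => ?_
        rw [← h] at hN; norm_num at hN
      refine lt_of_pow_lt_pow_left₀ 2 hN0 ?_
      rw [n1]
      exact pow_lt_pow_right_of_lt_one₀ n3 n2 (by norm_num)
  have hpos : 0 < ‖quad l A B C‖ := norm_pos_iff.2 hy0
  have hσ : σ (quad l A B C) - quad l A B C = α (B + 2 * a * C) * (σ l - l) +
      α C * ((σ l - l) * (σ (l - α a) + (l - α a))) := by
    simp only [quad, map_add, map_mul, map_pow, map_ofNat, AlgEquiv.commutes, map_sub]; ring
  rw [hσ]
  refine ultra_add_lt ?_ ?_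
  · rw [norm_mul, PadicAlgCl.norm_extends]
    rcases eq_or_ne (B + 2 * a * C) 0 with h | h
    · rw [h, norm_zero, zero_mul]; exact hpos
    · calc _ < ‖B + 2 * a * C‖ * ‖l - α a‖ := by
            have := norm_pos_iff.2 h
            gcongr
        _ ≤ _ := by rw [hmax]; exact le_max_of_le_left (le_max_right _ _)
  · rw [norm_mul, PadicAlgCl.norm_extends]
    rcases eq_or_ne C 0 with h | h
    · rw [norm_eq_zero.2 h, zero_mul]; exact hpos
    · have n1 : ‖σ (l - α a) + (l - α a)‖ ≤ ‖l - α a‖ :=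
        ultra_add_le (by rw [PadicAlgCl.norm_algEquiv]) le_rfl
      calc _ < ‖C‖ * ‖l - α a‖ ^ 2 := by
            have := norm_pos_iff.2 h
            rw [norm_mul, pow_two]
            have h2 : 0 < ‖l - α a‖ := lt_of_le_of_lt (norm_nonneg _) hη
            exact mul_lt_mul_of_pos_left ((mul_le_mul_of_nonneg_left n1 (norm_nonneg _)).trans_lt
              (mul_lt_mul_of_pos_right hη h2)) this
        _ ≤ _ := by rw [hmax]; exact le_max_right _ _

end

/-- The cube of the norm of a coordinate is at least `9` as soon as it exceeds `1`. -/
lemma nine_le_norm_cube {D a ξ₁ ξ₂ M C : ℚ_[3]} {l x : PadicAlgCl 3} (hD : D = 1 ∨ D = -3)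
    (ha : ‖a‖ = 1) (hn : ∀ y, y ^ 3 ≠ a) (hl : l ^ 3 = α a)
    (hx : x = quad l (D * M ^ 2 / 3) ξ₁ ξ₂) (hρ : 1 < ‖x‖) (hC : ‖x‖ ^ 3 = ‖D * C ^ 2‖) :
    9 ≤ ‖x‖ ^ 3 := by
  have h1 : 1 < ‖x‖ ^ 3 := one_lt_pow₀ hρ (by norm_num)
  rw [norm_mul, norm_pow] at hC
  have hCC : 1 < ‖C‖ → 3 ≤ ‖C‖ := three_le_norm
  rcases hD with rfl | rfl
  · rw [hC, norm_one, one_mul] at h1 ⊢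
    have : 1 < ‖C‖ := by
      by_contra h
      exact absurd (pow_le_one₀ (n := 2) (norm_nonneg _) (not_lt.1 h)) (not_le.2 h1)
    nlinarith [hCC this]
  · rw [norm_neg, norm_three] at hC
    have h3 : 3 ≤ ‖C‖ := by
      apply hCC
      by_contra h
      have := pow_le_one₀ (n := 2) (norm_nonneg _) (not_lt.1 h)
      rw [hC] at h1
      linarith
    rcases h3.lt_or_eq with h4 | h4
    · have h5 := three_le_norm (x := 3 * C) (by rw [norm_mul, norm_three]; linarith)
      rw [norm_mul, norm_three] at h5
      rw [hC]; nlinarith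
    · exfalso
      have hx3 : ‖x‖ ^ 3 = 3 := by rw [hC, ← h4]; norm_num
      have hN := norm_cbrt_sub ha hn hl
      have hmax := norm_quad_sub ha hn hl (-3 * M ^ 2 / 3 + a * ξ₁ + a ^ 2 * ξ₂)
        (ξ₁ + 2 * a * ξ₂) ξ₂
      rw [← quad_eq_sub, ← hx] at hmax
      obtain ⟨b₀, hb₀⟩ : ∃ b, b = -3 * M ^ 2 / 3 + a * ξ₁ + a ^ 2 * ξ₂ := ⟨_, rfl⟩
      obtain ⟨b₁, hb₁⟩ : ∃ b, b = ξ₁ + 2 * a * ξ₂ := ⟨_, rfl⟩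
      rw [← hb₀, ← hb₁] at hmax
      have k₀ : ‖b₀‖ ^ 3 ≤ 3 := by
        rw [← hx3, hmax]
        exact pow_le_pow_left₀ (norm_nonneg _) (le_max_of_le_left (le_max_left _ _)) 3
      have k₁ : ‖b₁‖ ^ 3 ≤ 9 := by
        have : (‖b₁‖ * ‖l - α a‖) ^ 3 ≤ 3 := by
          rw [← hx3, hmax]
          exact pow_le_pow_left₀ (by positivity) (le_max_of_le_left (le_max_right _ _)) 3
        rw [mul_pow, hN] at this
        linarith
      have small : ∀ b : ℚ_[3], ‖b‖ ^ 3 ≤ 9 → ‖b‖ ≤ 1 := fun b hb => by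
        by_contra h
        have := pow_le_pow_left₀ (by norm_num) (three_le_norm (not_le.1 h)) 3
        linarith
      have m₀ := small b₀ (by linarith)
      have m₁ := small b₁ k₁
      have m₂ : ‖ξ₂‖ = 3 := by
        have hN6 : (‖l - α a‖ ^ 2) ^ 3 = 9⁻¹ := by
          rw [← pow_mul, mul_comm 2 3, pow_mul, hN]; norm_num
        have hN1 : ‖l - α a‖ ≤ 1 := by
          by_contra h
          have := one_lt_pow₀ (n := 3) (not_le.1 h) (by norm_num)
          rw [hN] at this; norm_num at this
        have : max ‖b₀‖ (‖b₁‖ * ‖l - α a‖) ≤ 1 :=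
          max_le m₀ (mul_le_one₀ m₁ (norm_nonneg _) hN1)
        have h6 : ‖x‖ = ‖ξ₂‖ * ‖l - α a‖ ^ 2 := by
          rcases max_choice (max ‖b₀‖ (‖b₁‖ * ‖l - α a‖)) (‖ξ₂‖ * ‖l - α a‖ ^ 2) with h | h
          · rw [h] at hmax; linarith
          · rw [hmax, h]
        rw [h6, mul_pow, hN6] at hx3
        have : ‖ξ₂‖ ^ 3 = 3 ^ 3 := by linarith
        exact (pow_left_inj₀ (norm_nonneg _) (by norm_num) (by norm_num)).1 this
      have hs : ‖M ^ 2‖ = 3 := by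
        have : -(M ^ 2) = a ^ 2 * ξ₂ + (b₀ + -(a * b₁)) := by rw [hb₀, hb₁]; ring
        have n2 : ‖a ^ 2 * ξ₂‖ = 3 := by rw [norm_mul, norm_pow, ha, m₂]; norm_num
        rw [← norm_neg, this, ultra_add_eq, n2]
        rw [n2]
        refine lt_of_le_of_lt (ultra_add_le m₀ ?_) (by norm_num : (1 : ℝ) < 3)
        rwa [norm_neg, norm_mul, ha, one_mul]
      have hv : ‖M ^ 2 * 3‖ = 1 := by rw [norm_mul, hs, norm_three]; norm_num
      have hM : M ≠ 0 := by rintro rfl; norm_num at hv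
      have := Padic.valuation_eq_zero_of_norm hv
      have v3 : (3 : ℚ_[3]).valuation = 1 := by exact_mod_cast Padic.valuation_p (p := 3)
      rw [Padic.valuation_mul (pow_ne_zero _ hM) (by norm_num), Padic.valuation_pow, v3] at this
      push_cast at this
      omega

theorem exists_zero_descentCubic_three {D a ξ₁ ξ₂ M C : ℚ_[3]}
    (R₁ : D ^ 2 * M ^ 4 / 3 - 3 * a * ξ₁ * ξ₂ = -(1 + 2 * D * M * C))
    (R₂ : a * ξ₁ ^ 3 + a ^ 2 * ξ₂ ^ 3 =
      2 * D ^ 3 * M ^ 6 / 27 + (1 + 2 * D * M * C) * (D * M ^ 2 / 3) + D * C ^ 2)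
    (hD : D = 1 ∨ D = -3) (ha : ‖a‖ = 1)
    (hρ : ∃ l : PadicAlgCl 3, l ^ 3 = α a ∧ 1 < ‖quad l (D * M ^ 2 / 3) ξ₁ ξ₂‖) :
    ∃ v : Fin 3 → ℚ_[3], v ≠ 0 ∧ (descentCubic D a ξ₁ ξ₂ M C).eval v = 0 := by
  by_cases hn : ∃ y, y ^ 3 = a
  · obtain ⟨y, hy⟩ := hn
    exact ⟨![-y, 1, 0], fun h => by simpa using congrFun h 1, descentCubic_eval_cbrt hy⟩
  push Not at hn
  have hD0 : D ≠ 0 := by rcases hD with rfl | rfl <;> norm_num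
  have ha0 : a ≠ 0 := by rintro rfl; simp at ha
  obtain ⟨δ, hδ⟩ := IsAlgClosed.exists_pow_nat_eq (α D) (n := 2) (by norm_num)
  obtain ⟨θ, hθ⟩ := IsAlgClosed.exists_pow_nat_eq (-3 : PadicAlgCl 3) (n := 2) (by norm_num)
  obtain ⟨ω, hω⟩ : ∃ ω : PadicAlgCl 3, ω ^ 2 + ω + 1 = 0 :=
    ⟨(θ - 1) / 2, by linear_combination hθ / 4⟩
  have hω3 : ω ^ 3 = 1 := by linear_combination (ω - 1) * hω
  obtain ⟨lam, hlam, hρ⟩ := hρ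
  obtain ⟨l, hl⟩ : ∃ l : Fin 3 → PadicAlgCl 3, l = ![lam, ω * lam, ω ^ 2 * lam] := ⟨_, rfl⟩
  have l0 : l 0 ^ 3 = α a := by rw [hl]; exact hlam
  have l1 : l 1 = ω * l 0 := by rw [hl]; rfl
  have l2 : l 2 = ω ^ 2 * l 0 := by rw [hl]; rfl
  obtain ⟨x, hx⟩ : ∃ x : Fin 3 → PadicAlgCl 3, ∀ i, x i = quad (l i) (D * M ^ 2 / 3) ξ₁ ξ₂ :=
    ⟨_, fun _ => rfl⟩
  have hρ0 : 1 < ‖x 0‖ := by rw [hx, hl]; exact hρ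
  have nx : ∀ i, ‖x i‖ = ‖x 0‖ := by
    intro i
    obtain ⟨σ, hσ⟩ := exists_algEquiv_cbrt (K := ℚ_[3]) hn l0 (l' := l i) (by
      fin_cases i
      · exact l0
      · change l 1 ^ 3 = _; rw [l1, mul_pow, hω3, l0, one_mul]
      · change l 2 ^ 3 = _
        rw [l2, mul_pow, ← pow_mul, mul_comm 2 3, pow_mul, hω3, l0, one_pow, one_mul])
    rw [hx, ← map_quad hσ, PadicAlgCl.norm_algEquiv, ← hx]
  obtain ⟨-, -, f₃⟩ := conj_symm hω l1 l2 l0 (x := x) (s := α (D * M ^ 2 / 3)) (ξ₁ := α ξ₁)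
    (ξ₂ := α ξ₂) (fun i => by rw [hx, quad])
  have hC : ‖x 0‖ ^ 3 = ‖D * C ^ 2‖ := by
    have h1 : α (D * C ^ 2) = x 0 * x 1 * x 2 := by
      rw [f₃, show D * C ^ 2 = (D * M ^ 2 / 3) ^ 3 + a * ξ₁ ^ 3 + a ^ 2 * ξ₂ ^ 3 -
        3 * (D * M ^ 2 / 3) * a * ξ₁ * ξ₂ by linear_combination -R₂ - D * M ^ 2 / 3 * R₁]
      generalize D * M ^ 2 / 3 = s
      simp only [map_mul, map_add, map_sub, map_pow, map_ofNat]
    rw [← PadicAlgCl.norm_extends, h1, norm_mul, norm_mul, nx 1, nx 2]; ring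
  have h9 := nine_le_norm_cube hD ha hn l0 (hx 0) hρ0 hC
  have hN := norm_cbrt_sub ha hn l0
  refine exists_padic_zero_of_pencil R₁ R₂ hD0 hn hδ hω l0 l1 l2 hx hρ0
    (e := fun i => quad (l i) (1 / 3) (-2 / (3 * a)) (1 / (3 * a ^ 2))) (fun _ => rfl) ?_
    (Or.inr fun σ y hy hy0 => norm_algEquiv_sub_lt ha hn l0 σ hy hy0)
  have e : quad (l 0) (1 / 3) (-2 / (3 * a)) (1 / (3 * a ^ 2)) =
      α (1 / (3 * a ^ 2)) * (l 0 - α a) ^ 2 := by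
    have : α a ≠ 0 := by simpa using ha0
    simp only [quad, map_div₀, map_mul, map_neg, map_pow, map_ofNat, map_one]
    field_simp; ring
  have ne : ‖quad (l 0) (1 / 3) (-2 / (3 * a)) (1 / (3 * a ^ 2))‖ = 3 * ‖l 0 - α a‖ ^ 2 := by
    rw [e, norm_mul, norm_pow, PadicAlgCl.norm_extends, norm_div, norm_mul, norm_pow, ha, norm_one,
      norm_three]; norm_num
  rw [ne]
  refine le_of_pow_le_pow_left₀ (n := 3) (by norm_num) (norm_nonneg _) ?_
  calc ((3 * ‖l 0 - α a‖ ^ 2) ^ 2) ^ 3 = 729 * (‖l 0 - α a‖ ^ 3) ^ 4 := by ring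
    _ = 9 := by rw [hN]; norm_num
    _ ≤ _ := h9

end

end

section

open TernaryCubic

lemma descentCubic_map {F K : Type*} [Field F] [Field K] (f : F →+* K) (D a ξ₁ ξ₂ M C : F) :
    (descentCubic D a ξ₁ ξ₂ M C).map f = descentCubic (f D) (f a) (f ξ₁) (f ξ₂) (f M) (f C) := by
  simp [descentCubic, TernaryCubic.map, map_ofNat]

theorem exists_rat_zero_descentCubic {a : ℕ} (ha : 1 < a)
    (hcubefree : ∀ p : ℕ, p.Prime → ¬ p ^ 3 ∣ a)
    (hfac : ∀ p : ℕ, (hp : p.Prime) → p ∣ a → p ≠ 2 ∧ p ≠ 3 ∧ ConditionP p hp)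
    {D ξ₁ ξ₂ M C : ℚ} (hD : D = 1 ∨ D = -3)
    (R₁ : D ^ 2 * M ^ 4 / 3 - 3 * a * ξ₁ * ξ₂ = -(1 + 2 * D * M * C))
    (R₂ : a * ξ₁ ^ 3 + a ^ 2 * ξ₂ ^ 3 =
      2 * D ^ 3 * M ^ 6 / 27 + (1 + 2 * D * M * C) * (D * M ^ 2 / 3) + D * C ^ 2)
    (hρ : ∃ l : PadicAlgCl 3, l ^ 3 = a ∧
      1 < ‖((D * M ^ 2 / 3 : ℚ) : PadicAlgCl 3) + (ξ₁ : PadicAlgCl 3) * l + ξ₂ * l ^ 2‖) :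
    ∃ w : Fin 3 → ℚ, w ≠ 0 ∧ (descentCubic D (a : ℚ) ξ₁ ξ₂ M C).eval w = 0 := by
  have ha0 : (a : ℚ) ≠ 0 := by positivity
  obtain ⟨κ, hκ⟩ : ∃ κ : ℚ, IsScale D a κ := by
    rcases hD with h | h
    exacts [⟨_, Or.inl ⟨h, rfl⟩⟩, ⟨_, Or.inr ⟨h, rfl⟩⟩]
  have hκ0 : κ ≠ 0 := by
    rcases hκ with ⟨-, rfl⟩ | ⟨-, rfl⟩
    exacts [ha0, mul_ne_zero three_ne_zero ha0]
  have h4 := descentCubic_c4 R₁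
  have h6 := descentCubic_c6 R₁ R₂
  obtain ⟨y, hy⟩ : ∃ y : ℝ, y ^ 3 = a :=
    ⟨(a : ℝ) ^ ((1 : ℝ) / 3), by
      rw [← Real.rpow_natCast, ← Real.rpow_mul (by positivity)]; norm_num⟩
  have hv : (![-y, 1, 0] : Fin 3 → ℝ) ≠ 0 := fun h => by simpa using congrFun h 1
  have hreal : ((descentCubic D a ξ₁ ξ₂ M C).map (Rat.castHom ℝ)).eval ![-y, 1, 0] = 0 := by
    rw [descentCubic_map]
    exact descentCubic_eval_cbrt (by simpa using hy)
  have rel : ∀ (p : ℕ) [Fact p.Prime], ((D : ℚ_[p]) ^ 2 * M ^ 4 / 3 - 3 * (a : ℚ) * ξ₁ * ξ₂ =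
      -(1 + 2 * D * M * C)) ∧ ((a : ℚ) * (ξ₁ : ℚ_[p]) ^ 3 + (a : ℚ) ^ 2 * ξ₂ ^ 3 =
      2 * D ^ 3 * M ^ 6 / 27 + (1 + 2 * D * M * C) * (D * M ^ 2 / 3) + D * C ^ 2) := fun p _ =>
    ⟨by exact_mod_cast congrArg (Rat.cast : ℚ → ℚ_[p]) R₁,
      by exact_mod_cast congrArg (Rat.cast : ℚ → ℚ_[p]) R₂⟩
  have relκ : ∀ (p : ℕ) [Fact p.Prime], IsScale (D : ℚ_[p]) (a : ℚ) κ := fun p _ => by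
    rcases hκ with ⟨h1, h2⟩ | ⟨h1, h2⟩
    · exact Or.inl ⟨by rw [h1]; norm_num, by rw [h2]⟩
    · exact Or.inr ⟨by rw [h1]; norm_num, by rw [h2]; push_cast; ring⟩
  have h3 : ‖((a : ℚ) : ℚ_[3])‖ = 1 := by
    rw [Rat.cast_natCast, Padic.norm_natCast_eq_one_iff]
    exact (Nat.Prime.coprime_iff_not_dvd Nat.prime_three).2 fun h =>
      (hfac 3 Nat.prime_three h).2.1 rfl
  obtain ⟨v₃, hv₃, hz₃⟩ := exists_zero_descentCubic_three (rel 3).1 (rel 3).2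
    (by rcases relκ 3 with h | h; exacts [Or.inl h.1, Or.inr h.1]) h3 (by
      obtain ⟨l, hl, h⟩ := hρ
      refine ⟨l, by rw [hl, Rat.cast_natCast, map_natCast], ?_⟩
      have e : (D : ℚ_[3]) * M ^ 2 / 3 = ((D * M ^ 2 / 3 : ℚ) : ℚ_[3]) := by push_cast; rfl
      simpa only [quad, e, map_ratCast] using h)
  have hloc : ∀ (p : ℕ) [Fact p.Prime],
      LocalModel ((descentCubic D a ξ₁ ξ₂ M C).map (Rat.castHom ℚ_[p])) κ := by
    intro p hp
    rw [descentCubic_map]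
    simp only [Rat.coe_castHom]
    by_cases hp3 : p = 3
    · subst hp3
      exact localModel_descentCubic_of_zero (rel 3).1 (rel 3).2 (relκ 3) (by exact_mod_cast ha0) hv₃ hz₃
    · refine localModel_descentCubic (rel p).1 (rel p).2 (relκ p) hp.out hp3 ?_
      by_cases hpa : p ∣ a
      · obtain ⟨h2, -, hP⟩ := hfac p hp.out hpa
        refine Or.inr ⟨by exact_mod_cast ha0, ?_, h2, hP⟩
        rw [Rat.cast_natCast, Padic.valuation_natCast]
        have ha' : a ≠ 0 := by omega
        have h1 : 1 ≤ padicValNat p a := one_le_padicValNat_of_dvd ha' hpa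
        have h2 : ¬ 3 ≤ padicValNat p a := fun h =>
          hcubefree p hp.out ((padicValNat_dvd_iff_le ha').2 h)
        omega
      · left
        rw [Rat.cast_natCast, Padic.norm_natCast_eq_one_iff]
        exact (Nat.Prime.coprime_iff_not_dvd hp.out).2 hpa
  rcases hκ with ⟨rfl, rfl⟩ | ⟨rfl, rfl⟩
  · refine exists_rat_zero_nine hκ0 (by rw [h4]; ring) h6 hv hreal hloc ?_
    rw [descentCubic_map]
    simp only [Rat.coe_castHom]
    refine localModelLine_of_zero (by exact_mod_cast ha0) ?_ ?_ hv₃ hz₃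
    · rw [descentCubic_c4 (rel 3).1]; push_cast; ring
    · exact descentCubic_c6 (rel 3).1 (rel 3).2
  · exact exists_rat_zero hκ0 (by rw [h4]; ring) h6 hv hreal hloc

end

section

lemma Nat.exists_sq_of_coprime_mul_eq {A B w n : ℕ} (hn : n = 1 ∨ n.Prime) (h : A.Coprime B)
    (hw : A * B = n * w ^ 2) :
    (∃ r s, A = r ^ 2 ∧ B = n * s ^ 2) ∨ (∃ r s, A = n * r ^ 2 ∧ B = s ^ 2) := by
  have key : ∀ {A B w : ℕ}, A.Coprime B → A * B = w ^ 2 → ∃ r s, A = r ^ 2 ∧ B = s ^ 2 := by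
    intro A B w h hw
    obtain ⟨r, hr⟩ := exists_eq_pow_of_mul_eq_pow (Nat.isUnit_iff.2 h) hw
    obtain ⟨s, hs⟩ := exists_eq_pow_of_mul_eq_pow (Nat.isUnit_iff.2 h.symm)
      ((mul_comm _ _).trans hw)
    exact ⟨r, s, hr, hs⟩
  rcases hn with rfl | hn
  · obtain ⟨r, s, hr, hs⟩ := key h (hw.trans (one_mul _))
    exact Or.inl ⟨r, s, hr, by rw [hs, one_mul]⟩
  · rcases (Nat.Prime.dvd_mul hn).1 (Dvd.intro _ hw.symm) with ⟨A, rfl⟩ | ⟨B, rfl⟩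
    · obtain ⟨r, s, hr, hs⟩ := key (w := w) (Nat.Coprime.coprime_mul_left h)
        (Nat.eq_of_mul_eq_mul_left hn.pos (by rw [← hw]; ring))
      exact Or.inr ⟨r, s, by rw [hr], hs⟩
    · obtain ⟨r, s, hr, hs⟩ := key (w := w) (Nat.Coprime.coprime_mul_left_right h)
        (Nat.eq_of_mul_eq_mul_left hn.pos (by rw [← hw]; ring))
      exact Or.inl ⟨r, s, hr, by rw [hs]⟩

lemma Nat.three_dvd_of_sq_add_sq {x y : ℕ} (h : 3 ∣ x ^ 2 + y ^ 2) : 3 ∣ x ∧ 3 ∣ y := by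
  have hx : x % 3 = 0 ∨ x % 3 = 1 ∨ x % 3 = 2 := by omega
  have hy : y % 3 = 0 ∨ y % 3 = 1 ∨ y % 3 = 2 := by omega
  have := Nat.mod_eq_zero_of_dvd h
  rcases hx with hx | hx | hx <;> rcases hy with hy | hy | hy <;>
    simp [Nat.add_mod, Nat.pow_mod, hx, hy] at this
  omega

lemma Nat.sq_mod_eight {x : ℕ} (h : x % 2 = 1) : x ^ 2 % 8 = 1 := by
  have : x % 8 = 1 ∨ x % 8 = 3 ∨ x % 8 = 5 ∨ x % 8 = 7 := by omega
  rcases this with h | h | h | h <;> simp [Nat.pow_mod, h]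

/-- The four factors of `v * d * (v + d) * (2 * v + d)` when the product is `n` times a square. -/
lemma exists_sq_factors {n v d w : ℕ} (hn : n = 1 ∨ n = 3) (hv : 0 < v) (hvd : v.Coprime d)
    (hd : d % 2 = 1) (hw : v * d * ((v + d) * (2 * v + d)) = n * w ^ 2) :
    ∃ q s p r, v = n * q ^ 2 ∧ d = s ^ 2 ∧ v + d = p ^ 2 ∧ 2 * v + d = r ^ 2 := by
  have hn' : n = 1 ∨ n.Prime := hn.imp_right (fun h => by rw [h]; exact Nat.prime_three)
  have c1 : v.Coprime (v + d) := by simpa using hvd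
  have c2 : v.Coprime (2 * v + d) := by rw [add_comm]; simpa using hvd
  have c3 : d.Coprime (v + d) := by simpa using hvd.symm
  have c4 : d.Coprime (2 * v + d) := by
    simp only [Nat.coprime_add_self_right]
    exact Nat.Coprime.mul_right (Nat.coprime_two_right.2 (Nat.odd_iff.2 hd)) hvd.symm
  have c5 : (v + d).Coprime (2 * v + d) := by
    rw [show 2 * v + d = v + (v + d) by ring, Nat.coprime_add_self_right]; exact c1.symm
  have C : (v * d).Coprime ((v + d) * (2 * v + d)) :=
    Nat.Coprime.mul_left (Nat.Coprime.mul_right c1 c2) (Nat.Coprime.mul_right c3 c4)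
  have fin : n = 1 → (∃ q, v = q ^ 2) → (∃ q, d = q ^ 2) → (∃ q, v + d = q ^ 2) →
      (∃ q, 2 * v + d = q ^ 2) →
      ∃ q s p r, v = n * q ^ 2 ∧ d = s ^ 2 ∧ v + d = p ^ 2 ∧ 2 * v + d = r ^ 2 := by
    rintro rfl ⟨q, hq⟩ ⟨s, hs⟩ ⟨p, hp⟩ ⟨r, hr⟩
    exact ⟨q, s, p, r, by rw [hq, one_mul], hs, hp, hr⟩
  rcases Nat.exists_sq_of_coprime_mul_eq hn' C hw with ⟨e, f, he, hf⟩ | ⟨e, f, he, hf⟩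
  · obtain ⟨q, s, hq, hs⟩ : ∃ q s, v = q ^ 2 ∧ d = s ^ 2 := by
      rcases Nat.exists_sq_of_coprime_mul_eq (Or.inl rfl) hvd (he.trans (one_mul _).symm) with
        ⟨q, s, hq, hs⟩ | ⟨q, s, hq, hs⟩
      exacts [⟨q, s, hq, by rw [hs, one_mul]⟩, ⟨q, s, by rw [hq, one_mul], hs⟩]
    rcases Nat.exists_sq_of_coprime_mul_eq hn' c5 hf with ⟨p, r, hp, hr⟩ | ⟨p, r, hp, hr⟩
    · rcases hn with hn | rfl
      · exact fin hn ⟨q, hq⟩ ⟨s, hs⟩ ⟨p, hp⟩ ⟨r, by rw [hr, hn, one_mul]⟩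
      · exfalso
        have hq2 : 2 * q ^ 2 + s ^ 2 = 3 * r ^ 2 := by rw [← hq, ← hs, hr]
        have hq3 : q ^ 2 + s ^ 2 = p ^ 2 := by rw [← hq, ← hs, hp]
        have o1 : s % 2 = 1 := by
          by_contra h
          rw [hs] at hd; simp [Nat.pow_mod, show s % 2 = 0 by omega] at hd
        have o2 : r % 2 = 1 := by
          by_contra h
          obtain ⟨k, rfl⟩ : ∃ k, r = 2 * k := ⟨r / 2, by omega⟩
          rw [← hs] at hq2; ring_nf at hq2; omega
        have := Nat.sq_mod_eight o1
        have := Nat.sq_mod_eight o2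
        rcases Nat.mod_two_eq_zero_or_one q with h | h
        · obtain ⟨k, rfl⟩ : ∃ k, q = 2 * k := ⟨q / 2, by omega⟩
          rcases Nat.mod_two_eq_zero_or_one k with h | h
          · obtain ⟨k, rfl⟩ : ∃ j, k = 2 * j := ⟨k / 2, by omega⟩
            ring_nf at hq2; omega
          · have := Nat.sq_mod_eight h
            ring_nf at hq2; omega
        · have := Nat.sq_mod_eight h
          have o3 : p % 2 = 0 := by
            by_contra h
            have := Nat.sq_mod_eight (x := p) (by omega)
            omega
          obtain ⟨k, rfl⟩ : ∃ k, p = 2 * k := ⟨p / 2, by omega⟩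
          ring_nf at hq3; omega
    · rcases hn with hn | rfl
      · exact fin hn ⟨q, hq⟩ ⟨s, hs⟩ ⟨p, by rw [hp, hn, one_mul]⟩ ⟨r, hr⟩
      · exfalso
        obtain ⟨h1, h2⟩ := Nat.three_dvd_of_sq_add_sq (x := q) (y := s) ⟨p ^ 2, by
          rw [← hp, hq, hs]⟩
        have := Nat.dvd_gcd (dvd_pow h1 two_ne_zero) (dvd_pow h2 two_ne_zero)
        rw [← hq, ← hs, hvd] at this
        norm_num at this
  · obtain ⟨p, r, hp, hr⟩ : ∃ q s, v + d = q ^ 2 ∧ 2 * v + d = s ^ 2 := by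
      rcases Nat.exists_sq_of_coprime_mul_eq (Or.inl rfl) c5 (hf.trans (one_mul _).symm) with
        ⟨q, s, hq, hs⟩ | ⟨q, s, hq, hs⟩
      exacts [⟨q, s, hq, by rw [hs, one_mul]⟩, ⟨q, s, by rw [hq, one_mul], hs⟩]
    rcases Nat.exists_sq_of_coprime_mul_eq hn' hvd he with ⟨q, s, hq, hs⟩ | ⟨q, s, hq, hs⟩
    · rcases hn with hn | rfl
      · exact fin hn ⟨q, hq⟩ ⟨s, by rw [hs, hn, one_mul]⟩ ⟨p, hp⟩ ⟨r, hr⟩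
      · exfalso
        obtain ⟨h1, h2⟩ := Nat.three_dvd_of_sq_add_sq (x := q) (y := r) ⟨q ^ 2 + s ^ 2, by
          rw [← hr, hq, hs]; ring⟩
        have h3 : 3 ∣ v := hq ▸ dvd_pow h1 two_ne_zero
        have := Nat.dvd_gcd h3 (hs ▸ Dvd.intro _ rfl : 3 ∣ d)
        rw [hvd] at this
        norm_num at this
    · exact ⟨q, s, p, r, hq, hs, hp, hr⟩

lemma exists_of_pythagorean {x y p : ℕ} (hx : 0 < x) (hy : 0 < y) (ox : x % 2 = 1)
    (hxy : x.Coprime y) (hp0 : 0 < p) (hp : x ^ 2 + y ^ 2 = p ^ 2) :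
    ∃ v d, 0 < v ∧ 0 < d ∧ v.Coprime d ∧ d % 2 = 1 ∧ v + d < p ∧
      2 * (v * d * ((v + d) * (2 * v + d))) = x * y := by
  have ht : PythagoreanTriple (x : ℤ) y p := by
    rw [PythagoreanTriple]
    have : (x : ℤ) ^ 2 + y ^ 2 = p ^ 2 := by exact_mod_cast hp
    linear_combination this
  obtain ⟨U, V, hU, hV, hP, hg, hpar, hU0⟩ := ht.coprime_classification' (by simpa using hxy)
    (by omega) (by exact_mod_cast hp0)
  have hx' : (0 : ℤ) < x := by exact_mod_cast hx
  have hy' : (0 : ℤ) < y := by exact_mod_cast hy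
  have hV0 : 0 < U * V := by rw [hV] at hy'; linarith
  have hU1 : 0 < U := lt_of_le_of_ne hU0 (by rintro rfl; simp at hV0)
  have hV1 : 0 < V := pos_of_mul_pos_right hV0 hU0
  have hUV : V < U := lt_of_pow_lt_pow_left₀ 2 hU0 (by rw [hU] at hx'; linarith)
  obtain ⟨v, rfl⟩ := Int.eq_ofNat_of_zero_le hV1.le
  obtain ⟨t, rfl⟩ : ∃ t : ℕ, U = v + t := ⟨(U - v).toNat, by omega⟩
  have hg' : (v + t).Coprime v := by
    rw [Int.gcd_eq_natAbs] at hg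
    exact_mod_cast hg
  refine ⟨v, t, by omega, by omega, by simpa using hg'.symm, by omega, ?_, ?_⟩
  · have h1 : (v : ℤ) + t ≤ (v + t) ^ 2 := by nlinarith
    have h2 : (0 : ℤ) < (v : ℤ) ^ 2 := by positivity
    have : ((v + t : ℕ) : ℤ) < p := by rw [hP]; push_cast; linarith
    exact_mod_cast this
  · zify
    rw [hU, hV]; ring

/-- Fermat's descent: neither `1` nor `3` is a congruent number. -/
lemma descent_congruent {n : ℕ} (hn : n = 1 ∨ n = 3) (N : ℕ) : ∀ {v d w : ℕ}, v + d = N → 0 < v →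
    0 < d → v.Coprime d → d % 2 = 1 → v * d * ((v + d) * (2 * v + d)) ≠ n * w ^ 2 := by
  induction N using Nat.strong_induction_on with
  | _ N ih =>
    intro v d w hN hv hd0 hvd hd hw
    obtain ⟨q, s, p, r, hq, hs, hp, hr⟩ := exists_sq_factors hn hv hvd hd hw
    have os : s % 2 = 1 := by
      by_contra h
      rw [hs] at hd; simp [Nat.pow_mod, show s % 2 = 0 by omega] at hd
    have or : r % 2 = 1 := by
      by_contra h
      have : r ^ 2 % 2 = 0 := by simp [Nat.pow_mod, show r % 2 = 0 by omega]
      omega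
    have hrs : s < r := lt_of_pow_lt_pow_left₀ 2 (Nat.zero_le _) (by omega)
    obtain ⟨f, rfl⟩ : ∃ f, r = s + 2 * f := ⟨(r - s) / 2, by omega⟩
    have hf : 0 < f := by omega
    have e1 : 2 * (f * (s + f)) = v := by
      have : (s + 2 * f) ^ 2 = s ^ 2 + 2 * (2 * (f * (s + f))) := by ring
      omega
    have hqe : q % 2 = 0 := by
      by_contra h
      have : q ^ 2 % 2 = 1 := by simp [Nat.pow_mod, show q % 2 = 1 by omega]
      rcases hn with rfl | rfl <;> omega
    obtain ⟨q, rfl⟩ : ∃ k, q = 2 * k := ⟨q / 2, by omega⟩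
    have e2 : f * (s + f) = 2 * (n * q ^ 2) := by
      have : n * (2 * q) ^ 2 = 2 * (2 * (n * q ^ 2)) := by ring
      omega
    have e3 : (s + f) ^ 2 + f ^ 2 = p ^ 2 := by
      rw [← hp, ← e1, hs]; ring
    have hcop : (s + f).Coprime f := by
      rw [Nat.coprime_add_self_left]
      have : (f * (s + f)).Coprime (s ^ 2) := by
        rw [← e1, hs] at hvd
        exact hvd.coprime_mul_left
      exact ((Nat.Coprime.coprime_mul_right this).coprime_dvd_right (dvd_pow_self _ two_ne_zero)).symm
    have hp0 : 0 < p := by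
      rcases Nat.eq_zero_or_pos p with rfl | h
      · simp at hp; omega
      · exact h
    have key : ∀ x y : ℕ, 0 < x → 0 < y → x % 2 = 1 → x.Coprime y → x ^ 2 + y ^ 2 = p ^ 2 →
        x * y = 2 * (n * q ^ 2) → False := by
      intro x y hx hy ox hxy hp2 hxy2
      obtain ⟨V, t, h1, h2, h3, h4, h5, h6⟩ := exists_of_pythagorean hx hy ox hxy hp0 hp2
      have h7 : p ≤ p ^ 2 := Nat.le_self_pow two_ne_zero p
      exact ih (V + t) (by omega) rfl h1 h2 h3 h4 (w := q) (by omega)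
    rcases Nat.mod_two_eq_zero_or_one f with h | h
    · exact key (s + f) f (by omega) hf (by omega) hcop e3 (by rw [mul_comm]; exact e2)
    · exact key f (s + f) hf (by omega) h hcop.symm (by rw [add_comm]; exact e3) e2

end

section

lemma not_congruent_of_coprime {n : ℕ} (hn : n = 1 ∨ n = 3) {v t w : ℕ} (hv : 0 < v) (ht : 0 < t)
    (hvt : v.Coprime t) : v * t * ((v + t) * (2 * v + t)) ≠ n * w ^ 2 := by
  intro hw
  rcases Nat.mod_two_eq_zero_or_one t with h | h
  · obtain ⟨t, rfl⟩ : ∃ k, t = 2 * k := ⟨t / 2, by omega⟩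
    have ov : v % 2 = 1 := by
      by_contra h'
      have := Nat.dvd_gcd (Nat.dvd_of_mod_eq_zero (by omega : v % 2 = 0)) (Dvd.intro t rfl)
      rw [hvt] at this
      omega
    have e : 4 * (t * v * ((t + v) * (2 * t + v))) = n * w ^ 2 := by rw [← hw]; ring
    have ow : w % 2 = 0 := by
      by_contra h'
      have : w ^ 2 % 2 = 1 := by simp [Nat.pow_mod, show w % 2 = 1 by omega]
      rcases hn with rfl | rfl <;> omega
    obtain ⟨w, rfl⟩ : ∃ k, w = 2 * k := ⟨w / 2, by omega⟩
    refine descent_congruent hn _ rfl (by omega) hv hvt.coprime_mul_left_right.symm ov (w := w) ?_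
    have : n * (2 * w) ^ 2 = 4 * (n * w ^ 2) := by ring
    omega
  · exact descent_congruent hn _ rfl hv ht hvt h hw

lemma natAbs_mul_sub_ne {n : ℕ} (hn : n = 1 ∨ n = 3) {p q : ℕ} (hp : 0 < p) (hq : 0 < q)
    (hpq : p.Coprime q) (hne : p ≠ q) (w : ℤ) :
    |(p : ℤ) * q * (p ^ 2 - q ^ 2)| ≠ n * w ^ 2 := by
  wlog h : p < q generalizing p q
  · have := this hq hp hpq.symm hne.symm (by omega)
    rwa [show (p : ℤ) * q * (p ^ 2 - q ^ 2) = -(q * p * (q ^ 2 - p ^ 2)) by ring, abs_neg]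
  obtain ⟨t, rfl⟩ : ∃ t, q = p + t := ⟨q - p, by omega⟩
  intro hw
  refine not_congruent_of_coprime hn (v := p) (t := t) (w := w.natAbs) hp (by omega)
    (by simpa using hpq) ?_
  rw [show (p : ℤ) * ↑(p + t) * (p ^ 2 - ↑(p + t) ^ 2) = -(p * t * ((p + t) * (2 * p + t))) by
    push_cast; ring, abs_neg, abs_of_nonneg (by positivity)] at hw
  zify
  rw [sq_abs, ← hw]

/-- The quadratic twists of `y² = x³ - x` by `1` and `-3` have no rational points with `y ≠ 0`. -/
lemma eq_zero_of_rat_point {D x y : ℚ} (hD : D = 1 ∨ D = -3) (h : D * y ^ 2 = x ^ 3 - x) :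
    y = 0 := by
  obtain ⟨n, hn, hDn⟩ : ∃ n : ℕ, (n = 1 ∨ n = 3) ∧ |D| = n := by
    rcases hD with rfl | rfl
    · exact ⟨1, Or.inl rfl, by norm_num⟩
    · exact ⟨3, Or.inr rfl, by norm_num [abs_of_neg]⟩
  by_contra hy
  obtain ⟨r, hr⟩ : ∃ r, r = y * (x.den : ℚ) ^ 2 := ⟨_, rfl⟩
  have hq : (x.den : ℚ) ≠ 0 := by exact_mod_cast x.den_ne_zero
  have hx : x * x.den = x.num := Rat.mul_den_eq_num x
  have e1 : (x.num : ℚ) * x.den * (x.num ^ 2 - x.den ^ 2) = D * r ^ 2 := by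
    rw [hr, ← hx]; linear_combination (-(x.den : ℚ) ^ 4) * h
  have hr0 : r ≠ 0 := by rw [hr]; exact mul_ne_zero hy (pow_ne_zero _ hq)
  have hD0 : D ≠ 0 := by rcases hD with rfl | rfl <;> norm_num
  have e2 : |(x.num : ℚ) * x.den * (x.num ^ 2 - x.den ^ 2)| = n * r ^ 2 := by
    rw [e1, abs_mul, hDn, abs_of_nonneg (sq_nonneg r)]
  have e0 : (x.num : ℚ) * x.den * (x.num ^ 2 - x.den ^ 2) ≠ 0 := by
    rw [e1]; exact mul_ne_zero hD0 (pow_ne_zero _ hr0)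
  have hr1 : r.den = 1 := by
    have : (n : ℤ) * r.num ^ 2 = |x.num * x.den * (x.num ^ 2 - x.den ^ 2)| * r.den ^ 2 := by
      have h1 : r * r.den = r.num := Rat.mul_den_eq_num r
      have : ((n : ℤ) * r.num ^ 2 : ℚ) =
          |(x.num : ℚ) * x.den * (x.num ^ 2 - x.den ^ 2)| * r.den ^ 2 := by
        rw [e2, ← h1]; push_cast; ring
      exact_mod_cast this
    have h2 : r.den ^ 2 ∣ n := by
      have h3 : (r.den : ℤ) ^ 2 ∣ n * r.num ^ 2 := Dvd.intro_left _ this.symm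
      have h4 : IsCoprime ((r.den : ℤ) ^ 2) (r.num ^ 2) := by
        apply IsCoprime.pow
        rw [Int.isCoprime_iff_gcd_eq_one, Int.gcd_comm]
        simpa [Int.gcd_eq_natAbs] using r.reduced
      exact_mod_cast h4.dvd_of_dvd_mul_right h3
    have h5 : r.den ^ 2 ≤ n := Nat.le_of_dvd (by omega) h2
    have h6 := r.den_pos
    rcases hn with rfl | rfl
    · nlinarith
    · have : r.den < 2 := by nlinarith
      omega
  have hrn : r = r.num := by
    conv_lhs => rw [← Rat.num_div_den r, hr1]
    simp
  have hp0 : x.num ≠ 0 := by intro h0; simp [h0] at e0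
  have hcop := x.reduced
  have habs : |((x.num.natAbs : ℤ)) * x.den * ((x.num.natAbs : ℤ) ^ 2 - x.den ^ 2)| =
      n * r.num ^ 2 := by
    rw [Int.natCast_natAbs, sq_abs, abs_mul, abs_mul, abs_abs, ← abs_mul, ← abs_mul]
    rw [hrn] at e2
    exact_mod_cast e2
  refine natAbs_mul_sub_ne hn (Int.natAbs_pos.2 hp0) x.den_pos hcop ?_ _ habs
  intro hpq
  rw [hpq, sub_self, mul_zero, abs_zero] at habs
  have : r.num = 0 := by
    rcases hn with rfl | rfl <;> simpa using habs.symm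
  rw [this] at hrn
  exact hr0 (by simpa using hrn)

end

section

/-- A field `L = ℚ(ω, l)` with `ω` a primitive cube root of unity and `l` a cube root of `a`,
together with two generators of its Galois group and a sufficiently good embedding in `ℚ̄₃`. -/
structure KummerData (a : ℕ) (L : Type*) [Field L] where
  ω : L
  l : L
  σ : L →+* L
  τ : L →+* L
  φ : L →+* PadicAlgCl 3
  hω : ω ^ 2 + ω + 1 = 0
  hl : l ^ 3 = a
  not_cube : ∀ y : ℚ, y ^ 3 ≠ a
  span : ∀ y : L, ∃ A B C A' B' C' : ℚ,
    y = A + B * l + C * l ^ 2 + ω * (A' + B' * l + C' * l ^ 2)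
  σ_ω : σ ω = ω
  σ_l : σ l = ω * l
  τ_ω : τ ω = ω ^ 2
  τ_l : τ l = l
  norm_cube_sub_le : ∀ A B C : ℚ, ‖φ (A + B * l + C * l ^ 2)‖ ≤ 1 →
    ‖φ (A + B * l + C * l ^ 2) ^ 3 - φ (A + B * l + C * l ^ 2)‖ ^ 3 ≤ 3⁻¹
  norm_cube_le : ∀ A B C : ℚ, ‖φ (A + B * l + C * l ^ 2)‖ < 1 →
    ‖φ (A + B * l + C * l ^ 2)‖ ^ 3 ≤ 3⁻¹

namespace KummerData

variable {a : ℕ} {L : Type*} [Field L] [CharZero L] (S : KummerData a L)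

omit [CharZero L] in
lemma ω_cube : S.ω ^ 3 = 1 := by linear_combination (S.ω - 1) * S.hω

lemma τ_τ (y : L) : S.τ (S.τ y) = y := by
  obtain ⟨A, B, C, A', B', C', rfl⟩ := S.span y
  simp only [map_add, map_mul, map_pow, map_ratCast, S.τ_ω, S.τ_l]
  linear_combination (A' + B' * S.l + C' * S.l ^ 2) * S.ω * S.ω_cube

lemma σ_σ_σ (y : L) : S.σ (S.σ (S.σ y)) = y := by
  obtain ⟨A, B, C, A', B', C', rfl⟩ := S.span y
  simp only [map_add, map_mul, map_pow, map_ratCast, S.σ_ω, S.σ_l]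
  linear_combination (B * S.l + S.ω * (B' * S.l) + C * S.l ^ 2 * (S.ω ^ 3 + 1) +
    S.ω * (C' * S.l ^ 2) * (S.ω ^ 3 + 1)) * S.ω_cube

lemma τ_σ (y : L) : S.τ (S.σ y) = S.σ (S.σ (S.τ y)) := by
  obtain ⟨A, B, C, A', B', C', rfl⟩ := S.span y
  simp only [map_add, map_mul, map_pow, map_ratCast, S.σ_ω, S.σ_l, S.τ_ω, S.τ_l]
  ring

lemma exists_of_τ {y : L} (hy : S.τ y = y) : ∃ A B C : ℚ, y = A + B * S.l + C * S.l ^ 2 := by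
  obtain ⟨A, B, C, A', B', C', h⟩ := S.span y
  refine ⟨A - A' / 2, B - B' / 2, C - C' / 2, ?_⟩
  have h2 : S.τ y = A + B * S.l + C * S.l ^ 2 + S.ω ^ 2 * (A' + B' * S.l + C' * S.l ^ 2) := by
    rw [h]
    simp only [map_add, map_mul, map_pow, map_ratCast, S.τ_ω, S.τ_l]
  push_cast
  linear_combination (1 / 2 : L) * h + (1 / 2 : L) * h2 - (1 / 2 : L) * hy +
    (A' + B' * S.l + C' * S.l ^ 2) / 2 * S.hω

lemma exists_rat {y : L} (hσ : S.σ y = y) (hτ : S.τ y = y) : ∃ q : ℚ, y = q := by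
  obtain ⟨A, B, C, h⟩ := S.exists_of_τ hτ
  have h1 : S.σ y = A + B * (S.ω * S.l) + C * (S.ω * S.l) ^ 2 := by
    rw [h]; simp only [map_add, map_mul, map_pow, map_ratCast, S.σ_l]
  have h2 : S.σ (S.σ y) = A + B * (S.ω * (S.ω * S.l)) + C * (S.ω * (S.ω * S.l)) ^ 2 := by
    rw [h1]; simp only [map_add, map_mul, map_pow, map_ratCast, S.σ_l, S.σ_ω]
  rw [hσ] at h2
  rw [hσ] at h2
  rw [hσ] at h1
  refine ⟨A, ?_⟩
  linear_combination (1 / 3 : L) * h + (1 / 3 : L) * h1 + (1 / 3 : L) * h2 +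
    (1 / 3 : L) * (B * S.l + C * S.l ^ 2 + C * S.l ^ 2 * S.ω * (S.ω - 1)) * S.hω

/-- The two eigenspaces of `τ` on the fixed field of `σ`. -/
structure IsTwist (D : ℚ) (δ : L) (ε : ℤ) : Prop where
  sq : δ ^ 2 = D
  σ_eq : S.σ δ = δ
  τ_eq : S.τ δ = ε * δ
  cases : D = 1 ∧ ε = 1 ∨ D = -3 ∧ ε = -1

variable {S}

omit [CharZero L] in
lemma isTwist_one : S.IsTwist 1 1 1 := ⟨by simp, by simp, by simp, Or.inl ⟨rfl, rfl⟩⟩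

lemma isTwist_neg_three : S.IsTwist (-3) (2 * S.ω + 1) (-1) := by
  refine ⟨?_, by simp [S.σ_ω, map_ofNat], ?_, Or.inr ⟨rfl, rfl⟩⟩
  · push_cast; linear_combination 4 * S.hω
  · simp only [map_add, map_mul, map_ofNat, S.τ_ω, map_one]
    push_cast
    linear_combination 2 * S.hω

namespace IsTwist

variable {D : ℚ} {δ : L} {ε : ℤ} (T : S.IsTwist D δ ε)

include T

lemma hD : D = 1 ∨ D = -3 := T.cases.imp And.left And.left

lemma D_ne_zero : D ≠ 0 := by rcases T.hD with rfl | rfl <;> norm_num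

lemma ne_zero : δ ≠ 0 := by
  rintro rfl
  have := T.sq
  exact T.D_ne_zero (by exact_mod_cast (by rw [← this]; simp : (D : L) = 0))

lemma ε_mul_ε : (ε : L) * ε = 1 := by
  rcases T.cases with ⟨-, rfl⟩ | ⟨-, rfl⟩ <;> norm_num

lemma exists_rat {y : L} (hσ : S.σ y = y) (hτ : S.τ y = ε * y) : ∃ q : ℚ, y = δ * q := by
  have hδ := T.ne_zero
  have hε : (ε : L) ≠ 0 := left_ne_zero_of_mul_eq_one T.ε_mul_ε
  obtain ⟨q, hq⟩ := S.exists_rat (y := y / δ) (by rw [map_div₀, hσ, T.σ_eq])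
    (by rw [map_div₀, hτ, T.τ_eq, mul_div_mul_left _ _ hε])
  exact ⟨q, by rw [← hq, mul_div_cancel₀ _ hδ]⟩

end IsTwist

end KummerData

end

section

open Ecurve

namespace KummerData

variable {a : ℕ} {L : Type*} [Field L] [CharZero L] [DecidableEq L] {S : KummerData a L}

lemma map_τ_τ (P : (Ecurve L).Point) : map S.τ (map S.τ P) = P := by
  rcases eq_zero_or_pt P with rfl | ⟨x, y, h, rfl⟩
  · simp
  · simp only [map_pt, S.τ_τ]

lemma map_σ_σ_σ (P : (Ecurve L).Point) : map S.σ (map S.σ (map S.σ P)) = P := by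
  rcases eq_zero_or_pt P with rfl | ⟨x, y, h, rfl⟩
  · simp
  · simp only [map_pt, S.σ_σ_σ]

lemma map_τ_σ (P : (Ecurve L).Point) :
    map S.τ (map S.σ P) = map S.σ (map S.σ (map S.τ P)) := by
  rcases eq_zero_or_pt P with rfl | ⟨x, y, h, rfl⟩
  · simp
  · simp only [map_pt, S.τ_σ]

variable {D : ℚ} {δ : L} {ε : ℤ}

lemma IsTwist.coords (T : S.IsTwist D δ ε) {x y : L} {h : y ^ 2 = x ^ 3 - x}
    (hP : map S.τ (pt h) = ε • pt h) : S.τ x = x ∧ S.τ y = ε * y := by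
  rcases T.cases with ⟨-, rfl⟩ | ⟨-, rfl⟩
  · rw [one_smul, map_pt, pt_inj] at hP
    simpa using hP
  · rw [neg_one_smul, map_pt, neg_pt, pt_inj] at hP
    simpa using hP

lemma IsTwist.two_nsmul_eq_zero (T : S.IsTwist D δ ε) {P : (Ecurve L).Point}
    (hσ : map S.σ P = P) (hτ : map S.τ P = ε • P) : 2 • P = 0 := by
  rcases eq_zero_or_pt P with rfl | ⟨x, y, h, rfl⟩
  · simp
  obtain ⟨h1, h2⟩ := T.coords hτ
  rw [map_pt, pt_inj] at hσ
  obtain ⟨q, rfl⟩ := S.exists_rat hσ.1 h1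
  obtain ⟨r, rfl⟩ := T.exists_rat hσ.2 h2
  have : D * r ^ 2 = q ^ 3 - q := by
    have : (D : L) * (r : L) ^ 2 = (q : L) ^ 3 - q := by rw [← h, ← T.sq]; ring
    exact_mod_cast this
  have hr := eq_zero_of_rat_point T.hD this
  rw [two_nsmul]
  exact pt_add_neg _ _ rfl (by simp [hr])

lemma four_nsmul_eq_zero {P : (Ecurve L).Point} (hσ : map S.σ P = P) : 4 • P = 0 := by
  have h3 : map S.σ (map S.τ P) = map S.τ P := by
    have := congrArg (map S.σ) (map_τ_σ (S := S) P)
    rwa [hσ, map_σ_σ_σ] at this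
  have h1 := (isTwist_one (S := S)).two_nsmul_eq_zero (P := P + map S.τ P)
    (by rw [map_add, hσ, h3]) (by rw [map_add, map_τ_τ, one_smul, add_comm])
  have h2 := (isTwist_neg_three (S := S)).two_nsmul_eq_zero (P := P - map S.τ P)
    (by rw [map_sub, hσ, h3]) (by rw [map_sub, map_τ_τ, neg_one_smul, neg_sub])
  calc 4 • P = 2 • (P + map S.τ P) + 2 • (P - map S.τ P) := by
        rw [← nsmul_add, add_add_sub_cancel, ← two_nsmul, ← mul_nsmul]
    _ = 0 := by rw [h1, h2, add_zero]

end KummerData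

end

section

open Ecurve

section

variable {F : Type*} [Field F] {m c x₀ x₁ x₂ u₀ u₁ u₂ : F}

/-- A zero of the collinear cubic gives a point of the curve. -/
lemma curve_of_collinear (h₀ : (m * x₀ + c) ^ 2 = x₀ ^ 3 - x₀) (e₁ : x₀ + x₁ + x₂ = m ^ 2)
    (e₂ : x₀ * x₁ + x₀ * x₂ + x₁ * x₂ = -(1 + 2 * m * c)) (hu : u₀ + u₁ + u₂ = -m)
    (hU : -(u₀ * u₁ * u₂) - m * (u₀ * u₁ + u₀ * u₂ + u₁ * u₂) +
      (u₀ * x₀ + u₁ * x₁ + u₂ * x₂) + m ^ 3 + 2 * c = 0) {X₀ X₁ Y₀ Y₁ : F}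
    (hX₀ : X₀ = u₀ ^ 2 + u₀ * u₁ + m * (u₀ + u₁) + x₁)
    (hX₁ : X₁ = u₁ ^ 2 + u₁ * u₂ + m * (u₁ + u₂) + x₂)
    (hY₀ : Y₀ = u₀ * (X₀ - x₀) - (m * x₀ + c)) (hY₁ : Y₁ = u₁ * (X₁ - x₁) - (m * x₁ + c)) :
    Y₀ ^ 2 = X₀ ^ 3 - X₀ ∧ -Y₁ = u₀ * X₁ + (-u₀ * x₀ - (m * x₀ + c)) ∧
      X₀ + x₀ + X₁ = u₀ ^ 2 ∧
      X₀ * x₀ + X₀ * X₁ + x₀ * X₁ = -(1 + 2 * u₀ * (-u₀ * x₀ - (m * x₀ + c))) := by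
  obtain rfl : x₂ = m ^ 2 - x₀ - x₁ := by linear_combination e₁
  obtain rfl : u₂ = -m - u₀ - u₁ := by linear_combination hu
  have k₁ : X₀ + x₀ + X₁ = u₀ ^ 2 := by rw [hX₀, hX₁]; ring
  have k₂ : X₀ * x₀ + X₀ * X₁ + x₀ * X₁ = -(1 + 2 * u₀ * (-u₀ * x₀ - (m * x₀ + c))) := by
    rw [hX₀, hX₁]
    linear_combination -(u₀ + m) * hU + e₂
  refine ⟨?_, ?_, k₁, k₂⟩
  · obtain rfl : X₁ = u₀ ^ 2 - X₀ - x₀ := by linear_combination k₁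
    rw [hY₀]
    linear_combination h₀ + (X₀ - x₀) * k₂
  · rw [hY₁, hX₁]
    linear_combination hU

end

end

section

open Ecurve TernaryCubic

lemma norm_algebraMap_two : ‖(2 : PadicAlgCl 3)‖ = 1 := by
  rw [show (2 : PadicAlgCl 3) = -1 + 3 by norm_num, ultra_add_eq] <;>
    rw [norm_neg, norm_one]
  rw [norm_algebraMap_three]; norm_num

/-- The coordinate of a double has large norm. -/
lemma one_lt_norm_of_double {z w : PadicAlgCl 3} (h : w * (4 * (z ^ 3 - z)) = (z ^ 2 + 1) ^ 2)
    (hz : ‖z‖ ≤ 1 → ‖z ^ 3 - z‖ ^ 3 ≤ 3⁻¹) : 1 < ‖w‖ := by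
  have h' := congrArg norm h
  rw [norm_mul, norm_mul, norm_pow, show (4 : PadicAlgCl 3) = 2 ^ 2 by norm_num, norm_pow,
    norm_algebraMap_two, one_pow, one_mul] at h'
  rcases le_or_gt ‖z‖ 1 with h1 | h1
  · have h2 : ‖z ^ 3 - z‖ < 1 := by
      by_contra hc
      have := one_le_pow₀ (n := 3) (not_lt.1 hc)
      have := hz h1
      linarith
    have h3 : ‖z ^ 2 + 1‖ = 1 := by
      rcases h1.lt_or_eq with h4 | h4
      · rw [add_comm, ultra_add_eq, norm_one]
        rw [norm_one, norm_pow]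
        exact pow_lt_one₀ (norm_nonneg _) h4 two_ne_zero
      · rw [show z ^ 2 + 1 = 2 + (z ^ 2 - 1) by ring, ultra_add_eq, norm_algebraMap_two]
        rw [norm_algebraMap_two]
        rwa [show z ^ 3 - z = z * (z ^ 2 - 1) by ring, norm_mul, h4, one_mul] at h2
    rw [h3, one_pow] at h'
    by_contra hc
    have := mul_le_mul (not_lt.1 hc) h2.le (norm_nonneg _) zero_le_one
    nlinarith [norm_nonneg (z ^ 3 - z), norm_nonneg w]
  · have h2 : 1 < ‖z‖ ^ 2 := one_lt_pow₀ h1 two_ne_zero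
    have h3 : ‖z ^ 2 + 1‖ = ‖z‖ ^ 2 := by
      rw [ultra_add_eq, norm_pow]
      rwa [norm_one, norm_pow]
    have h4 : ‖z ^ 3 - z‖ = ‖z‖ ^ 3 := by
      rw [sub_eq_add_neg, ultra_add_eq, norm_pow]
      rw [norm_neg, norm_pow]
      nlinarith
    rw [h3, h4] at h'
    have : ‖w‖ = ‖z‖ := by
      apply mul_right_cancel₀ (pow_ne_zero 3 (by linarith : ‖z‖ ≠ 0))
      rw [h']; ring
    rwa [this]

lemma TernaryCubic.eval_smul {F : Type*} [Field F] (U : TernaryCubic F) (k : F) (v : Fin 3 → F) :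
    U.eval (k • v) = k ^ 3 * U.eval v := by
  simp only [eval, Pi.smul_apply, smul_eq_mul]; ring

lemma exists_affine_zero {a : ℕ} (hn : ∀ y : ℚ, y ^ 3 ≠ a) {D ξ₁ ξ₂ M C : ℚ} (hD : D ≠ 0)
    (ha : a ≠ 0)
    {w : Fin 3 → ℚ} (hw : w ≠ 0) (h : (descentCubic D (a : ℚ) ξ₁ ξ₂ M C).eval w = 0) :
    ∃ r s : ℚ, (descentCubic D (a : ℚ) ξ₁ ξ₂ M C).eval ![r, s, 1] = 0 := by
  have ha' : (a : ℚ) ≠ 0 := by exact_mod_cast ha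
  by_cases h2 : w 2 = 0
  · exfalso
    have e : w 0 ^ 3 + a * w 1 ^ 3 = 0 := by
      apply mul_left_cancel₀ (mul_ne_zero hD ha')
      rw [mul_zero, ← neg_eq_zero, ← h]
      simp only [eval, descentCubic, h2]; ring
    by_cases h1 : w 1 = 0
    · have h0 : w 0 = 0 := by simpa [h1] using e
      refine hw (funext fun i => ?_)
      fin_cases i <;> assumption
    · refine hn (-w 0 / w 1) ?_
      field_simp
      linear_combination -e
  · refine ⟨w 0 / w 2, w 1 / w 2, ?_⟩
    have : w = w 2 • ![w 0 / w 2, w 1 / w 2, 1] := by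
      funext i
      fin_cases i <;> simp [mul_div_cancel₀ _ h2]
    rw [this, eval_smul] at h
    exact (mul_eq_zero.1 h).resolve_left (pow_ne_zero _ h2)

end

section

open Ecurve
open TernaryCubic (eval_map)

namespace KummerData

variable {a : ℕ} {L : Type*} [Field L] [CharZero L] [DecidableEq L] {S : KummerData a L}
  {D : ℚ} {δ : L} {ε : ℤ}

/-- The hypotheses on `a` of the main theorem. -/
structure Admissible (a : ℕ) : Prop where
  one_lt : 1 < a
  cube_free : ∀ p : ℕ, p.Prime → ¬ p ^ 3 ∣ a
  factors : ∀ p : ℕ, (hp : p.Prime) → p ∣ a → p ≠ 2 ∧ p ≠ 3 ∧ ConditionP p hp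

lemma IsTwist.exists_line (T : S.IsTwist D δ ε) {x y : L} (h : y ^ 2 = x ^ 3 - x)
    (hx : S.τ x = x) (hy : S.τ y = ε * y) (hσ : S.σ x ≠ x)
    (hA : pt h + map S.σ (pt h) + map S.σ (map S.σ (pt h)) = 0) :
    ∃ M C : ℚ, y = δ * M * x + δ * C ∧ x + S.σ x + S.σ (S.σ x) = D * M ^ 2 ∧
      x * S.σ x + x * S.σ (S.σ x) + S.σ x * S.σ (S.σ x) = -(1 + 2 * D * M * C) ∧
      x * S.σ x * S.σ (S.σ x) = D * C ^ 2 := by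
  simp only [map_pt] at hA
  obtain ⟨m, c, k₁, k₂, k₃, e₁, e₂, e₃⟩ := Ecurve.exists_line hA
  have hσ2 : S.σ (S.σ x) ≠ x := fun h0 => hσ (by
    have := congrArg S.σ h0
    rw [S.σ_σ_σ] at this
    exact this.symm)
  have hm : S.σ m = m := by
    have h1 := congrArg S.σ (show m * (x - S.σ x) = y - S.σ y by linear_combination k₂ - k₁)
    rw [map_mul, map_sub, map_sub] at h1
    have h2 : S.σ x - S.σ (S.σ x) ≠ 0 := fun h0 => hσ (S.σ.injective (sub_eq_zero.1 h0)).symm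
    apply mul_right_cancel₀ h2
    rw [h1]
    linear_combination k₂ - k₃
  have hm' : S.τ m = ε * m := by
    have h1 := congrArg S.τ (show m * (x - S.σ x) = y - S.σ y by linear_combination k₂ - k₁)
    rw [map_mul, map_sub, map_sub, S.τ_σ, S.τ_σ, hx, hy, map_mul, map_mul, map_intCast,
      map_intCast] at h1
    apply mul_right_cancel₀ (sub_ne_zero.2 hσ2.symm)
    rw [h1]
    linear_combination ε * k₁ - ε * k₃
  have hc : c = y - m * x := by linear_combination -k₁
  obtain ⟨M, rfl⟩ := T.exists_rat hm hm'
  obtain ⟨C, rfl⟩ := T.exists_rat (y := c) (by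
      rw [hc, map_sub, map_mul, hm]; linear_combination k₂ - k₁)
    (by rw [hc, map_sub, map_mul, hm', hx, hy]; ring)
  refine ⟨M, C, k₁, ?_, ?_, ?_⟩
  · rw [e₁, ← T.sq]; ring
  · rw [e₂, ← T.sq]; ring
  · rw [e₃, ← T.sq]; ring

lemma IsTwist.exists_sub_pt (T : S.IsTwist D δ ε) (ha : Admissible a) {x y : L}
    (h : y ^ 2 = x ^ 3 - x) (hx : S.τ x = x) (hy : S.τ y = ε * y) (hσ : S.σ x ≠ x)
    (hA : pt h + map S.σ (pt h) + map S.σ (map S.σ (pt h)) = 0) (hρ : 1 < ‖S.φ x‖) :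
    ∃ Z, pt h = Z - map S.σ Z := by
  obtain ⟨M, C, k, e₁, e₂, e₃⟩ := T.exists_line h hx hy hσ hA
  obtain ⟨s, ξ₁, ξ₂, hxl⟩ := S.exists_of_τ hx
  obtain ⟨l, hl⟩ : ∃ l : Fin 3 → L, l = ![S.l, S.ω * S.l, S.ω ^ 2 * S.l] := ⟨_, rfl⟩
  have l0 : l 0 = S.l := by rw [hl]; rfl
  have l1 : l 1 = S.ω * l 0 := by rw [hl]; rfl
  have l2 : l 2 = S.ω ^ 2 * l 0 := by rw [hl]; rfl
  have σl0 : S.σ (l 0) = l 1 := by rw [l1, l0, S.σ_l]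
  have σl1 : S.σ (l 1) = l 2 := by rw [l1, map_mul, S.σ_ω, σl0, l2, l1]; ring
  have hl3 : l 0 ^ 3 = (a : L) := by rw [l0, S.hl]
  obtain ⟨X, hX⟩ : ∃ X : Fin 3 → L, X = ![x, S.σ x, S.σ (S.σ x)] := ⟨_, rfl⟩
  have X0 : X 0 = x := by rw [hX]; rfl
  have X1 : X 1 = S.σ x := by rw [hX]; rfl
  have X2 : X 2 = S.σ (S.σ x) := by rw [hX]; rfl
  have x0 : x = s + ξ₁ * l 0 + ξ₂ * l 0 ^ 2 := by rw [l0, hxl]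
  have x1 : S.σ x = s + ξ₁ * l 1 + ξ₂ * l 1 ^ 2 := by
    rw [x0]; simp only [map_add, map_mul, map_pow, map_ratCast, σl0]
  have x2 : S.σ (S.σ x) = s + ξ₁ * l 2 + ξ₂ * l 2 ^ 2 := by
    rw [x1]; simp only [map_add, map_mul, map_pow, map_ratCast, σl1]
  have hXl : ∀ i, X i = s + ξ₁ * l i + ξ₂ * l i ^ 2 := by
    intro i
    fin_cases i
    exacts [X0.trans x0, X1.trans x1, X2.trans x2]
  obtain ⟨f₁, f₂, f₃⟩ := conj_symm S.hω l1 l2 hl3 hXl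
  rw [X0, X1, X2] at f₁ f₂ f₃
  obtain rfl : s = D * M ^ 2 / 3 := by
    have : (3 * s : L) = D * M ^ 2 := by rw [← e₁, f₁]
    have : 3 * s = D * M ^ 2 := by exact_mod_cast this
    linear_combination this / 3
  have R₁ : D ^ 2 * M ^ 4 / 3 - 3 * a * ξ₁ * ξ₂ = -(1 + 2 * D * M * C) := by
    have : 3 * (D * M ^ 2 / 3) ^ 2 - 3 * a * ξ₁ * ξ₂ = -(1 + 2 * D * M * C) := by
      exact_mod_cast f₂.symm.trans e₂
    linear_combination this
  have R₂ : a * ξ₁ ^ 3 + a ^ 2 * ξ₂ ^ 3 =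
      2 * D ^ 3 * M ^ 6 / 27 + (1 + 2 * D * M * C) * (D * M ^ 2 / 3) + D * C ^ 2 := by
    have : (D * M ^ 2 / 3) ^ 3 + a * ξ₁ ^ 3 + a ^ 2 * ξ₂ ^ 3 - 3 * (D * M ^ 2 / 3) * a * ξ₁ * ξ₂ =
        D * C ^ 2 := by
      exact_mod_cast f₃.symm.trans e₃
    linear_combination this - D * M ^ 2 / 3 * R₁
  obtain ⟨w, hw0, hw⟩ := exists_rat_zero_descentCubic ha.one_lt ha.cube_free ha.factors T.hD R₁ R₂
    ⟨S.φ S.l, by rw [← map_pow, S.hl, map_natCast], by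
      rw [hxl] at hρ
      simpa only [map_add, map_mul, map_pow, map_ratCast] using hρ⟩
  obtain ⟨r, t, hrt⟩ := exists_affine_zero S.not_cube T.D_ne_zero (by have := ha.one_lt; omega)
    hw0 hw
  obtain ⟨u, hu⟩ : ∃ u : Fin 3 → L, ∀ i, u i = δ * (r * l i + t * l i ^ 2 - M / 3) :=
    ⟨_, fun _ => rfl⟩
  have σu0 : S.σ (u 0) = u 1 := by
    simp only [hu, map_sub, map_add, map_mul, map_pow, map_div₀, map_ratCast, map_ofNat, T.σ_eq,
      σl0]
  have σu1 : S.σ (u 1) = u 2 := by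
    simp only [hu, map_sub, map_add, map_mul, map_pow, map_div₀, map_ratCast, map_ofNat, T.σ_eq,
      σl1]
  have hsum : u 0 + u 1 + u 2 = -(δ * M) := by
    rw [hu, hu, hu, l1, l2]
    linear_combination δ * (r * l 0 + t * l 0 ^ 2 + t * l 0 ^ 2 * S.ω * (S.ω - 1)) * S.hω
  have hU : collinearCubic (δ * M) (δ * C) X u = 0 := by
    rw [collinearCubic_eq_descentCubic S.hω l1 l2 hl3 T.sq (M := (M : L)) (ξ₁ := (ξ₁ : L))
      (ξ₂ := (ξ₂ : L)) (r := r) (s := t) (fun i => by rw [hXl]; push_cast; rfl) hu]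
    have h1 := eval_map (U := descentCubic D (a : ℚ) ξ₁ ξ₂ M C) (f := Rat.castHom L) (v := ![r, t, 1])
    rw [hrt, map_zero, descentCubic_map] at h1
    rw [mul_eq_zero]
    refine Or.inr ?_
    convert h1 using 2
    · simp
    · funext i; fin_cases i <;> simp
  rw [collinearCubic, X0, X1, X2] at hU
  obtain ⟨hZ, g₁, g₂, g₃⟩ := curve_of_collinear (x₁ := S.σ x) (x₂ := S.σ (S.σ x)) (m := δ * M)
    (c := δ * C) (by rw [← k, h]) (by rw [e₁, ← T.sq]; ring) (by rw [e₂, ← T.sq]; ring) hsum hU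
    rfl rfl rfl rfl
  rw [← k] at g₁ g₃
  have σX : S.σ (u 0 ^ 2 + u 0 * u 1 + δ * M * (u 0 + u 1) + S.σ x) =
      u 1 ^ 2 + u 1 * u 2 + δ * M * (u 1 + u 2) + S.σ (S.σ x) := by
    simp only [map_add, map_mul, map_pow, map_ratCast, T.σ_eq, σu0, σu1]
  refine ⟨pt hZ, ?_⟩
  have hsum0 := sum_eq_zero_of_line (m := u 0) (c := -u 0 * x - y) hZ
    (by rw [neg_sq, h] : (-y) ^ 2 = x ^ 3 - x) (by rw [neg_sq]; exact map_eqn S.σ hZ)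
    (by rw [← k]; ring) (by ring)
    (by
      rw [σX, ← g₁]
      simp only [map_sub, map_add, map_mul, map_pow, map_ratCast, T.σ_eq, σu0, σu1])
    (by rw [σX]; exact g₂) (by rw [σX]; exact g₃)
  rw [← neg_pt h, ← neg_pt (map_eqn S.σ hZ), ← map_pt S.σ hZ] at hsum0
  rw [← sub_eq_zero, ← neg_eq_zero, ← hsum0]
  abel

end KummerData

end

section

open Ecurve

section

variable {F : Type*} [Field F] [NeZero (2 : F)] [DecidableEq F]

lemma exists_two_nsmul_pt {x y : F} (h : y ^ 2 = x ^ 3 - x) (h2 : 2 • pt h ≠ 0) :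
    ∃ (X Y : F) (h' : Y ^ 2 = X ^ 3 - X), 2 • pt h = pt h' ∧
      X * (4 * (x ^ 3 - x)) = (x ^ 2 + 1) ^ 2 := by
  rw [two_nsmul] at h2 ⊢
  have hy : y ≠ 0 := by
    rintro rfl
    exact h2 (pt_add_neg _ _ rfl (by simp))
  have hy2 : 2 * y ≠ 0 := mul_ne_zero two_ne_zero hy
  obtain ⟨m, hm⟩ : ∃ m, m * (2 * y) = 3 * x ^ 2 - 1 := ⟨_, div_mul_cancel₀ _ hy2⟩
  obtain ⟨h', e⟩ := pt_add_self h hy hm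
  refine ⟨_, _, h', e, ?_⟩
  rw [← h]
  linear_combination (m * (2 * y) + 3 * x ^ 2 - 1) * hm - 8 * x * h

end

namespace KummerData

variable {a : ℕ} {L : Type*} [Field L] [CharZero L] [DecidableEq L] {S : KummerData a L}
  {D : ℚ} {δ : L} {ε : ℤ}

lemma IsTwist.exists_two_nsmul_pt (T : S.IsTwist D δ ε) {P : (Ecurve L).Point}
    (hτ : map S.τ P = ε • P) (h2 : 2 • P ≠ 0) :
    ∃ (X Y : L) (h : Y ^ 2 = X ^ 3 - X), 2 • P = pt h ∧ S.τ X = X ∧ S.τ Y = ε * Y ∧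
      1 < ‖S.φ X‖ := by
  rcases eq_zero_or_pt P with rfl | ⟨x, y, h, rfl⟩
  · simp at h2
  obtain ⟨X, Y, h', e, hX⟩ := _root_.exists_two_nsmul_pt h h2
  obtain ⟨A, B, C, hx⟩ := S.exists_of_τ (T.coords hτ).1
  obtain ⟨c1, c2⟩ := T.coords (h := h') (by rw [← e, map_nsmul, hτ, smul_comm])
  refine ⟨X, Y, h', e, c1, c2, one_lt_norm_of_double (z := S.φ x) ?_ ?_⟩
  · simpa only [map_mul, map_sub, map_add, map_pow, map_one, map_ofNat] using congrArg S.φ hX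
  · rw [hx]; exact S.norm_cube_sub_le A B C

/-- Every double of a point in an eigenspace of `τ` in the kernel of the trace is in the image of
`1 - σ`. -/
lemma IsTwist.exists_sub (T : S.IsTwist D δ ε) (ha : Admissible a) {P : (Ecurve L).Point}
    (hτ : map S.τ P = ε • P) (hA : P + map S.σ P + map S.σ (map S.σ P) = 0) :
    ∃ Z, 2 • P = Z - map S.σ Z := by
  by_cases h2 : 2 • P = 0
  · exact ⟨0, by simp [h2]⟩
  obtain ⟨X, Y, h, e, hX, hY, hρ⟩ := T.exists_two_nsmul_pt hτ h2
  have hA' : pt h + map S.σ (pt h) + map S.σ (map S.σ (pt h)) = 0 := by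
    rw [← e, map_nsmul, map_nsmul, ← nsmul_add, ← nsmul_add, hA, nsmul_zero]
  rw [e]
  refine T.exists_sub_pt ha h hX hY (fun hσ => ?_) hA' hρ
  obtain ⟨m, c, k₁, k₂, -⟩ := Ecurve.exists_line (h₂ := map_eqn S.σ h)
    (h₃ := map_eqn S.σ (map_eqn S.σ h)) hA'
  have hfix : map S.σ (pt h) = pt h := by
    rw [map_pt, pt_inj]
    exact ⟨hσ, by linear_combination k₂ - k₁ + m * hσ⟩
  rw [hfix, hfix] at hA'
  refine pt_ne_zero h ?_
  have h4 := four_nsmul_eq_zero hfix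
  calc pt h = 4 • pt h - (pt h + pt h + pt h) := by abel
    _ = 0 := by rw [h4, hA', sub_zero]

/-- The kernel of the trace `1 + σ + σ²`. -/
def traceKer (S : KummerData a L) : AddSubgroup (Ecurve L).Point :=
  (AddMonoidHom.id _ + map S.σ + (map S.σ).comp (map S.σ)).ker

lemma mem_traceKer {P : (Ecurve L).Point} :
    P ∈ S.traceKer ↔ P + map S.σ P + map S.σ (map S.σ P) = 0 := by
  simp [traceKer, AddMonoidHom.mem_ker]

lemma map_σ_mem {P : (Ecurve L).Point} (h : P ∈ S.traceKer) : map S.σ P ∈ S.traceKer := by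
  rw [mem_traceKer] at h ⊢
  rw [map_σ_σ_σ, ← h]; abel

lemma map_τ_mem {P : (Ecurve L).Point} (h : P ∈ S.traceKer) : map S.τ P ∈ S.traceKer := by
  rw [mem_traceKer] at h ⊢
  have h1 : map S.τ (map S.σ (map S.σ P)) = map S.σ (map S.τ P) := by
    rw [map_τ_σ (map S.σ P), map_τ_σ P, map_σ_σ_σ]
  have h2 := congrArg (map S.τ) h
  rw [map_add, map_add, map_zero, h1, map_τ_σ] at h2
  rw [← h2]; abel

lemma four_nsmul_mem (Z : (Ecurve L).Point)  : 4 • (Z + map S.σ Z + map S.σ (map S.σ Z)) = 0 :=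
  four_nsmul_eq_zero (S := S) (by
    rw [map_add, map_add, map_σ_σ_σ]; abel)

lemma exists_sub (ha : Admissible a) {P : (Ecurve L).Point} (hP : P ∈ S.traceKer) :
    ∃ W ∈ S.traceKer, P = W - map S.σ W := by
  have hτ := map_τ_mem hP
  obtain ⟨Z₁, h₁⟩ := (isTwist_one (S := S)).exists_sub ha (P := P + map S.τ P)
    (by rw [map_add, map_τ_τ, one_smul, add_comm]) (mem_traceKer.1 (add_mem hP hτ))
  obtain ⟨Z₂, h₂⟩ := (isTwist_neg_three (S := S)).exists_sub ha (P := P - map S.τ P)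
    (by rw [map_sub, map_τ_τ, neg_one_smul, neg_sub]) (mem_traceKer.1 (sub_mem hP hτ))
  have h4 : 4 • P = Z₁ + Z₂ - map S.σ (Z₁ + Z₂) := by
    rw [map_add]
    calc 4 • P = 2 • (P + map S.τ P) + 2 • (P - map S.τ P) := by abel
      _ = _ := by rw [h₁, h₂]; abel
  obtain ⟨W, hW⟩ : ∃ W, W = 4 • (Z₁ + Z₂) := ⟨_, rfl⟩
  have hWA : W ∈ S.traceKer := by
    rw [mem_traceKer, hW, map_nsmul, map_nsmul, ← nsmul_add, ← nsmul_add]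
    exact four_nsmul_mem _
  have h16 : 16 • P = W - map S.σ W := by
    rw [hW, map_nsmul, ← nsmul_sub, ← h4, ← mul_nsmul]
  have h3 : 3 • P = 2 • P + map S.σ P - map S.σ (2 • P + map S.σ P) := by
    rw [map_add, map_nsmul]
    calc 3 • P = 2 • P + map S.σ P - (2 • map S.σ P + map S.σ (map S.σ P)) +
          (P + map S.σ P + map S.σ (map S.σ P)) := by abel
      _ = _ := by rw [mem_traceKer.1 hP, add_zero]
  refine ⟨W - 5 • (2 • P + map S.σ P), sub_mem hWA (nsmul_mem (add_mem (nsmul_mem hP 2)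
    (map_σ_mem hP)) 5), ?_⟩
  rw [map_sub, map_nsmul]
  calc P = 16 • P - 5 • (3 • P) := by abel
    _ = _ := by rw [h16, h3]; abel

lemma exists_three_nsmul (ha : Admissible a) {P : (Ecurve L).Point} (hP : P ∈ S.traceKer) :
    ∃ Q ∈ S.traceKer, P = 3 • Q := by
  obtain ⟨W, hW, h₁⟩ := exists_sub ha hP
  obtain ⟨V, hV, h₂⟩ := exists_sub ha hW
  refine ⟨-map S.σ V, neg_mem (map_σ_mem hV), ?_⟩
  rw [h₁, h₂, map_sub]
  calc _ = V + map S.σ V + map S.σ (map S.σ V) + 3 • -map S.σ V := by abel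
    _ = _ := by rw [mem_traceKer.1 hV, zero_add]

lemma IsTwist.exists_three_nsmul (T : S.IsTwist D δ ε) (ha : Admissible a) {P : (Ecurve L).Point}
    (hτ : map S.τ P = ε • P) (hP : P ∈ S.traceKer) :
    ∃ Q ∈ S.traceKer, map S.τ Q = ε • Q ∧ P = 3 • Q := by
  obtain ⟨Q, hQ, h⟩ := KummerData.exists_three_nsmul ha hP
  have hε : ε * ε = 1 := by exact_mod_cast T.ε_mul_ε
  have key : map S.τ (P - (Q + ε • map S.τ Q)) = ε • (P - (Q + ε • map S.τ Q)) := by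
    rw [map_sub, map_add, map_zsmul, map_τ_τ, hτ, smul_sub, smul_add, smul_smul, hε, one_smul,
      add_comm (map S.τ Q)]
  refine ⟨P - (Q + ε • map S.τ Q), sub_mem hP (add_mem hQ (zsmul_mem (map_τ_mem hQ) _)), key, ?_⟩
  have h3 : 3 • map S.τ Q = ε • P := by rw [← map_nsmul, ← h, hτ]
  calc P = 3 • P - P - P := by abel
    _ = 3 • P - 3 • Q - ε • (3 • map S.τ Q) := by rw [h3, smul_smul, hε, one_smul, ← h]
    _ = _ := by rw [smul_comm ε 3]; simp only [nsmul_sub, nsmul_add]; abel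

end KummerData

end

section

open Ecurve

lemma mul_eq_of_three_nsmul {F : Type*} [Field F] [NeZero (2 : F)] [DecidableEq F] {x y X Y : F}
    {h : y ^ 2 = x ^ 3 - x} {h' : Y ^ 2 = X ^ 3 - X} (hy : y ≠ 0) (e : pt h' = 3 • pt h) :
    X * (3 * x ^ 4 - 6 * x ^ 2 - 1) ^ 2 =
      x ^ 9 + 12 * x ^ 7 + 30 * x ^ 5 - 36 * x ^ 3 + 9 * x := by
  have hy2 : 2 * y ≠ 0 := mul_ne_zero two_ne_zero hy
  obtain ⟨m, hm⟩ : ∃ m, m * (2 * y) = 3 * x ^ 2 - 1 := ⟨_, div_mul_cancel₀ _ hy2⟩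
  obtain ⟨h₂, e₂⟩ := pt_add_self h hy hm
  rw [show 3 • pt h = pt h + (pt h + pt h) by abel, e₂] at e
  have hx : x ≠ m ^ 2 - x - x := by
    intro hx
    have hy' : -(m * (m ^ 2 - x - x - x) + y) = -y := by linear_combination m * hx
    refine pt_ne_zero h' ?_
    rw [e]
    exact pt_add_neg h h₂ hx (by rw [hy', neg_neg])
  obtain ⟨n, hn⟩ : ∃ n, n * (x - (m ^ 2 - x - x)) = y - -(m * (m ^ 2 - x - x - x) + y) :=
    ⟨_, div_mul_cancel₀ _ (sub_ne_zero.2 hx)⟩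
  obtain ⟨h₃, e₃⟩ := pt_add_of_ne h h₂ hx hn
  rw [e₃, pt_inj] at e
  have hX := e.1
  obtain ⟨ψ, hψ⟩ : ∃ ψ, ψ = 3 * x ^ 4 - 6 * x ^ 2 - 1 := ⟨_, rfl⟩
  have h5 : 4 * y ^ 2 * (x - (m ^ 2 - x - x)) = ψ := by
    rw [hψ]
    linear_combination -(m * (2 * y) + 3 * x ^ 2 - 1) * hm + 12 * x * h
  have h6 : (n + m) * ψ = 8 * y ^ 3 := by
    rw [← h5]
    linear_combination 4 * y ^ 2 * hn
  rw [← hψ]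
  have h7 : X = (n + m) ^ 2 - 2 * (n + m) * m + x := by rw [hX]; ring
  have h8 : X * ψ ^ 2 = 64 * y ^ 6 - 8 * y ^ 2 * (3 * x ^ 2 - 1) * ψ + x * ψ ^ 2 := by
    rw [h7]
    linear_combination ((n + m) * ψ + 8 * y ^ 3 - 2 * m * ψ) * h6 - 8 * y ^ 2 * ψ * hm
  rw [h8, show y ^ 6 = (y ^ 2) ^ 3 by ring, h, hψ]
  ring

lemma norm_of_three_nsmul {x X : PadicAlgCl 3}
    (h : X * (3 * x ^ 4 - 6 * x ^ 2 - 1) ^ 2 =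
      x ^ 9 + 12 * x ^ 7 + 30 * x ^ 5 - 36 * x ^ 3 + 9 * x) (hx : 1 < ‖x‖) (hx3 : 3 ≤ ‖x‖ ^ 3) :
    9 * ‖x‖ ≤ ‖X‖ := by
  have hn (n : ℕ) : ‖(n : PadicAlgCl 3)‖ ≤ 1 := IsUltrametricDist.norm_natCast_le_one _ _
  obtain ⟨r, hr⟩ : ∃ r, r = ‖x‖ := ⟨_, rfl⟩
  rw [← hr] at hx hx3 ⊢
  have hr0 : 0 < r := by linarith
  have hr4 : 3 ≤ r ^ 4 := by nlinarith
  have hr2 : r ^ 2 ≤ r ^ 4 := pow_le_pow_right₀ hx.le (by norm_num)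
  have hψ : ‖3 * x ^ 4 - 6 * x ^ 2 - 1‖ ≤ r ^ 4 / 3 := by
    rw [sub_sub, sub_eq_add_neg]
    refine ultra_add_le ?_ ?_
    · rw [norm_mul, norm_algebraMap_three, norm_pow, hr]; linarith
    · rw [norm_neg]
      refine ultra_add_le ?_ ?_
      · rw [show (6 : PadicAlgCl 3) = 3 * 2 by norm_num, norm_mul, norm_mul, norm_algebraMap_three,
          norm_algebraMap_two, norm_pow, ← hr]
        linarith
      · rw [norm_one]; linarith
  have hm (n k : ℕ) (hk : k ≤ 7) : ‖(n : PadicAlgCl 3) * x ^ k‖ ≤ r ^ 7 := by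
    rw [norm_mul, norm_pow, ← hr]
    calc _ ≤ 1 * r ^ k := by gcongr; exact hn n
      _ ≤ r ^ 7 := by rw [one_mul]; exact pow_le_pow_right₀ hx.le hk
  have hφ : ‖x ^ 9 + 12 * x ^ 7 + 30 * x ^ 5 - 36 * x ^ 3 + 9 * x‖ = r ^ 9 := by
    rw [show x ^ 9 + 12 * x ^ 7 + 30 * x ^ 5 - 36 * x ^ 3 + 9 * x = x ^ 9 + (((12 : ℕ) * x ^ 7 +
      (30 : ℕ) * x ^ 5) + (-((36 : ℕ) * x ^ 3) + (9 : ℕ) * x ^ 1)) by push_cast; ring,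
      ultra_add_eq, norm_pow, hr]
    refine (ultra_add_le (ultra_add_le (hm _ _ le_rfl) (hm _ _ (by norm_num)))
      (ultra_add_le ?_ (hm _ _ (by norm_num)))).trans_lt ?_
    · rw [norm_neg]; exact hm _ _ (by norm_num)
    · rw [norm_pow, ← hr]
      exact pow_lt_pow_right₀ hx (by norm_num)
  have h1 := congrArg norm h
  rw [hφ, norm_mul, norm_pow] at h1
  have h2 : r ^ 9 ≤ ‖X‖ * (r ^ 4 / 3) ^ 2 := by rw [← h1]; gcongr
  have h3 : 0 < r ^ 8 := by positivity
  refine le_of_mul_le_mul_right ?_ h3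
  calc 9 * r * r ^ 8 = 9 * r ^ 9 := by ring
    _ ≤ 9 * (‖X‖ * (r ^ 4 / 3) ^ 2) := by gcongr
    _ = _ := by ring

namespace KummerData

variable {a : ℕ} {L : Type*} [Field L] [CharZero L] [DecidableEq L] {S : KummerData a L}
  {D : ℚ} {δ : L} {ε : ℤ}

omit [DecidableEq L] in
lemma three_le_norm_cube {X : L} (hX : S.τ X = X) (h : 1 < ‖S.φ X‖) : 3 ≤ ‖S.φ X‖ ^ 3 := by
  obtain ⟨A, B, C, hA⟩ := S.exists_of_τ (y := X⁻¹) (by rw [map_inv₀, hX])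
  have h1 := S.norm_cube_le A B C
  rw [← hA, map_inv₀, norm_inv, inv_pow] at h1
  have := h1 (inv_lt_one_of_one_lt₀ h)
  exact (inv_le_inv₀ (by positivity) (by norm_num)).1 this

lemma IsTwist.nine_pow_le (T : S.IsTwist D δ ε) (ha : Admissible a) (n : ℕ)
    {P : (Ecurve L).Point} (hτ : map S.τ P = ε • P) (hP : P ∈ S.traceKer) {X Y : L}
    {h : Y ^ 2 = X ^ 3 - X} (e : 2 • P = pt h) : 9 ^ n ≤ ‖S.φ X‖ := by
  induction n generalizing P X Y with
  | zero =>
    obtain ⟨X', Y', h', e', -, -, hX⟩ := T.exists_two_nsmul_pt hτ (by rw [e]; exact pt_ne_zero h)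
    rw [e, pt_inj] at e'
    rw [pow_zero, e'.1]
    exact hX.le
  | succ n ih =>
    obtain ⟨Q, hQ, hQτ, rfl⟩ := T.exists_three_nsmul ha hτ hP
    rw [smul_comm] at e
    obtain ⟨X', Y', h', e', hX', -, h1⟩ := T.exists_two_nsmul_pt hQτ (by
      intro h0; rw [h0, smul_zero] at e; exact pt_ne_zero h e.symm)
    have hY' : Y' ≠ 0 := by
      rintro rfl
      have h2 : S.φ X' ^ 2 = 1 := by
        have h3 : X' ≠ 0 := by rintro rfl; simp at h1; linarith
        rw [← map_pow, ← map_one S.φ]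
        congr 1
        apply mul_left_cancel₀ h3
        linear_combination -h'
      have h3 := congrArg norm h2
      rw [norm_pow, norm_one] at h3
      nlinarith
    rw [e'] at e
    have h2 := congrArg S.φ (mul_eq_of_three_nsmul hY' e.symm)
    simp only [map_mul, map_sub, map_add, map_pow, map_one, map_ofNat] at h2
    have h3 := norm_of_three_nsmul h2 h1 (three_le_norm_cube hX' h1)
    have h4 := ih hQτ hQ e'
    rw [pow_succ]
    linarith

lemma IsTwist.two_nsmul_eq_zero_of_mem (T : S.IsTwist D δ ε) (ha : Admissible a)
    {P : (Ecurve L).Point} (hτ : map S.τ P = ε • P) (hP : P ∈ S.traceKer) : 2 • P = 0 := by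
  rcases eq_zero_or_pt (2 • P) with h | ⟨X, Y, h, e⟩
  · exact h
  · obtain ⟨n, hn⟩ := pow_unbounded_of_one_lt ‖S.φ X‖ (by norm_num : (1 : ℝ) < 9)
    exact absurd (T.nine_pow_le ha n hτ hP e) (not_le.2 hn)

theorem twelve_nsmul_eq_zero (S : KummerData a L) (ha : Admissible a) (V : (Ecurve L).Point) :
    12 • V = 0 := by
  have hW : 2 • V - map S.σ V - map S.σ (map S.σ V) ∈ S.traceKer := by
    rw [mem_traceKer]
    simp only [map_sub, map_nsmul, map_σ_σ_σ]
    abel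
  obtain ⟨W, hV⟩ : ∃ W, W = 2 • V - map S.σ V - map S.σ (map S.σ V) := ⟨_, rfl⟩
  rw [← hV] at hW
  have hτ := map_τ_mem hW
  have h₁ := (isTwist_one (S := S)).two_nsmul_eq_zero_of_mem ha (P := W + map S.τ W)
    (by rw [map_add, map_τ_τ, one_smul, add_comm]) (add_mem hW hτ)
  have h₂ := (isTwist_neg_three (S := S)).two_nsmul_eq_zero_of_mem ha (P := W - map S.τ W)
    (by rw [map_sub, map_τ_τ, neg_one_smul, neg_sub]) (sub_mem hW hτ)
  calc 12 • V = 4 • (V + map S.σ V + map S.σ (map S.σ V)) +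
        4 • (2 • V - map S.σ V - map S.σ (map S.σ V)) := by abel
    _ = 2 • (W + map S.τ W) + 2 • (W - map S.τ W) := by
      rw [four_nsmul_mem, zero_add, ← hV]; abel
    _ = 0 := by rw [h₁, h₂, add_zero]

end KummerData

end

section

open TernaryCubic

local notation "α" => algebraMap ℚ_[3] (PadicAlgCl 3)

lemma norm_cube_sub_self_le {q : ℚ_[3]} (h : ‖q‖ ≤ 1) : ‖q ^ 3 - q‖ ≤ 3⁻¹ := by
  have h2 : ‖q ^ 2 - 1‖ ≤ 1 := by
    rw [sub_eq_add_neg]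
    refine ultra_add_le ?_ (by rw [norm_neg, norm_one])
    rw [norm_pow]; exact pow_le_one₀ (norm_nonneg _) h
  rw [show q ^ 3 - q = q * (q ^ 2 - 1) by ring, norm_mul]
  rcases h.lt_or_eq with h1 | h1
  · exact (mul_le_of_le_one_right (norm_nonneg _) h2).trans (norm_le_inv_three h1)
  · rw [h1, one_mul]; exact norm_sq_sub_one h1

lemma exists_cbrt_norm {a : ℚ_[3]} (ha : ‖a‖ = 1) : ∃ l : PadicAlgCl 3, l ^ 3 = α a ∧
    ∀ A B C : ℚ_[3], (‖quad l A B C‖ ≤ 1 → ‖quad l A B C ^ 3 - quad l A B C‖ ^ 3 ≤ 3⁻¹) ∧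
      (‖quad l A B C‖ < 1 → ‖quad l A B C‖ ^ 3 ≤ 3⁻¹) := by
  by_cases hn : ∀ y, y ^ 3 ≠ a
  · obtain ⟨l, hl⟩ := IsAlgClosed.exists_pow_nat_eq (α a) (by norm_num : 0 < 3)
    refine ⟨l, hl, fun A B C => ?_⟩
    have hmax := norm_quad_sub ha hn hl (A + a * B + a ^ 2 * C) (B + 2 * a * C) C
    have hπ := norm_cbrt_sub ha hn hl
    rw [quad_eq_sub (a := a)]
    generalize A + a * B + a ^ 2 * C = b₀ at *
    generalize B + 2 * a * C = b₁ at *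
    generalize l - α a = π at *
    obtain ⟨r, hr⟩ : ∃ r, r = ‖π‖ := ⟨_, rfl⟩
    rw [← hr] at hmax hπ
    have hr0 : 0 ≤ r := by rw [hr]; exact norm_nonneg _
    have hr1 : r < 1 := by
      by_contra hc
      have := one_le_pow₀ (n := 3) (not_lt.1 hc)
      rw [hπ] at this
      norm_num at this
    have hr2 : 3⁻¹ < r := by nlinarith
    have hr3 : 3⁻¹ < r ^ 2 := by nlinarith
    obtain ⟨v, hv⟩ : ∃ v, v = α b₁ * π + α C * π ^ 2 := ⟨_, rfl⟩
    obtain ⟨z, hz⟩ : ∃ z, z = α b₀ + α b₁ * π + α C * π ^ 2 := ⟨_, rfl⟩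
    have hzv : z = α b₀ + v := by rw [hz, hv, add_assoc]
    rw [← hz] at hmax ⊢
    have key (h : ‖z‖ ≤ 1) : ‖b₀‖ ≤ ‖z‖ ∧ ‖v‖ ≤ r := by
      have h0 : ‖b₀‖ ≤ ‖z‖ := by rw [hmax]; exact (le_max_left _ _).trans (le_max_left _ _)
      have h1 : ‖b₁‖ * r ≤ ‖z‖ := by rw [hmax]; exact (le_max_right _ _).trans (le_max_left _ _)
      have h2 : ‖C‖ * r ^ 2 ≤ ‖z‖ := by rw [hmax]; exact le_max_right _ _
      have hb : ‖b₁‖ ≤ 1 := by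
        by_contra hc
        have := three_le_norm (not_le.1 hc)
        nlinarith
      have hC : ‖C‖ ≤ 1 := by
        by_contra hc
        have := three_le_norm (not_le.1 hc)
        nlinarith
      refine ⟨h0, ?_⟩
      rw [hv]
      refine ultra_add_le ?_ ?_
      · rw [norm_mul, PadicAlgCl.norm_extends, ← hr]
        exact mul_le_of_le_one_left hr0 hb
      · rw [norm_mul, PadicAlgCl.norm_extends, norm_pow, ← hr]
        nlinarith [norm_nonneg C]
    refine ⟨fun h => ?_, fun h => ?_⟩ <;> rw [← hπ]
    · obtain ⟨h0, hvr⟩ := key h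
      gcongr
      have e : z ^ 3 - z = α (b₀ ^ 3 - b₀) +
          v * (3 * (α b₀ ^ 2 + α b₀ * v) + (v ^ 2 + -1)) := by
        rw [hzv, map_sub, map_pow]; ring
      have n0 : ‖α b₀‖ ≤ 1 := by rw [PadicAlgCl.norm_extends]; exact h0.trans h
      have n1 : ‖v‖ ≤ 1 := hvr.trans hr1.le
      rw [e]
      refine ultra_add_le ?_ ?_
      · rw [PadicAlgCl.norm_extends]
        exact (norm_cube_sub_self_le (h0.trans h)).trans hr2.le
      · rw [norm_mul]
        refine (mul_le_of_le_one_right (norm_nonneg _) ?_).trans hvr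
        refine ultra_add_le ?_ (ultra_add_le ?_ ?_)
        · rw [norm_mul, norm_algebraMap_three]
          have : ‖α b₀ ^ 2 + α b₀ * v‖ ≤ 1 := by
            refine ultra_add_le ?_ ?_
            · rw [norm_pow]; exact pow_le_one₀ (norm_nonneg _) n0
            · rw [norm_mul]; exact mul_le_one₀ n0 (norm_nonneg _) n1
          linarith
        · rw [norm_pow]; exact pow_le_one₀ (norm_nonneg _) n1
        · rw [norm_neg, norm_one]
    · obtain ⟨h0, hvr⟩ := key h.le
      gcongr
      rw [hzv]
      refine ultra_add_le ?_ hvr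
      rw [PadicAlgCl.norm_extends]
      exact (norm_le_inv_three (h0.trans_lt h)).trans hr2.le
  · push Not at hn
    obtain ⟨y, rfl⟩ := hn
    refine ⟨α y, by rw [map_pow], fun A B C => ?_⟩
    have e : quad (α y) A B C = α (A + B * y + C * y ^ 2) := by
      simp only [quad, map_add, map_mul, map_pow]
    rw [e, ← map_pow, ← map_sub, PadicAlgCl.norm_extends, PadicAlgCl.norm_extends]
    refine ⟨fun h => ?_, fun h => ?_⟩
    · calc _ ≤ (3⁻¹ : ℝ) ^ 3 := by gcongr; exact norm_cube_sub_self_le h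
        _ ≤ 3⁻¹ := by norm_num
    · calc _ ≤ (3⁻¹ : ℝ) ^ 3 := by gcongr; exact norm_le_inv_three h
        _ ≤ 3⁻¹ := by norm_num

end

section

open IntermediateField

section

variable {E : Type*} [Field E] [CharZero E] {a : ℕ} {w l : E}

lemma exists_eq_of_mem_adjoin (hw : w ^ 2 + w + 1 = 0) (hl : l ^ 3 = a) {y : E}
    (hy : y ∈ adjoin ℚ {w, l}) : ∃ A B C A' B' C' : ℚ,
      y = A + B * l + C * l ^ 2 + w * (A' + B' * l + C' * l ^ 2) := by
  have halg : ∀ x ∈ ({w, l} : Set E), IsAlgebraic ℚ x := by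
    rintro x (rfl | rfl)
    · exact (IsIntegral.isAlgebraic (isIntegral_cbrt (a := (1 : ℚ))
        (by rw [map_one]; linear_combination (x - 1) * hw)))
    · exact (IsIntegral.isAlgebraic (isIntegral_cbrt (a := (a : ℚ)) (by simpa using hl)))
  rw [← mem_toSubalgebra, adjoin_toSubalgebra_of_isAlgebraic halg] at hy
  induction hy using Algebra.adjoin_induction with
  | mem x hx =>
    rcases hx with rfl | rfl
    exacts [⟨0, 0, 0, 1, 0, 0, by simp⟩, ⟨0, 1, 0, 0, 0, 0, by simp⟩]
  | algebraMap r => exact ⟨r, 0, 0, 0, 0, 0, by simp⟩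
  | add x y _ _ hx hy =>
    obtain ⟨A, B, C, A', B', C', rfl⟩ := hx
    obtain ⟨D, E, F, D', E', F', rfl⟩ := hy
    exact ⟨A + D, B + E, C + F, A' + D', B' + E', C' + F', by push_cast; ring⟩
  | mul x y _ _ hx hy =>
    have hmul (A B C D E' F : ℚ) : (A + B * l + C * l ^ 2 : E) * (D + E' * l + F * l ^ 2) =
        ((A * D + a * (B * F + C * E') : ℚ) : E) + (A * E' + B * D + a * (C * F) : ℚ) * l +
          (A * F + B * E' + C * D : ℚ) * l ^ 2 := by
      push_cast; linear_combination (B * F + C * E' + C * F * l) * hl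
    obtain ⟨A, B, C, A', B', C', rfl⟩ := hx
    obtain ⟨D, E, F, D', E', F', rfl⟩ := hy
    have h1 := hmul A B C D E F
    have h2 := hmul A' B' C' D' E' F'
    have h3 := hmul A B C D' E' F'
    have h4 := hmul A' B' C' D E F
    refine ⟨(A * D + a * (B * F + C * E)) - (A' * D' + a * (B' * F' + C' * E')),
      (A * E + B * D + a * (C * F)) - (A' * E' + B' * D' + a * (C' * F')),
      (A * F + B * E + C * D) - (A' * F' + B' * E' + C' * D'),
      (A * D' + a * (B * F' + C * E')) + (A' * D + a * (B' * F + C' * E)) -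
        (A' * D' + a * (B' * F' + C' * E')),
      (A * E' + B * D' + a * (C * F')) + (A' * E + B' * D + a * (C' * F)) -
        (A' * E' + B' * D' + a * (C' * F')),
      (A * F' + B * E' + C * D') + (A' * F + B' * E + C' * D) -
        (A' * F' + B' * E' + C' * D'), ?_⟩
    push_cast at h1 h2 h3 h4 ⊢
    linear_combination h1 + w * h3 + w * h4 - (1 + w) * h2 +
      (A' + B' * l + C' * l ^ 2) * (D' + E' * l + F' * l ^ 2) * hw

lemma cube_ne_of_mem_adjoin (hw : w ^ 2 + w + 1 = 0) (hn : ∀ y : ℚ, y ^ 3 ≠ a) (y : ℚ⟮w⟯) :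
    y ^ 3 ≠ ((a : ℕ) : ℚ⟮w⟯) := by
  intro h
  have hi : IsIntegral ℚ w := isIntegral_cbrt (a := (1 : ℚ))
    (by rw [map_one]; linear_combination (w - 1) * hw)
  have := adjoin.finiteDimensional hi
  have h1 := minpoly.natDegree_le (A := ℚ) y
  rw [adjoin.finrank hi, minpoly_cbrt (a := (a : ℚ)) hn (by simpa using h),
    Polynomial.natDegree_X_pow_sub_C] at h1
  have hp : (Polynomial.X ^ 2 + Polynomial.X + 1 : Polynomial ℚ).Monic := by monicity!
  have h2 := Polynomial.natDegree_le_natDegree (minpoly.min ℚ w hp (by simpa using hw))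
  have h3 : (Polynomial.X ^ 2 + Polynomial.X + 1 : Polynomial ℚ).natDegree ≤ 2 := by
    compute_degree
  omega

variable (w l) in
/-- The restriction of an embedding of `ℚ(w, l)` to an endomorphism. -/
noncomputable def restrictEnd (hw : w ^ 2 + w + 1 = 0) (hl : l ^ 3 = a)
    (g : adjoin ℚ {w, l} →+* E) (gw : g ⟨w, subset_adjoin _ _ (by simp)⟩ ∈ adjoin ℚ {w, l})
    (gl : g ⟨l, subset_adjoin _ _ (by simp)⟩ ∈ adjoin ℚ {w, l}) :
    adjoin ℚ {w, l} →+* adjoin ℚ {w, l} :=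
  g.codRestrict (adjoin ℚ {w, l}) (by
    rintro ⟨y, hy⟩
    obtain ⟨A, B, C, A', B', C', h⟩ := exists_eq_of_mem_adjoin hw hl hy
    have : (⟨y, hy⟩ : adjoin ℚ {w, l}) = A + B * ⟨l, subset_adjoin _ _ (by simp)⟩ +
      C * ⟨l, subset_adjoin _ _ (by simp)⟩ ^ 2 + ⟨w, subset_adjoin _ _ (by simp)⟩ * (A' +
        B' * ⟨l, subset_adjoin _ _ (by simp)⟩ + C' * ⟨l, subset_adjoin _ _ (by simp)⟩ ^ 2) := by
      ext; simpa using h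
    rw [this]
    simp only [map_add, map_mul, map_pow, map_ratCast]
    have hr (q : ℚ) : (q : E) ∈ adjoin ℚ {w, l} := (adjoin ℚ {w, l}).algebraMap_mem q
    exact add_mem (add_mem (add_mem (hr _) (mul_mem (hr _) gl)) (mul_mem (hr _) (pow_mem gl _)))
      (mul_mem gw (add_mem (add_mem (hr _) (mul_mem (hr _) gl)) (mul_mem (hr _) (pow_mem gl _)))))

end

end

section

open IntermediateField

section

variable {E : Type*} [Field E] [CharZero E] {a : ℕ} {w l : E}

lemma exists_hom_adjoin (hw : w ^ 2 + w + 1 = 0) (hl : l ^ 3 = a) (hn : ∀ y : ℚ, y ^ 3 ≠ a) :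
    ∃ g : adjoin ℚ {w, l} →+* E, g ⟨w, subset_adjoin _ _ (by simp)⟩ = w ∧
      g ⟨l, subset_adjoin _ _ (by simp)⟩ = w * l := by
  have hl' : l ^ 3 = algebraMap ℚ⟮w⟯ E (a : ℚ⟮w⟯) := by simpa using hl
  have hi := isIntegral_cbrt hl'
  have hm : w * l ∈ (minpoly ℚ⟮w⟯ l).aroots E := by
    rw [Polynomial.mem_aroots, minpoly_cbrt (cube_ne_of_mem_adjoin hw hn) hl']
    refine ⟨Polynomial.X_pow_sub_C_ne_zero (by norm_num) _, ?_⟩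
    simp only [map_sub, map_pow, Polynomial.aeval_X, map_natCast]
    linear_combination l ^ 3 * (w - 1) * hw + hl
  obtain ⟨f, fl⟩ : ∃ f : ℚ⟮w⟯⟮l⟯ →ₐ[ℚ⟮w⟯] E, f (AdjoinSimple.gen ℚ⟮w⟯ l) = w * l :=
    ⟨_, algHomAdjoinIntegralEquiv_symm_apply_gen _ hi ⟨_, hm⟩⟩
  have fw : f (algebraMap _ _ (AdjoinSimple.gen ℚ w)) = w := f.commutes _
  have hmem (x : E) (hx : x ∈ adjoin ℚ {w, l}) : x ∈ ℚ⟮w⟯⟮l⟯ := by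
    have hle : adjoin ℚ {w, l} ≤ ℚ⟮w⟯⟮l⟯.restrictScalars ℚ := by
      rw [adjoin_le_iff]
      rintro x (rfl | rfl)
      · exact (algebraMap ℚ⟮x⟯ ℚ⟮x⟯⟮l⟯ (AdjoinSimple.gen ℚ x)).2
      · exact mem_adjoin_simple_self ℚ⟮w⟯ x
    exact hle hx
  let i : adjoin ℚ {w, l} →+* ℚ⟮w⟯⟮l⟯ := (algebraMap (adjoin ℚ {w, l}) E).codRestrict _
    fun x => hmem x x.2
  exact ⟨f.toRingHom.comp i, fw, fl⟩

lemma exists_end_adjoin_one (hw : w ^ 2 + w + 1 = 0) (hl : l ^ 3 = a)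
    (hn : ∀ y : ℚ, y ^ 3 ≠ a) :
    ∃ σ : adjoin ℚ {w, l} →+* adjoin ℚ {w, l}, ((σ ⟨w, subset_adjoin _ _ (by simp)⟩ : E) = w) ∧
      (σ ⟨l, subset_adjoin _ _ (by simp)⟩ : E) = w * l := by
  obtain ⟨g, gw, gl⟩ := exists_hom_adjoin hw hl hn
  refine ⟨restrictEnd w l hw hl g ?_ ?_, gw, gl⟩
  · rw [gw]; exact subset_adjoin _ _ (by simp)
  · rw [gl]; exact mul_mem (subset_adjoin _ _ (by simp)) (subset_adjoin _ _ (by simp))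

end

lemma conj_eq_sq {w : ℂ} (hw : w ^ 2 + w + 1 = 0) : starRingEnd ℂ w = w ^ 2 := by
  have h3 : w ^ 3 = 1 := by linear_combination (w - 1) * hw
  have h0 : w ≠ 0 := by rintro rfl; norm_num at hw
  have hnorm : ‖w‖ = 1 := Complex.norm_eq_one_of_pow_eq_one h3 (by norm_num)
  have : starRingEnd ℂ w * w = 1 := by
    rw [mul_comm, Complex.mul_conj, Complex.normSq_eq_norm_sq, hnorm]; norm_num
  refine mul_right_cancel₀ h0 ?_
  rw [this, ← h3]; ring

lemma exists_end_adjoin_conj {a : ℕ} {w : ℂ} {r : ℝ} (hw : w ^ 2 + w + 1 = 0)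
    (hl : (r : ℂ) ^ 3 = a) :
    ∃ τ : adjoin ℚ {w, (r : ℂ)} →+* adjoin ℚ {w, (r : ℂ)},
      ((τ ⟨w, subset_adjoin _ _ (by simp)⟩ : ℂ) = w ^ 2) ∧
      (τ ⟨r, subset_adjoin _ _ (by simp)⟩ : ℂ) = r := by
  have gw : (starRingEnd ℂ).comp (algebraMap (adjoin ℚ {w, (r : ℂ)}) ℂ)
    ⟨w, subset_adjoin _ _ (by simp)⟩ = w ^ 2 := conj_eq_sq hw
  have gl : (starRingEnd ℂ).comp (algebraMap (adjoin ℚ {w, (r : ℂ)}) ℂ)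
    ⟨r, subset_adjoin _ _ (by simp)⟩ = r := Complex.conj_ofReal r
  refine ⟨restrictEnd w r hw hl _ ?_ ?_, gw, gl⟩
  · rw [gw]; exact pow_mem (subset_adjoin _ _ (by simp)) _
  · rw [gl]; exact subset_adjoin _ _ (by simp)

lemma cube_ne_of_cubefree {a : ℕ} (ha : 1 < a) (hc : ∀ p : ℕ, p.Prime → ¬ p ^ 3 ∣ a) (y : ℚ) :
    y ^ 3 ≠ a := by
  intro h
  have hy : IsIntegral ℤ y := by
    refine .of_pow (n := 3) (by norm_num) ?_
    rw [h]
    exact isIntegral_algebraMap (x := (a : ℤ))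
  obtain ⟨z, rfl⟩ := IsIntegrallyClosed.isIntegral_iff.mp hy
  have h1 : z ^ 3 = a := by rw [eq_intCast] at h; exact_mod_cast h
  have h2 : z.natAbs ^ 3 = a := by rw [← Int.natAbs_pow, h1, Int.natAbs_natCast]
  have h3 : z.natAbs ≠ 1 := by intro h4; rw [h4] at h2; omega
  obtain ⟨p, hp, hd⟩ := Nat.exists_prime_and_dvd h3
  exact hc p hp (h2 ▸ pow_dvd_pow_of_dvd hd 3)

/-- Embeddings in `ℚ̄₃` can be prescribed on a cube root. -/
lemma exists_hom_padicAlgCl {L : Type*} [Field L] [CharZero L] [Algebra.IsAlgebraic ℚ L] {a : ℕ}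
    {ω l : L} (hω : ω ^ 2 + ω + 1 = 0) (hl : l ^ 3 = a) {σ : L →+* L} (σω : σ ω = ω)
    (σl : σ l = ω * l) {l₀ : PadicAlgCl 3} (hl₀ : l₀ ^ 3 = a) :
    ∃ φ : L →+* PadicAlgCl 3, φ l = l₀ := by
  let φ : L →ₐ[ℚ] PadicAlgCl 3 := IsAlgClosed.lift
  have h1 : φ l ^ 3 = a := by rw [← map_pow, hl, map_natCast]
  have h2 : φ ω ^ 2 + φ ω + 1 = 0 := by
    rw [← map_pow, ← map_add, ← map_one φ, ← map_add, hω, map_zero]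
  have h3 : (l₀ - φ l) * ((l₀ - φ ω * φ l) * (l₀ - φ ω * (φ ω * φ l))) = 0 := by
    linear_combination hl₀ - h1 + (-l₀ ^ 2 * φ l + l₀ * φ l ^ 2 * φ ω - φ l ^ 3 * (φ ω - 1)) * h2
  rcases mul_eq_zero.mp h3 with h | h
  · exact ⟨φ, (sub_eq_zero.mp h).symm⟩
  rcases mul_eq_zero.mp h with h | h
  · exact ⟨φ.toRingHom.comp σ, by simpa [σl] using (sub_eq_zero.mp h).symm⟩
  · exact ⟨φ.toRingHom.comp (σ.comp σ), by simpa [σl, σω] using (sub_eq_zero.mp h).symm⟩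

end

section

open IntermediateField

lemma exists_kummerData {a : ℕ} (ha : KummerData.Admissible a) {w : ℂ} {r : ℝ}
    (hw : w ^ 2 + w + 1 = 0) (hl : (r : ℂ) ^ 3 = a) :
    Nonempty (KummerData a (adjoin ℚ {w, (r : ℂ)})) := by
  have hn := cube_ne_of_cubefree ha.one_lt ha.cube_free
  obtain ⟨σ, σω, σl⟩ := exists_end_adjoin_one hw hl hn
  obtain ⟨τ, τω, τl⟩ := exists_end_adjoin_conj hw hl
  obtain ⟨ω, hωw⟩ : ∃ ω : adjoin ℚ {w, (r : ℂ)}, ω = ⟨w, subset_adjoin _ _ (by simp)⟩ := ⟨_, rfl⟩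
  obtain ⟨l, hlr⟩ : ∃ l : adjoin ℚ {w, (r : ℂ)}, l = ⟨r, subset_adjoin _ _ (by simp)⟩ := ⟨_, rfl⟩
  rw [← hωw] at σω τω
  rw [← hlr] at σl τl
  have eω : (ω : ℂ) = w := by rw [hωw]
  have el : (l : ℂ) = r := by rw [hlr]
  have σω' : σ ω = ω := Subtype.ext (by rw [σω, eω])
  have τω' : τ ω = ω ^ 2 := Subtype.ext (by simp [τω, eω])
  have σl' : σ l = ω * l := Subtype.ext (by simp [σl, eω, el])
  have τl' : τ l = l := Subtype.ext (by rw [τl, el])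
  have hω : ω ^ 2 + ω + 1 = 0 := Subtype.ext (by simpa [eω] using hw)
  have hl' : l ^ 3 = a := Subtype.ext (by simpa [el] using hl)
  have hspan (y : adjoin ℚ {w, (r : ℂ)}) : ∃ A B C A' B' C' : ℚ,
      y = A + B * l + C * l ^ 2 + ω * (A' + B' * l + C' * l ^ 2) := by
    obtain ⟨A, B, C, A', B', C', h⟩ := exists_eq_of_mem_adjoin hw hl y.2
    exact ⟨A, B, C, A', B', C', Subtype.ext (by simpa [eω, el] using h)⟩
  have : Algebra.IsAlgebraic ℚ (adjoin ℚ {w, (r : ℂ)}) := by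
    refine isAlgebraic_adjoin ?_
    rintro x (rfl | rfl)
    · exact isIntegral_cbrt (a := (1 : ℚ)) (by rw [map_one]; linear_combination (x - 1) * hw)
    · exact isIntegral_cbrt (a := (a : ℚ)) (by simpa using hl)
  have hna : ‖(a : ℚ_[3])‖ = 1 := by
    rw [Padic.norm_natCast_eq_one_iff, Nat.Prime.coprime_iff_not_dvd Nat.prime_three]
    exact fun h => (ha.factors 3 Nat.prime_three h).2.1 rfl
  obtain ⟨l₀, hl₀, h₀⟩ := exists_cbrt_norm hna
  obtain ⟨φ, hφ⟩ := exists_hom_padicAlgCl hω hl' σω' σl' (l₀ := l₀) (by rw [hl₀, map_natCast])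
  have eφ (A B C : ℚ) : φ (A + B * l + C * l ^ 2) = quad l₀ (A : ℚ_[3]) (B : ℚ_[3]) (C : ℚ_[3]) := by
    simp [quad, hφ]
  refine ⟨⟨ω, l, σ, τ, φ, hω, hl', hn, hspan, σω', σl', τω', τl', fun A B C => ?_,
    fun A B C => ?_⟩⟩
  · rw [eφ]; exact (h₀ A B C).1
  · rw [eφ]; exact (h₀ A B C).2

end

/-- Let `a > 1` be a cube-free integer all of whose prime factors `p` satisfy `p ∉ {2,3}` and
condition (P).  Then every point of `y² = x³ - x` over `ℚ(ζ₃, ∛a)` — the subfield of `ℂ`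
generated over `ℚ` by a primitive cube root of unity and the real cube root of `a` — is
torsion. -/
theorem rank_zero_over_Q_zeta3_cbrt_a (a : ℕ) (ha : 1 < a)
    (hcubefree : ∀ p : ℕ, p.Prime → ¬ p ^ 3 ∣ a)
    (hfac : ∀ p : ℕ, (hp : p.Prime) → p ∣ a → p ≠ 2 ∧ p ≠ 3 ∧ ConditionP p hp)
    (ζ : ℂ) (hζ : IsPrimitiveRoot ζ 3) :
    ∀ P : (Ecurve
        (IntermediateField.adjoin ℚ {ζ, (((a : ℝ) ^ ((1 : ℝ) / 3) : ℝ) : ℂ)} :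
          IntermediateField ℚ ℂ)).Point,
      ∃ n : ℤ, n ≠ 0 ∧ n • P = 0 := by
  intro P
  have hA : KummerData.Admissible a := ⟨ha, hcubefree, hfac⟩
  have hw : ζ ^ 2 + ζ + 1 = 0 := by
    refine mul_left_cancel₀ (sub_ne_zero.mpr (hζ.ne_one (by norm_num))) ?_
    linear_combination hζ.pow_eq_one
  have hl : (((a : ℝ) ^ ((1 : ℝ) / 3) : ℝ) : ℂ) ^ 3 = a := by
    rw [← Complex.ofReal_pow, ← Real.rpow_natCast, ← Real.rpow_mul (Nat.cast_nonneg _)]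
    norm_num
  obtain ⟨S⟩ := exists_kummerData hA hw hl
  refine ⟨12, by norm_num, ?_⟩
  rw [← S.twelve_nsmul_eq_zero hA P]
  exact ofNat_zsmul P 12
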